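/- arXiv:1411.3359 — 2 statements merged into one kernel-verified Lean document; each statement's English description precedes it below -/
import Mathlib

section
/- Set d₀ := (Σ_{i=1}^N t_i log t_i)/(Σ_{i=1}^N t_i log s_i). Then 0 < liminf_{n→∞} n^{1/d₀} e_{n,0}(μ) ≤ limsup_{n→∞} n^{1/d₀} e_{n,0}(μ) < ∞; in particular, the quantization dimension of order zero of μ exists and equals d₀, i.e. lim_{n→∞} (log n)/(−log e_{n,0}(μ)) = d₀. -/
open MeasureTheory Filter Metric

/-- The `n`-th geometric mean error (quantization error of order zero) of a Borel
probability measure `P` on `ℝ^q`. -/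
noncomputable def geomError {q : ℕ} (P : Measure (EuclideanSpace ℝ (Fin q))) (n : ℕ) : ℝ :=
  sInf {r : ℝ | ∃ α : Finset (EuclideanSpace ℝ (Fin q)), α.Nonempty ∧ α.card ≤ n ∧
    r = Real.exp (∫ x, Real.log (infDist x (↑α : Set (EuclideanSpace ℝ (Fin q)))) ∂P)}

namespace Quant

abbrev Eu (q : ℕ) := EuclideanSpace ℝ (Fin q)

lemma sim_eq {q : ℕ} {g : Eu q → Eu q} {r : ℝ} (hr : 0 < r)
    (h : ∀ x y, dist (g x) (g y) = r * dist x y) :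
    ∃ e : Eu q ≃ᵃⁱ[ℝ] Eu q, ∀ x, g x = r • e x := by
  have hi : Isometry (fun x => r⁻¹ • g x) := by
    apply Isometry.of_dist_eq
    intro x y
    rw [dist_smul₀, h, Real.norm_of_nonneg (by positivity)]
    field_simp
  let a := hi.affineIsometryOfStrictConvexSpace
  refine ⟨a.toAffineIsometryEquiv rfl, fun x => ?_⟩
  have : (a.toAffineIsometryEquiv rfl) x = r⁻¹ • g x := rfl
  rw [this, smul_smul, mul_inv_cancel₀ hr.ne', one_smul]

lemma sim_surj {q : ℕ} {g : Eu q → Eu q} {r : ℝ} (hr : 0 < r)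
    (h : ∀ x y, dist (g x) (g y) = r * dist x y) : Function.Surjective g := by
  obtain ⟨e, he⟩ := sim_eq hr h
  intro y
  refine ⟨e.symm (r⁻¹ • y), ?_⟩
  rw [he]
  simp [smul_smul, hr.ne']

lemma sim_inj {q : ℕ} {g : Eu q → Eu q} {r : ℝ} (hr : 0 < r)
    (h : ∀ x y, dist (g x) (g y) = r * dist x y) : Function.Injective g := by
  intro x y hxy
  have := h x y
  rw [hxy, dist_self] at this
  have h2 : dist x y = 0 := by
    rcases mul_eq_zero.1 this.symm with h | h
    · exact absurd h hr.ne'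
    · exact h
  exact dist_eq_zero.1 h2

lemma sim_cont {q : ℕ} {g : Eu q → Eu q} {r : ℝ} (hr : 0 < r)
    (h : ∀ x y, dist (g x) (g y) = r * dist x y) : Continuous g := by
  obtain ⟨e, he⟩ := sim_eq hr h
  have : g = fun x => r • e x := funext he
  rw [this]
  exact e.continuous.const_smul r

open scoped Pointwise in
lemma sim_infDist {q : ℕ} {g : Eu q → Eu q} {r : ℝ} (hr : 0 < r)
    (h : ∀ x y, dist (g x) (g y) = r * dist x y) (x : Eu q) (S : Set (Eu q)) :
    infDist (g x) (g '' S) = r * infDist x S := by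
  obtain ⟨e, he⟩ := sim_eq hr h
  have h1 : g '' S = r • (e '' S) := by
    rw [← Set.image_smul, Set.image_image]
    exact Set.image_congr (fun x _ => he x)
  rw [h1, he, infDist_smul₀ hr.ne', infDist_image e.isometry, Real.norm_of_nonneg hr.le]

section words
variable {q N : ℕ}

def F (f : Fin N → Eu q → Eu q) : List (Fin N) → Eu q → Eu q
  | [] => id
  | i :: w => f i ∘ F f w

def S (s : Fin N → ℝ) : List (Fin N) → ℝ
  | [] => 1
  | i :: w => s i * S s w

lemma F_append (f : Fin N → Eu q → Eu q) (u v : List (Fin N)) (x : Eu q) :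
    F f (u ++ v) x = F f u (F f v x) := by
  induction u with
  | nil => rfl
  | cons a u ih => simp [F, ih]

lemma S_append (s : Fin N → ℝ) (u v : List (Fin N)) : S s (u ++ v) = S s u * S s v := by
  induction u with
  | nil => simp [S]
  | cons a u ih => simp [S, ih, mul_assoc]

variable {s : Fin N → ℝ} {f : Fin N → Eu q → Eu q}

lemma S_pos (hs : ∀ i, 0 < s i) (w : List (Fin N)) : 0 < S s w := by
  induction w with
  | nil => simp [S]
  | cons a u ih => exact mul_pos (hs a) ih

lemma S_le_one (hs : ∀ i, s i ∈ Set.Ioo (0 : ℝ) 1) (w : List (Fin N)) : S s w ≤ 1 := by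
  induction w with
  | nil => simp [S]
  | cons a u ih =>
    exact mul_le_one₀ (hs a).2.le (S_pos (fun i => (hs i).1) _).le ih

lemma S_lt_one (hs : ∀ i, s i ∈ Set.Ioo (0 : ℝ) 1) (w : List (Fin N)) (hw : w ≠ []) :
    S s w < 1 := by
  cases w with
  | nil => exact absurd rfl hw
  | cons a u =>
    exact mul_lt_one_of_nonneg_of_lt_one_left (hs a).1.le (hs a).2 (S_le_one hs u)

lemma F_dist (hf : ∀ i x y, dist (f i x) (f i y) = s i * dist x y) (w : List (Fin N))
    (x y : Eu q) : dist (F f w x) (F f w y) = S s w * dist x y := by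
  induction w with
  | nil => simp [F, S]
  | cons a u ih => simp [F, S, hf, ih, mul_assoc]

lemma F_mem {U : Set (Eu q)} (hU : ∀ i, f i '' U ⊆ U) (w : List (Fin N)) {x : Eu q}
    (hx : x ∈ U) : F f w x ∈ U := by
  induction w with
  | nil => exact hx
  | cons a u ih => exact hU a ⟨_, ih, rfl⟩

lemma words_cases (u v : List (Fin N)) :
    (∃ w, v = u ++ w) ∨ (∃ w, u = v ++ w) ∨
    ∃ c a b u' v', a ≠ b ∧ u = c ++ a :: u' ∧ v = c ++ b :: v' := by
  induction u generalizing v with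
  | nil => left; exact ⟨v, rfl⟩
  | cons a u ih =>
    cases v with
    | nil => right; left; exact ⟨_, rfl⟩
    | cons b v =>
      by_cases hab : a = b
      · subst hab
        rcases ih v with ⟨w, h⟩ | ⟨w, h⟩ | ⟨c, x, y, u', v', h1, h2, h3⟩
        · left; exact ⟨w, by simp [h]⟩
        · right; left; exact ⟨w, by simp [h]⟩
        · right; right; exact ⟨a :: c, x, y, u', v', h1, by simp [h2], by simp [h3]⟩
      · right; right; exact ⟨[], a, b, u, v, hab, rfl, rfl⟩

/-- antichain -/
def Lam (s : Fin N → ℝ) (b : ℝ) : Set (List (Fin N)) :=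
  {i | S s i ≤ b ∧ ∃ w a, i = w ++ [a] ∧ b < S s w}

lemma Lam_antichain (hs : ∀ i, s i ∈ Set.Ioo (0 : ℝ) 1) {b : ℝ} {u v : List (Fin N)}
    (hu : u ∈ Lam s b) (hv : v ∈ Lam s b) (huv : u ≠ v) :
    ∃ c a b u' v', a ≠ b ∧ u = c ++ a :: u' ∧ v = c ++ b :: v' := by
  have key : ∀ u v : List (Fin N), u ∈ Lam s b → v ∈ Lam s b → u ≠ v → ¬ ∃ w, v = u ++ w := by
    rintro u v hu ⟨_, w, a, rfl, hw⟩ huv ⟨z, hz⟩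
    rcases List.eq_nil_or_concat z with rfl | ⟨z', c, rfl⟩
    · simp at hz; exact huv hz.symm
    · rw [List.concat_eq_append, ← List.append_assoc] at hz
      have := List.append_inj_left' hz rfl
      rw [this, S_append] at hw
      have h1 := S_le_one hs z'
      have h2 := S_pos (fun i => (hs i).1) u
      have := hu.1
      nlinarith
  rcases words_cases u v with h | h | h
  · exact absurd h (key u v hu hv huv)
  · exact absurd h (key v u hv hu huv.symm)
  · exact h

lemma exists_prefix {b : ℝ} (hb : b < 1) (w : List (Fin N)) (hw : S s w ≤ b) :
    ∃ i v, w = i ++ v ∧ i ∈ Lam s b := by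
  induction w using List.reverseRecOn with
  | nil => simp [S] at hw; linarith
  | append_singleton w a ih =>
    by_cases h : S s w ≤ b
    · obtain ⟨i, v, rfl, hi⟩ := ih h
      exact ⟨i, v ++ [a], by simp, hi⟩
    · exact ⟨w ++ [a], [], by simp, hw, w, a, rfl, not_le.1 h⟩

lemma F_disj (hs : ∀ i, s i ∈ Set.Ioo (0 : ℝ) 1)
    (hf : ∀ i x y, dist (f i x) (f i y) = s i * dist x y)
    {U : Set (Eu q)} (hU : ∀ i, f i '' U ⊆ U)
    (hd : ∀ i j, i ≠ j → Disjoint (f i '' U) (f j '' U)) {c : List (Fin N)} {a b : Fin N}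
    {u v : List (Fin N)} (hab : a ≠ b) {x y : Eu q} (hx : x ∈ U) (hy : y ∈ U) :
    F f (c ++ a :: u) x ≠ F f (c ++ b :: v) y := by
  intro h
  rw [F_append, F_append] at h
  have h2 := sim_inj (S_pos (fun i => (hs i).1) c) (F_dist hf c) h
  exact Set.disjoint_left.1 (hd a b hab) ⟨_, F_mem hU u hx, rfl⟩
    (by rw [show f a (F f u x) = F f (a :: u) x from rfl, h2]; exact ⟨_, F_mem hU v hy, rfl⟩)

lemma packing (q : ℕ) (C δ : ℝ) (hδ : 0 < δ) : ∃ M : ℕ, ∀ (ι : Type) (T : Finset ι) (y : ι → Eu q),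
    (∀ i ∈ T, ‖y i‖ ≤ C) → (∀ i ∈ T, ∀ j ∈ T, i ≠ j → δ ≤ dist (y i) (y j)) → T.card ≤ M := by
  obtain ⟨t, ht, hfin, hcov⟩ := (isCompact_closedBall (0 : Eu q) C).finite_cover_balls
    (half_pos hδ)
  refine ⟨hfin.toFinset.card, fun ι T y h1 h2 => ?_⟩
  have h3 : ∀ i ∈ T, ∃ c ∈ t, dist (y i) c < δ / 2 := by
    intro i hi
    have := hcov (show y i ∈ closedBall 0 C by simpa using h1 i hi)
    simpa using this
  choose! c hc hcd using h3
  apply Finset.card_le_card_of_injOn c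
  · intro i hi; simpa using hc i hi
  · intro i hi j hj hij
    by_contra hne
    have a1 := h2 i hi j hj hne
    have a2 := hcd i hi
    have a3 := hcd j hj
    rw [← hij] at a3
    have := dist_triangle_right (y i) (y j) (c i)
    linarith

theorem exists_V (hN : 2 ≤ N) (hs : ∀ i, s i ∈ Set.Ioo (0 : ℝ) 1)
    (hf : ∀ i x y, dist (f i x) (f i y) = s i * dist x y)
    (hOSC : ∃ U : Set (Eu q), U.Nonempty ∧ IsOpen U ∧
      Bornology.IsBounded U ∧
      (∀ i j, i ≠ j → Disjoint (f i '' U) (f j '' U)) ∧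
      (⋃ i, f i '' U) ⊆ U) :
    ∃ x0 : Eu q, ∀ ρ : ℝ, 0 < ρ → ∃ (V : Set (Eu q)) (k : List (Fin N)),
      (∀ i j, i ≠ j → Disjoint (f i '' V) (f j '' V)) ∧ (∀ i, f i '' V ⊆ V) ∧
      ball (F f k x0) (ρ * S s k) ⊆ V := by
  obtain ⟨U, ⟨x0, hx0⟩, hUo, hUb, hUd, hUs⟩ := hOSC
  have hU : ∀ i, f i '' U ⊆ U := fun i => (Set.subset_iUnion (fun i => f i '' U) i).trans hUs
  have hs0 : ∀ i, 0 < s i := fun i => (hs i).1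
  refine ⟨x0, fun ρ hρ => ?_⟩
  obtain ⟨r, hr, hrU⟩ := Metric.isOpen_iff.1 hUo x0 hx0
  obtain ⟨D, hD⟩ := Metric.isBounded_iff.1 hUb
  have hD0 : 0 ≤ D := by simpa using hD hx0 hx0
  have i0 : Fin N := ⟨0, by omega⟩
  obtain ⟨im, -, him⟩ := Finset.exists_min_image Finset.univ s ⟨i0, Finset.mem_univ _⟩
  set C := 2 * ρ + D with hC
  let I : List (Fin N) → Set (List (Fin N)) := fun k =>
    {i | i ∈ Lam s (S s k) ∧ dist (F f i x0) (F f k x0) < C * S s k}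
  obtain ⟨M, hM⟩ := packing q C (s im * r) (mul_pos (hs0 im) hr)
  have hcard : ∀ k, ∀ T : Finset (List (Fin N)), (↑T : Set (List (Fin N))) ⊆ I k → T.card ≤ M := by
    intro k T hT
    have hb := S_pos hs0 k
    apply hM _ T (fun i => (S s k)⁻¹ • (F f i x0 - F f k x0))
    · intro i hi
      have := (hT hi).2
      rw [norm_smul, Real.norm_of_nonneg (by positivity), ← dist_eq_norm,
        inv_mul_le_iff₀ hb]
      linarith
    · intro i hi j hj hij
      rw [dist_smul₀, Real.norm_of_nonneg (by positivity), dist_sub_right,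
        le_inv_mul_iff₀ hb]
      obtain ⟨c, a, b, u', v', hab, h1, h2⟩ := Lam_antichain hs (hT hi).1 (hT hj).1 hij
      have h3 : S s i * r ≤ dist (F f i x0) (F f j x0) := by
        by_contra hlt
        push Not at hlt
        obtain ⟨z, hz⟩ := sim_surj (S_pos hs0 i) (F_dist hf i) (F f j x0)
        rw [← hz, F_dist hf i] at hlt
        have : dist x0 z < r := lt_of_mul_lt_mul_left hlt (S_pos hs0 i).le
        have hzU : z ∈ U := hrU (by simpa [dist_comm] using this)
        rw [h1, h2] at hz
        exact F_disj hs hf hU hUd hab hzU hx0 hz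
      obtain ⟨w, l, hwl, hw⟩ := (hT hi).1.2
      have h4 : S s i = S s w * s l := by rw [hwl, S_append]; simp [S]
      have h5 := him l (Finset.mem_univ _)
      calc S s k * (s im * r) ≤ S s w * s l * r := by
            rw [← mul_assoc]
            have := hs0 im
            have := S_pos hs0 w
            gcongr
        _ ≤ _ := by rw [← h4]; exact h3
  have hex : ∃ m, (∃ k, k ≠ [] ∧ ∃ T : Finset (List (Fin N)), (↑T : Set (List (Fin N))) ⊆ I k ∧
      T.card = m) ∧ ∀ m', (∃ k, k ≠ [] ∧ ∃ T : Finset (List (Fin N)), (↑T : Set (List (Fin N))) ⊆ I k ∧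
      T.card = m') → m' ≤ m := by
    classical
    let P : ℕ → Prop := fun m => ∃ k, k ≠ [] ∧ ∃ T : Finset (List (Fin N)),
      (↑T : Set (List (Fin N))) ⊆ I k ∧ T.card = m
    have hP0 : P 0 := ⟨[i0], by simp, ∅, by simp, rfl⟩
    refine ⟨Nat.findGreatest P M, Nat.findGreatest_spec (Nat.zero_le M) hP0, fun m' hm' => ?_⟩
    apply Nat.le_findGreatest _ hm'
    obtain ⟨k, hk, T, hT, rfl⟩ := hm'
    exact hcard k T hT
  obtain ⟨m, ⟨k, hk, T, hT, hTm⟩, hmax⟩ := hex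
  have hpre : ∀ j i, i ∈ I (j ++ k) → ∃ i', i = j ++ i' := by
    intro j i hi
    by_contra hne
    classical
    let T' := insert i (T.image (fun z => j ++ z))
    have hT' : (↑T' : Set (List (Fin N))) ⊆ I (j ++ k) := by
      intro z hz
      simp only [T', Finset.coe_insert, Finset.coe_image, Set.mem_insert_iff, Set.mem_image] at hz
      rcases hz with rfl | ⟨z', hz', rfl⟩
      · exact hi
      · obtain ⟨⟨g1, w, a, rfl, g2⟩, g3⟩ := hT hz'
        have := S_pos hs0 j
        refine ⟨⟨?_, j ++ w, a, by simp, ?_⟩, ?_⟩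
        · rw [S_append s j, S_append s j]; exact mul_le_mul_of_nonneg_left g1 this.le
        · rw [S_append, S_append]; exact mul_lt_mul_of_pos_left g2 this
        · rw [F_append f j, F_append f j, F_dist hf, S_append, mul_left_comm]
          exact mul_lt_mul_of_pos_left g3 this
    have hc : T'.card = m + 1 := by
      rw [Finset.card_insert_of_notMem, Finset.card_image_of_injective, hTm]
      · intro a b hab; exact List.append_cancel_left hab
      · intro h
        obtain ⟨z, _, hz⟩ := Finset.mem_image.1 h
        exact hne ⟨z, hz.symm⟩
    have := hmax (m + 1) ⟨j ++ k, by simp [hk], T', hT', hc⟩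
    omega
  have key : ∀ l m' : Fin N, l ≠ m' → ∀ j j' : List (Fin N), ∀ y : Eu q,
      dist y (F f (l :: j ++ k) x0) < ρ * S s (l :: j ++ k) →
      dist y (F f (m' :: j' ++ k) x0) < ρ * S s (m' :: j' ++ k) →
      S s (m' :: j' ++ k) ≤ S s (l :: j ++ k) → False := by
    intro l m' hlm j j' y h1 h2 h3
    set b := S s (l :: j ++ k) with hb
    have hb1 : b < 1 := S_lt_one hs _ (by simp)
    obtain ⟨i, v, hiv, hi⟩ := exists_prefix hb1 _ h3
    have e1 : dist (F f (m' :: j' ++ k) x0) (F f i x0) ≤ D * b := by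
      rw [hiv, F_append, F_dist hf, mul_comm]
      have := hD (F_mem hU v hx0) hx0
      have := hi.1
      have := S_pos hs0 i
      gcongr
    have e2 : i ∈ I (l :: j ++ k) := by
      refine ⟨hi, ?_⟩
      rw [← hb]
      have := dist_triangle4 (F f i x0) (F f (m' :: j' ++ k) x0) y (F f (l :: j ++ k) x0)
      rw [dist_comm (F f i x0) (F f (m' :: j' ++ k) x0), dist_comm (F f (m' :: j' ++ k) x0) y] at this
      have : ρ * S s (m' :: j' ++ k) ≤ ρ * b := by gcongr
      rw [hC]
      linarith
    obtain ⟨i', hi'⟩ := hpre _ _ e2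
    rw [hi'] at hiv
    simp at hiv
    exact hlm hiv.1.symm
  refine ⟨⋃ j, ball (F f (j ++ k) x0) (ρ * S s (j ++ k)), k, ?_, ?_, ?_⟩
  · intro l m' hlm
    have tr : ∀ (l : Fin N) (z : Eu q), (z ∈ f l '' ⋃ j, ball (F f (j ++ k) x0) (ρ * S s (j ++ k))) →
        ∃ j, dist z (F f (l :: j ++ k) x0) < ρ * S s (l :: j ++ k) := by
      rintro l z ⟨z', hz', rfl⟩
      obtain ⟨j, hj⟩ := Set.mem_iUnion.1 hz'
      refine ⟨j, ?_⟩
      simp only [List.cons_append, F, S, Function.comp, hf]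
      rw [mul_left_comm]
      have := hs0 l
      exact mul_lt_mul_of_pos_left hj this
    rw [Set.disjoint_left]
    intro y h1 h2
    obtain ⟨j, hj⟩ := tr _ _ h1
    obtain ⟨j', hj'⟩ := tr _ _ h2
    rcases le_total (S s (m' :: j' ++ k)) (S s (l :: j ++ k)) with h | h
    · exact key l m' hlm j j' y hj hj' h
    · exact key m' l hlm.symm j' j y hj' hj h
  · rintro l _ ⟨z, hz, rfl⟩
    obtain ⟨j, hj⟩ := Set.mem_iUnion.1 hz
    refine Set.mem_iUnion.2 ⟨l :: j, ?_⟩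
    simp only [List.cons_append, F, S, Function.comp, hf, mem_ball]
    rw [mul_left_comm]
    exact mul_lt_mul_of_pos_left hj (hs0 l)
  · exact Set.subset_iUnion_of_subset [] (by simp)

end words

section phi

noncomputable def phi (ε r : ℝ) : ℝ := -Real.log (min 1 (max r ε))

variable {ε : ℝ}

lemma phi_pos (hε : 0 < ε) (r : ℝ) : 0 < min 1 (max r ε) :=
  lt_min one_pos (lt_of_lt_of_le hε (le_max_right _ _))

lemma phi_nonneg (hε : 0 < ε) (r : ℝ) : 0 ≤ phi ε r := by
  have := Real.log_nonpos (phi_pos hε r).le (min_le_left _ _)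
  unfold phi; linarith

lemma phi_le (hε : 0 < ε) (hε1 : ε < 1) (r : ℝ) : phi ε r ≤ -Real.log ε := by
  have := Real.log_le_log hε (le_min hε1.le (le_max_right r ε))
  unfold phi; linarith

lemma phi_anti (hε : 0 < ε) {a b : ℝ} (h : a ≤ b) : phi ε b ≤ phi ε a := by
  have := Real.log_le_log (phi_pos hε a) (min_le_min_left 1 (max_le_max_right ε h))
  unfold phi; linarith

lemma phi_scale (hε : 0 < ε) {c : ℝ} (hc : 0 < c) (hc1 : c ≤ 1) (r : ℝ) :
    phi ε (c * r) ≤ -Real.log c + phi ε r := by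
  have h1 : c * min 1 (max r ε) ≤ min 1 (max (c * r) ε) := by
    rw [mul_min_of_nonneg _ _ hc.le, mul_max_of_nonneg _ _ hc.le]
    apply min_le_min
    · linarith
    · apply max_le_max le_rfl
      nlinarith
  have := Real.log_le_log (mul_pos hc (phi_pos hε r)) h1
  rw [Real.log_mul hc.ne' (phi_pos hε r).ne'] at this
  unfold phi; linarith

lemma phi_min (hε : 0 < ε) (a b : ℝ) : phi ε (min a b) ≤ phi ε a + phi ε b := by
  have := phi_nonneg hε a
  have := phi_nonneg hε b
  rcases min_choice a b with h | h <;> rw [h] <;> linarith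

lemma phi_cont (hε : 0 < ε) : Continuous (phi ε) := by
  unfold phi
  apply Continuous.neg
  apply Continuous.log
  · fun_prop
  · intro r; exact (phi_pos hε r).ne'

lemma phi_int {X : Type*} [MeasurableSpace X] (P : Measure X) [IsFiniteMeasure P] {D : X → ℝ}
    (hD : Measurable D) (hε : 0 < ε) (hε1 : ε < 1) : Integrable (fun x => phi ε (D x)) P := by
  apply Integrable.of_bound ((phi_cont hε).measurable.comp hD).aestronglyMeasurable (-Real.log ε)
  filter_upwards with x
  simp only [Function.comp]
  rw [Real.norm_of_nonneg (phi_nonneg hε _)]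
  exact phi_le hε hε1 _

lemma phi_fin {X : Type*} [MeasurableSpace X] (P : Measure X) [IsProbabilityMeasure P] {D : X → ℝ}
    (hD : Measurable D) (hD0 : ∀ x, 0 ≤ D x) {R B : ℝ} (hR : ∀ᵐ x ∂P, D x ≤ R)
    (hB : ∀ ε : ℝ, 0 < ε → ε < 1 → ∫ x, phi ε (D x) ∂P ≤ B) :
    (∀ᵐ x ∂P, 0 < D x) ∧ Integrable (fun x => Real.log (D x)) P ∧
      -B ≤ ∫ x, Real.log (D x) ∂P := by
  have hpos : ∀ᵐ x ∂P, 0 < D x := by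
    have h0 : P.real {x | D x = 0} = 0 := by
      by_contra hne
      have hp : 0 < P.real {x | D x = 0} := lt_of_le_of_ne measureReal_nonneg (Ne.symm hne)
      obtain ⟨M, hM⟩ := exists_nat_gt (max 1 (B / P.real {x | D x = 0}))
      have hM1 : (1:ℝ) < M := lt_of_le_of_lt (le_max_left _ _) hM
      have hM2 : B / P.real {x | D x = 0} < M := lt_of_le_of_lt (le_max_right _ _) hM
      have e0 : 0 < Real.exp (-(M:ℝ)) := Real.exp_pos _
      have e1 : Real.exp (-(M:ℝ)) < 1 := by rw [Real.exp_lt_one_iff]; linarith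
      have h1 := mul_meas_ge_le_integral_of_nonneg (μ := P)
        (f := fun x => phi (Real.exp (-(M:ℝ))) (D x))
        (Eventually.of_forall fun x => phi_nonneg e0 _) (phi_int P hD e0 e1) (M:ℝ)
      have h2 : P.real {x | D x = 0} ≤ P.real {x | (M:ℝ) ≤ phi (Real.exp (-(M:ℝ))) (D x)} := by
        apply measureReal_mono _
        intro x hx
        simp only [Set.mem_ofPred_eq] at hx ⊢
        rw [hx, phi, max_eq_right e0.le, min_eq_right e1.le, Real.log_exp]
        simp
      have h3 := hB _ e0 e1
      rw [div_lt_iff₀ hp] at hM2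
      nlinarith
    rw [measureReal_eq_zero_iff] at h0
    have : ∀ᵐ x ∂P, ¬ (D x = 0) := by
      rw [ae_iff]; simpa using h0
    filter_upwards [this] with x hx
    exact lt_of_le_of_ne (hD0 x) (Ne.symm hx)
  refine ⟨hpos, ?_⟩
  let e : ℕ → ℝ := fun n => 1 / ((n:ℝ) + 2)
  have e0 : ∀ n, 0 < e n := fun n => by positivity
  have e1 : ∀ n, e n < 1 := fun n => by
    simp only [e]; rw [div_lt_one (by positivity)]; have : (0:ℝ) ≤ n := Nat.cast_nonneg n; linarith
  have elim : Tendsto e atTop (nhds 0) := by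
    have := (tendsto_one_div_add_atTop_nhds_zero_nat (𝕜 := ℝ)).comp (tendsto_add_atTop_nat 1)
    refine this.congr (fun n => ?_)
    simp only [Function.comp, e]; push_cast; ring_nf
  have eanti : Antitone e := by
    intro m n hmn
    simp only [e]
    have : (m:ℝ) ≤ n := by exact_mod_cast hmn
    gcongr
  let ψ : X → ℝ := fun x => -Real.log (min 1 (D x))
  have hlim : ∀ᵐ x ∂P, Tendsto (fun n => phi (e n) (D x)) atTop (nhds (ψ x)) := by
    filter_upwards [hpos] with x hx
    have h1 : Tendsto (fun n => min 1 (max (D x) (e n))) atTop (nhds (min 1 (max (D x) 0))) :=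
      tendsto_const_nhds.min (tendsto_const_nhds.max elim)
    rw [max_eq_left hx.le] at h1
    exact (h1.log (lt_min one_pos hx).ne').neg
  have hmono : ∀ᵐ x ∂P, Monotone (fun n => phi (e n) (D x)) := by
    filter_upwards with x m n hmn
    have := Real.log_le_log (phi_pos (e0 n) (D x))
      (min_le_min_left 1 (max_le_max_left (D x) (eanti hmn)))
    simp only [phi]; linarith
  have hψint : Integrable ψ P := by
    have : ∀ n, ∫⁻ x, ‖phi (e n) (D x)‖ₑ ∂P ≤ ENNReal.ofReal B := by
      intro n
      rw [← ofReal_integral_norm_eq_lintegral_enorm (phi_int P hD (e0 n) (e1 n))]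
      apply ENNReal.ofReal_le_ofReal
      refine le_trans (le_of_eq ?_) (hB _ (e0 n) (e1 n))
      apply integral_congr_ae
      filter_upwards with x
      rw [Real.norm_of_nonneg (phi_nonneg (e0 n) _)]
    refine ⟨aestronglyMeasurable_of_tendsto_ae _
      (fun n => (phi_int P hD (e0 n) (e1 n)).aestronglyMeasurable) hlim, ?_⟩
    refine lt_of_le_of_lt ?_ (ENNReal.ofReal_lt_top (r := B))
    calc ∫⁻ x, ‖ψ x‖ₑ ∂P = ∫⁻ x, liminf (fun n => ‖phi (e n) (D x)‖ₑ) atTop ∂P :=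
          lintegral_congr_ae (by filter_upwards [hlim] with x hx using hx.enorm.liminf_eq.symm)
      _ ≤ liminf (fun n => ∫⁻ x, ‖phi (e n) (D x)‖ₑ ∂P) atTop :=
          lintegral_liminf_le' (fun n =>
            (phi_int P hD (e0 n) (e1 n)).aestronglyMeasurable.enorm)
      _ ≤ liminf (fun _ : ℕ => ENNReal.ofReal B) atTop :=
          liminf_le_liminf (Eventually.of_forall this)
      _ = _ := by simp
  have hψB : ∫ x, ψ x ∂P ≤ B := by
    have := integral_tendsto_of_tendsto_of_monotone
      (fun n => phi_int P hD (e0 n) (e1 n)) hψint hmono hlim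
    exact le_of_tendsto' this (fun n => hB _ (e0 n) (e1 n))
  have hχ : Integrable (fun x => Real.log (max 1 (D x))) P := by
    apply Integrable.of_bound (C := Real.log (max 1 R))
      (Real.measurable_log.comp (measurable_const.max hD)).aestronglyMeasurable
    filter_upwards [hR] with x hx
    simp only [Function.comp]
    rw [Real.norm_of_nonneg (Real.log_nonneg (le_max_left _ _))]
    apply Real.log_le_log (by positivity)
    exact max_le_max_left _ hx
  have heq : ∀ᵐ x ∂P, Real.log (max 1 (D x)) - ψ x = Real.log (D x) := by
    filter_upwards [hpos] with x hx
    simp only [ψ]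
    rcases le_total 1 (D x) with h | h
    · simp [h]
    · simp [h]
  refine ⟨(hχ.sub hψint).congr heq, ?_⟩
  rw [← integral_congr_ae heq, integral_sub hχ hψint]
  have : 0 ≤ ∫ x, Real.log (max 1 (D x)) ∂P :=
    integral_nonneg (fun x => Real.log_nonneg (le_max_left _ _))
  linarith

end phi

section meas
variable {q N : ℕ} {f : Fin N → Eu q → Eu q} {s t : Fin N → ℝ} {ν : Measure (Eu q)}

lemma contr (hN : 2 ≤ N) (hs : ∀ i, s i ∈ Set.Ioo (0 : ℝ) 1)
    (hf : ∀ i x y, dist (f i x) (f i y) = s i * dist x y) (x0 : Eu q) :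
    ∃ σ ρ : ℝ, 0 < σ ∧ σ < 1 ∧ 0 ≤ ρ ∧ ∀ i x r, ρ + r < dist (f i x) x0 → ρ + r / σ < dist x x0 := by
  have i0 : Fin N := ⟨0, by omega⟩
  obtain ⟨im, -, him⟩ := Finset.exists_max_image Finset.univ s ⟨i0, Finset.mem_univ _⟩
  obtain ⟨ib, -, hib⟩ := Finset.exists_max_image Finset.univ (fun i => dist (f i x0) x0)
    ⟨i0, Finset.mem_univ _⟩
  have h0 := (hs im).1
  have h1 := (hs im).2
  have h2 : 0 < 1 - s im := by linarith
  refine ⟨s im, dist (f ib x0) x0 / (1 - s im), h0, h1, by positivity, ?_⟩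
  intro i x r h
  have e1 := dist_triangle (f i x) (f i x0) x0
  rw [hf] at e1
  have e2 := hib i (Finset.mem_univ _)
  have e3 : s i * dist x x0 ≤ s im * dist x x0 := by
    have := him i (Finset.mem_univ _); gcongr
  set ρ := dist (f ib x0) x0 / (1 - s im) with hρ
  have e4 : dist (f ib x0) x0 = ρ - ρ * s im := by rw [hρ]; field_simp
  have e5 : (ρ + r / s im) * s im = ρ * s im + r := by field_simp
  refine lt_of_mul_lt_mul_right (a := s im) ?_ h0.le
  rw [e5]
  linarith

lemma supp_aux (P : Measure (Eu q)) [IsProbabilityMeasure P] (x0 : Eu q) {σ ρ : ℝ} (h0 : 0 < σ)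
    (h1 : σ < 1)
    (h : ∀ r, 0 < r → P {x | ρ + r < dist x x0} ≤ P {x | ρ + r / σ < dist x x0}) :
    P {x | ρ + 1 < dist x x0} = 0 := by
  have hit : ∀ n : ℕ, P {x | ρ + 1 < dist x x0} ≤ P {x | ρ + (1 / σ) ^ n < dist x x0} := by
    intro n
    induction n with
    | zero => simp
    | succ n ih =>
      refine ih.trans ((h _ (by positivity)).trans (le_of_eq ?_))
      rw [pow_succ]; simp [div_eq_mul_inv]
  have hσ : 1 < 1 / σ := by rw [lt_div_iff₀ h0]; linarith
  have hT : Tendsto (fun n : ℕ => P {x | ρ + (1 / σ) ^ n < dist x x0}) atTop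
      (nhds (P (⋂ n : ℕ, {x | ρ + (1 / σ) ^ n < dist x x0}))) := by
    apply tendsto_measure_iInter_atTop
    · intro n
      exact (measurableSet_lt measurable_const (by fun_prop)).nullMeasurableSet
    · intro m n hmn x hx
      simp only [Set.mem_ofPred_eq] at hx ⊢
      have : (1 / σ) ^ m ≤ (1 / σ) ^ n := pow_le_pow_right₀ hσ.le hmn
      linarith
    · exact ⟨0, measure_ne_top _ _⟩
  have he : (⋂ n : ℕ, {x : Eu q | ρ + (1 / σ) ^ n < dist x x0}) = ∅ := by
    ext x
    simp only [Set.mem_iInter, Set.mem_ofPred_eq, Set.mem_empty_iff_false, iff_false, not_forall,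
      not_lt]
    obtain ⟨n, hn⟩ := pow_unbounded_of_one_lt (dist x x0 - ρ) hσ
    exact ⟨n, by linarith⟩
  rw [he, measure_empty] at hT
  exact le_antisymm (ge_of_tendsto' hT hit) bot_le

lemma sum_meas (hs : ∀ i, s i ∈ Set.Ioo (0 : ℝ) 1)
    (hf : ∀ i x y, dist (f i x) (f i y) = s i * dist x y) (P : Measure (Eu q))
    {c : Fin N → ℝ} (hc : ∀ i, 0 ≤ c i) (hc1 : ∑ i, c i ≤ 1) {A B : Set (Eu q)}
    (hA : MeasurableSet A) (hAB : ∀ i x, f i x ∈ A → x ∈ B) :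
    (∑ i, ENNReal.ofReal (c i) • P.map (f i)) A ≤ P B := by
  simp only [Measure.coe_finsetSum, Measure.coe_smul, Finset.sum_apply, Pi.smul_apply, smul_eq_mul]
  calc _ ≤ ∑ i, ENNReal.ofReal (c i) * P B := by
        apply Finset.sum_le_sum
        intro i _
        rw [Measure.map_apply (sim_cont (hs i).1 (hf i)).measurable hA]
        gcongr
        exact fun x hx => hAB i x hx
    _ = ENNReal.ofReal (∑ i, c i) * P B := by
        rw [← Finset.sum_mul, ENNReal.ofReal_sum_of_nonneg (fun i _ => hc i)]
    _ ≤ 1 * P B := by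
        gcongr
        exact ENNReal.ofReal_le_one.2 hc1
    _ = _ := one_mul _

lemma supp_ν (hN : 2 ≤ N) (hs : ∀ i, s i ∈ Set.Ioo (0 : ℝ) 1)
    (hf : ∀ i x y, dist (f i x) (f i y) = s i * dist x y)
    (ht : ∀ i, 0 < t i) (htsum : ∑ i, t i = 1) (hνp : IsProbabilityMeasure ν)
    (hν : ν = ∑ i, ENNReal.ofReal (t i) • ν.map (f i))
    {p : Fin (N + 1) → ℝ} (hp : ∀ i, 0 < p i) (hpsum : ∑ i, p i = 1)
    {μ : Measure (Eu q)} (hμp : IsProbabilityMeasure μ)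
    (hμ : μ = ENNReal.ofReal (p 0) • ν + ∑ i : Fin N, ENNReal.ofReal (p i.succ) • μ.map (f i))
    (x0 : Eu q) : ∃ R, 1 ≤ R ∧ (∀ᵐ x ∂ν, dist x x0 ≤ R) ∧ ∀ᵐ x ∂μ, dist x x0 ≤ R := by
  obtain ⟨σ, ρ, h0, h1, hρ, hcon⟩ := contr hN hs hf x0
  have hm : ∀ r : ℝ, MeasurableSet {x : Eu q | r < dist x x0} :=
    fun r => measurableSet_lt measurable_const (by fun_prop)
  have a1 : ν {x | ρ + 1 < dist x x0} = 0 := by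
    apply supp_aux ν x0 h0 h1
    intro r hr
    conv_lhs => rw [hν]
    exact sum_meas hs hf ν (fun i => (ht i).le) htsum.le (hm _) (fun i x hx => hcon i x r hx)
  have a2 : μ {x | ρ + 1 + 1 < dist x x0} = 0 := by
    have hps : ∑ i : Fin N, p i.succ ≤ 1 := by
      rw [Fin.sum_univ_succ] at hpsum
      have := hp 0
      linarith
    apply supp_aux μ x0 h0 h1 (ρ := ρ + 1)
    intro r hr
    conv_lhs => rw [hμ]
    rw [Measure.add_apply, Measure.smul_apply]
    have : ν {x | ρ + 1 + r < dist x x0} = 0 :=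
      measure_mono_null (fun x hx => by
        simp only [Set.mem_ofPred_eq] at hx ⊢; linarith) a1
    rw [this, smul_zero, zero_add]
    refine sum_meas hs hf μ (fun i => (hp i.succ).le) hps (hm _) (fun i x hx => ?_)
    simp only [Set.mem_ofPred_eq] at hx ⊢
    have := hcon i x (1 + r) (by linarith)
    have e : (1 + r) / σ = 1 / σ + r / σ := by ring
    have hσ : 1 < 1 / σ := by rw [lt_div_iff₀ h0]; linarith
    linarith
  refine ⟨ρ + 2, by linarith, ?_, ?_⟩
  · rw [ae_iff]
    refine measure_mono_null (fun x hx => ?_) a1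
    simp only [Set.mem_ofPred_eq] at hx ⊢; linarith
  · rw [ae_iff]
    refine measure_mono_null (fun x hx => ?_) a2
    simp only [Set.mem_ofPred_eq] at hx ⊢; linarith

lemma int_sum (hs : ∀ i, s i ∈ Set.Ioo (0 : ℝ) 1)
    (hf : ∀ i x y, dist (f i x) (f i y) = s i * dist x y) (P : Measure (Eu q))
    {c : Fin N → ℝ} (hc : ∀ i, 0 ≤ c i) {g : Eu q → ℝ} (hg : Measurable g)
    (hgi : ∀ i, Integrable (fun x => g (f i x)) P) :
    Integrable g (∑ i, ENNReal.ofReal (c i) • P.map (f i)) ∧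
    ∫ x, g x ∂(∑ i, ENNReal.ofReal (c i) • P.map (f i)) = ∑ i, c i * ∫ x, g (f i x) ∂P := by
  have hm : ∀ i, Measurable (f i) := fun i => (sim_cont (hs i).1 (hf i)).measurable
  have h1 : ∀ i ∈ Finset.univ, Integrable g (ENNReal.ofReal (c i) • P.map (f i)) := by
    intro i _
    apply Integrable.smul_measure _ ENNReal.ofReal_ne_top
    rw [integrable_map_measure hg.aestronglyMeasurable (hm i).aemeasurable]
    exact hgi i
  refine ⟨integrable_finsetSum_measure.2 h1, ?_⟩
  rw [integral_finsetSum_measure h1]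
  apply Finset.sum_congr rfl
  intro i _
  rw [integral_smul_measure, integral_map (hm i).aemeasurable hg.aestronglyMeasurable,
    ENNReal.toReal_ofReal (hc i), smul_eq_mul]

lemma int_ν (hs : ∀ i, s i ∈ Set.Ioo (0 : ℝ) 1)
    (hf : ∀ i x y, dist (f i x) (f i y) = s i * dist x y) (ht : ∀ i, 0 < t i)
    (hν : ν = ∑ i, ENNReal.ofReal (t i) • ν.map (f i)) {g : Eu q → ℝ} (hg : Measurable g)
    (hgi : ∀ i, Integrable (fun x => g (f i x)) ν) :
    ∫ x, g x ∂ν = ∑ i, t i * ∫ x, g (f i x) ∂ν := by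
  conv_lhs => rw [hν]
  exact (int_sum hs hf ν (fun i => (ht i).le) hg hgi).2

lemma int_μ (hs : ∀ i, s i ∈ Set.Ioo (0 : ℝ) 1)
    (hf : ∀ i x y, dist (f i x) (f i y) = s i * dist x y)
    {p : Fin (N + 1) → ℝ} (hp : ∀ i, 0 < p i)
    {μ : Measure (Eu q)}
    (hμ : μ = ENNReal.ofReal (p 0) • ν + ∑ i : Fin N, ENNReal.ofReal (p i.succ) • μ.map (f i))
    {g : Eu q → ℝ} (hg : Measurable g) (hgν : Integrable g ν)
    (hgi : ∀ i, Integrable (fun x => g (f i x)) μ) :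
    ∫ x, g x ∂μ = p 0 * ∫ x, g x ∂ν + ∑ i : Fin N, p i.succ * ∫ x, g (f i x) ∂μ := by
  conv_lhs => rw [hμ]
  obtain ⟨h1, h2⟩ := int_sum hs hf μ (c := fun i => p i.succ) (fun i => (hp i.succ).le) hg hgi
  rw [integral_add_measure (hgν.smul_measure ENNReal.ofReal_ne_top) h1, h2, integral_smul_measure,
    ENNReal.toReal_ofReal (hp 0).le, smul_eq_mul]

end meas

section lower
variable {q N : ℕ} {f : Fin N → Eu q → Eu q} {s t : Fin N → ℝ} {ν : Measure (Eu q)}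

/-- scaling of the distance to a set with expanding preimage -/
lemma infDist_ge {g : Eu q → Eu q} {r : ℝ} (hr : 0 < r)
    (h : ∀ x y, dist (g x) (g y) = r * dist x y) {A B : Set (Eu q)} (hA : A.Nonempty)
    (hAB : A ⊆ g '' B) (x : Eu q) : r * infDist x B ≤ infDist (g x) A := by
  rw [← sim_infDist hr h]
  exact infDist_le_infDist_of_subset hAB hA

lemma lemC0 (hs : ∀ i, s i ∈ Set.Ioo (0 : ℝ) 1)
    (hf : ∀ i x y, dist (f i x) (f i y) = s i * dist x y)
    (ht : ∀ i, 0 < t i) (htsum : ∑ i, t i = 1) (hνp : IsProbabilityMeasure ν)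
    (hν : ν = ∑ i, ENNReal.ofReal (t i) • ν.map (f i))
    {V : Set (Eu q)} {k : List (Fin N)} {x0 : Eu q} {ρ : ℝ}
    (hV : ∀ i, f i '' V ⊆ V) (hVn : Vᶜ.Nonempty)
    (hball : ball (F f k x0) ((ρ + 1) * S s k) ⊆ V) (hsupp : ∀ᵐ x ∂ν, dist x x0 ≤ ρ) :
    ∃ C0, ∀ ε, 0 < ε → ε < 1 → ∫ x, phi ε (infDist x Vᶜ) ∂ν ≤ C0 := by
  have hs0 : ∀ i, 0 < s i := fun i => (hs i).1
  let T : ℝ → List (Fin N) → ℝ := fun ε u => ∫ y, phi ε (infDist (F f u y) Vᶜ) ∂ν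
  have hFm : ∀ u, Measurable (F f u) := fun u =>
    (sim_cont (S_pos hs0 u) (F_dist hf u)).measurable
  have hm : ∀ u, Measurable (fun y => infDist (F f u y) Vᶜ) := fun u => (hFm u).infDist
  have hT1 : ∀ ε, 0 < ε → ε < 1 → ∀ u, T ε u = ∑ i, t i * T ε (u ++ [i]) := by
    intro ε h0 h1 u
    have := int_ν hs hf ht hν (g := fun y => phi ε (infDist (F f u y) Vᶜ))
      ((phi_cont h0).measurable.comp (hm u)) (fun i => by
        have := phi_int ν (hm (u ++ [i])) h0 h1
        simpa only [F_append, F, Function.comp, id] using this)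
    simp only [T, F_append, F]
    exact this
  have hT2 : ∀ ε, 0 < ε → ε < 1 → ∀ u, T ε u ≤ -Real.log (S s u) + T ε [] := by
    intro ε h0 h1 u
    have : T ε u ≤ ∫ y, (-Real.log (S s u) + phi ε (infDist (F f [] y) Vᶜ)) ∂ν := by
      apply integral_mono (phi_int ν (hm u) h0 h1)
      · exact (integrable_const _).add (phi_int ν (hm []) h0 h1)
      · intro y
        refine (phi_anti h0 (infDist_ge (S_pos hs0 u) (F_dist hf u) hVn (B := Vᶜ) ?_ y)).trans
          (phi_scale h0 (S_pos hs0 u) (S_le_one hs u) _)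
        intro z hz
        obtain ⟨z', rfl⟩ := sim_surj (S_pos hs0 u) (F_dist hf u) z
        exact ⟨z', fun hz' => hz (F_mem hV u hz'), rfl⟩
    rw [integral_add (integrable_const _) (phi_int ν (hm []) h0 h1)] at this
    simpa [T] using this
  have hT3 : ∀ v u, ∃ c, ∀ ε, 0 < ε → ε < 1 →
      T ε u ≤ c + (1 - S t v) * T ε [] + S t v * T ε (u ++ v) := by
    intro v
    induction v with
    | nil => intro u; exact ⟨0, fun ε _ _ => by simp [S]⟩
    | cons i v ih =>
      intro u
      obtain ⟨c', hc'⟩ := ih (u ++ [i])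
      refine ⟨t i * c' + ∑ j ∈ Finset.univ.erase i, t j * (-Real.log (S s (u ++ [j]))),
        fun ε h0 h1 => ?_⟩
      have e1 := hT1 ε h0 h1 u
      rw [← Finset.add_sum_erase _ _ (Finset.mem_univ i)] at e1
      have e2 : ∑ j ∈ Finset.univ.erase i, t j * T ε (u ++ [j]) ≤
          ∑ j ∈ Finset.univ.erase i, t j * (-Real.log (S s (u ++ [j])))
            + (1 - t i) * T ε [] := by
        have : 1 - t i = ∑ j ∈ Finset.univ.erase i, t j := by
          rw [← htsum, ← Finset.add_sum_erase _ _ (Finset.mem_univ i)]; ring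
        rw [this, Finset.sum_mul, ← Finset.sum_add_distrib]
        apply Finset.sum_le_sum
        intro j _
        rw [← mul_add]
        exact mul_le_mul_of_nonneg_left (hT2 ε h0 h1 _) (ht j).le
      have e3 := mul_le_mul_of_nonneg_left (hc' ε h0 h1) (ht i).le
      rw [List.append_assoc] at e3
      simp only [List.cons_append, List.nil_append] at e3
      simp only [S]
      nlinarith
  obtain ⟨c, hc⟩ := hT3 k []
  have hk : ∀ ε, 0 < ε → ε < 1 → T ε k ≤ -Real.log (S s k) := by
    intro ε h0 h1
    have : T ε k ≤ ∫ y, -Real.log (S s k) ∂ν := by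
      apply integral_mono_ae (phi_int ν (hm k) h0 h1) (integrable_const _)
      filter_upwards [hsupp] with y hy
      have e1 : S s k ≤ infDist (F f k y) Vᶜ := by
        rw [le_infDist hVn]
        intro z hz
        by_contra hlt
        push Not at hlt
        apply hz
        apply hball
        rw [mem_ball]
        have := dist_triangle_left z (F f k x0) (F f k y)
        rw [F_dist hf] at this
        have : S s k * dist y x0 ≤ S s k * ρ := mul_le_mul_of_nonneg_left hy (S_pos hs0 k).le
        linarith
      refine (phi_anti h0 e1).trans ?_
      have := phi_scale h0 (S_pos hs0 k) (S_le_one hs k) 1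
      simp only [mul_one] at this
      have h3 : phi ε 1 = 0 := by simp [phi]
      linarith
    simpa using this
  have hkp : 0 < S t k := S_pos ht k
  refine ⟨(c + S t k * (-Real.log (S s k))) / S t k, fun ε h0 h1 => ?_⟩
  have e1 := hc ε h0 h1
  have e2 := mul_le_mul_of_nonneg_left (hk ε h0 h1) hkp.le
  rw [le_div_iff₀ hkp]
  have e3 : T ε [] = ∫ x, phi ε (infDist x Vᶜ) ∂ν := rfl
  rw [← e3]
  simp only [List.nil_append] at e1
  nlinarith

lemma t_lt_one (hN : 2 ≤ N) (ht : ∀ i, 0 < t i) (htsum : ∑ i, t i = 1) (i : Fin N) : t i < 1 := by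
  rw [← htsum]
  have : ∃ j : Fin N, j ≠ i := by
    have : Nontrivial (Fin N) := Fin.nontrivial_iff_two_le.2 hN
    exact exists_ne i
  obtain ⟨j, hj⟩ := this
  exact Finset.single_lt_sum hj (Finset.mem_univ _) (Finset.mem_univ _) (ht j)
    (fun k _ _ => (ht k).le)

lemma lemC1 (hN : 2 ≤ N) (hs : ∀ i, s i ∈ Set.Ioo (0 : ℝ) 1)
    (hf : ∀ i x y, dist (f i x) (f i y) = s i * dist x y)
    (ht : ∀ i, 0 < t i) (htsum : ∑ i, t i = 1) (hνp : IsProbabilityMeasure ν)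
    (hν : ν = ∑ i, ENNReal.ofReal (t i) • ν.map (f i))
    {V : Set (Eu q)} (hd : ∀ i j, i ≠ j → Disjoint (f i '' V) (f j '' V))
    {C0 : ℝ} (hC0 : ∀ ε, 0 < ε → ε < 1 → ∫ x, phi ε (infDist x Vᶜ) ∂ν ≤ C0) :
    ∃ C1, ∀ ε, 0 < ε → ε < 1 → ∀ a, ∫ x, phi ε (dist x a) ∂ν ≤ C1 := by
  have hs0 : ∀ i, 0 < s i := fun i => (hs i).1
  have i0 : Fin N := ⟨0, by omega⟩
  obtain ⟨im, -, him⟩ := Finset.exists_max_image Finset.univ t ⟨i0, Finset.mem_univ _⟩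
  have htm := t_lt_one hN ht htsum im
  have hC0n : 0 ≤ C0 := (integral_nonneg (fun x => phi_nonneg (by norm_num) _)).trans
    (hC0 (1/2) (by norm_num) (by norm_num))
  set c := ∑ i, t i * (-Real.log (s i)) with hcdef
  refine ⟨(c + C0) / (1 - t im), fun ε h0 h1 => ?_⟩
  have hm : ∀ a : Eu q, Measurable (fun x : Eu q => dist x a) := fun a => by fun_prop
  let G := ⨆ a : Eu q, ∫ x, phi ε (dist x a) ∂ν
  have hbdd : BddAbove (Set.range fun a : Eu q => ∫ x, phi ε (dist x a) ∂ν) := by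
    refine ⟨-Real.log ε, ?_⟩
    rintro _ ⟨a, rfl⟩
    have : ∫ x, phi ε (dist x a) ∂ν ≤ ∫ x, -Real.log ε ∂ν :=
      integral_mono (phi_int ν (hm a) h0 h1) (integrable_const _) (fun x => phi_le h0 h1 _)
    simpa using this
  have hG : ∀ a, ∫ x, phi ε (dist x a) ∂ν ≤ G := fun a => le_ciSup hbdd a
  have hG0 : 0 ≤ G := (integral_nonneg (fun x => phi_nonneg h0 _)).trans (hG 0)
  have step : ∀ a, ∫ x, phi ε (dist x a) ∂ν ≤ c + C0 + t im * G := by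
    intro a
    have e0 := int_ν hs hf ht hν (g := fun y => phi ε (dist y a))
      ((phi_cont h0).measurable.comp (hm a)) (fun i => by
        have hfm : Measurable (f i) := (sim_cont (hs0 i) (hf i)).measurable
        exact phi_int ν ((hm a).comp hfm) h0 h1)
    have e1 : ∀ i, ∃ b, f i b = a := fun i => sim_surj (hs0 i) (hf i) a
    choose b hb using e1
    have e2 : ∀ i, ∫ x, phi ε (dist (f i x) a) ∂ν ≤
        -Real.log (s i) + ∫ x, phi ε (dist x (b i)) ∂ν := by
      intro i
      have : ∫ x, phi ε (dist (f i x) a) ∂ν ≤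
          ∫ x, (-Real.log (s i) + phi ε (dist x (b i))) ∂ν := by
        apply integral_mono
        · have hfm : Measurable (f i) := (sim_cont (hs0 i) (hf i)).measurable
          exact phi_int ν ((hm a).comp hfm) h0 h1
        · exact (integrable_const _).add (phi_int ν (hm _) h0 h1)
        · intro x
          simp only
          rw [← hb i, hf]
          exact phi_scale h0 (hs0 i) (hs i).2.le _
      rw [integral_add (integrable_const _) (phi_int ν (hm _) h0 h1)] at this
      simpa using this
    have e3 : ∀ i, b i ∉ V → ∫ x, phi ε (dist x (b i)) ∂ν ≤ C0 := by
      intro i hi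
      refine le_trans ?_ (hC0 ε h0 h1)
      apply integral_mono (phi_int ν (hm _) h0 h1) (phi_int ν measurable_infDist h0 h1)
      intro x
      exact phi_anti h0 (infDist_le_dist_of_mem hi)
    have e4 : ∃ j, ∀ i, i ≠ j → b i ∉ V := by
      by_cases hex : ∃ j, b j ∈ V
      · obtain ⟨j, hj⟩ := hex
        refine ⟨j, fun i hij hi => ?_⟩
        exact Set.disjoint_left.1 (hd i j hij) ⟨b i, hi, hb i⟩ ⟨b j, hj, hb j⟩
      · push Not at hex
        exact ⟨i0, fun i _ => hex i⟩
    obtain ⟨j, hj⟩ := e4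
    have e5 : ∑ i, t i * ∫ x, phi ε (dist x (b i)) ∂ν ≤ C0 + t im * G := by
      rw [← Finset.add_sum_erase _ _ (Finset.mem_univ j)]
      have g1 : t j * ∫ x, phi ε (dist x (b j)) ∂ν ≤ t im * G :=
        mul_le_mul (him j (Finset.mem_univ _)) (hG _) (integral_nonneg (fun x => phi_nonneg h0 _))
          (ht im).le
      have g2 : ∑ i ∈ Finset.univ.erase j, t i * ∫ x, phi ε (dist x (b i)) ∂ν ≤
          ∑ i ∈ Finset.univ.erase j, t i * C0 := by
        apply Finset.sum_le_sum
        intro i hi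
        exact mul_le_mul_of_nonneg_left (e3 i (hj i (Finset.ne_of_mem_erase hi))) (ht i).le
      have g3 : ∑ i ∈ Finset.univ.erase j, t i * C0 ≤ ∑ i, t i * C0 :=
        Finset.sum_le_sum_of_subset_of_nonneg (Finset.erase_subset _ _)
          (fun i _ _ => mul_nonneg (ht i).le hC0n)
      rw [← Finset.sum_mul Finset.univ, htsum, one_mul] at g3
      linarith
    rw [e0]
    calc _ ≤ ∑ i, t i * (-Real.log (s i) + ∫ x, phi ε (dist x (b i)) ∂ν) := by
          apply Finset.sum_le_sum
          intro i _
          exact mul_le_mul_of_nonneg_left (e2 i) (ht i).le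
      _ = c + ∑ i, t i * ∫ x, phi ε (dist x (b i)) ∂ν := by
          rw [hcdef, ← Finset.sum_add_distrib]
          exact Finset.sum_congr rfl (fun i _ => by ring)
      _ ≤ _ := by linarith
  have hGle : G ≤ c + C0 + t im * G := ciSup_le step
  intro a
  rw [le_div_iff₀ (by linarith)]
  have := hG a
  nlinarith

lemma phi_union {ε : ℝ} (h0 : 0 < ε) {A : Set (Eu q)} (hA : A.Nonempty) (x : Eu q)
    (α : Finset (Eu q)) :
    phi ε (infDist x (A ∪ ↑α)) ≤ phi ε (infDist x A) + ∑ a ∈ α, phi ε (dist x a) := by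
  classical
  induction α using Finset.induction_on with
  | empty => simp
  | insert a α ha ih =>
    rw [Finset.sum_insert ha]
    have h1 : min (infDist x (A ∪ ↑α)) (dist x a) ≤ infDist x (A ∪ ↑(insert a α)) := by
      rw [le_infDist (hA.mono Set.subset_union_left)]
      intro y hy
      simp only [Finset.coe_insert, Set.union_insert, Set.mem_insert_iff] at hy
      rcases hy with rfl | hy
      · exact min_le_right _ _
      · exact (min_le_left _ _).trans (infDist_le_dist_of_mem hy)
    have h2 := (phi_anti h0 h1).trans (phi_min h0 _ _)
    linarith

lemma lower_rec (hN : 2 ≤ N) (hs : ∀ i, s i ∈ Set.Ioo (0 : ℝ) 1)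
    (hf : ∀ i x y, dist (f i x) (f i y) = s i * dist x y)
    (ht : ∀ i, 0 < t i) (htsum : ∑ i, t i = 1) (hνp : IsProbabilityMeasure ν)
    (hν : ν = ∑ i, ENNReal.ofReal (t i) • ν.map (f i))
    {V : Set (Eu q)} (hd : ∀ i j, i ≠ j → Disjoint (f i '' V) (f j '' V))
    (hV : ∀ i, f i '' V ⊆ V) (hVn : Vᶜ.Nonempty) {κ : ℝ} (hκ : 0 < κ)
    (hbal : ∑ i, t i * (-Real.log (s i) + κ * Real.log (t i)) = 0)
    {C0 : ℝ} (hC0 : ∀ ε, 0 < ε → ε < 1 → ∫ x, phi ε (infDist x Vᶜ) ∂ν ≤ C0)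
    {C1 : ℝ} (hC1 : ∀ ε, 0 < ε → ε < 1 → ∀ a, ∫ x, phi ε (dist x a) ∂ν ≤ C1) :
    ∃ C, 0 ≤ C ∧ ∀ ε, 0 < ε → ε < 1 → ∀ x : ℝ, 1 ≤ x → ∀ α : Finset (Eu q),
      ∫ y, phi ε (infDist y (Vᶜ ∪ ↑α)) ∂ν ≤ κ * Real.log x + C + C * α.card / x := by
  have hs0 : ∀ i, 0 < s i := fun i => (hs i).1
  have i0 : Fin N := ⟨0, by omega⟩
  obtain ⟨im, -, him⟩ := Finset.exists_max_image Finset.univ t ⟨i0, Finset.mem_univ _⟩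
  obtain ⟨il, -, hil⟩ := Finset.exists_min_image Finset.univ t ⟨i0, Finset.mem_univ _⟩
  have htm := t_lt_one hN ht htsum im
  have htl := t_lt_one hN ht htsum il
  have hlog := Real.log_neg (ht il) htl
  have hC0n : 0 ≤ C0 := (integral_nonneg (fun x => phi_nonneg (by norm_num) _)).trans
    (hC0 (1/2) (by norm_num) (by norm_num))
  have hC1n : 0 ≤ C1 := (integral_nonneg (fun x => phi_nonneg (by norm_num) _)).trans
    (hC1 (1/2) (by norm_num) (by norm_num) 0)
  set C := C0 + C1 - κ * Real.log (t il) with hC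
  have hCn : 0 ≤ C := by nlinarith
  refine ⟨C, hCn, fun ε h0 h1 => ?_⟩
  have hm : ∀ a : Eu q, Measurable (fun x : Eu q => dist x a) := fun a => by fun_prop
  have base : ∀ x : ℝ, t il ≤ x → x ≤ 1 → ∀ α : Finset (Eu q),
      ∫ y, phi ε (infDist y (Vᶜ ∪ ↑α)) ∂ν ≤ κ * Real.log x + C + C * α.card / x := by
    intro x hx hx1 α
    have hx0 : 0 < x := lt_of_lt_of_le (ht il) hx
    have e1 : ∫ y, phi ε (infDist y (Vᶜ ∪ ↑α)) ∂ν ≤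
        ∫ y, (phi ε (infDist y Vᶜ) + ∑ a ∈ α, phi ε (dist y a)) ∂ν := by
      apply integral_mono (phi_int ν measurable_infDist h0 h1)
      · exact (phi_int ν measurable_infDist h0 h1).add
          (integrable_finsetSum _ (fun a _ => phi_int ν (hm a) h0 h1))
      · intro y; exact phi_union h0 hVn y α
    rw [integral_add (phi_int ν measurable_infDist h0 h1)
      (integrable_finsetSum _ (fun a _ => phi_int ν (hm a) h0 h1)),
      integral_finsetSum _ (fun a _ => phi_int ν (hm a) h0 h1)] at e1
    have e2 : ∑ a ∈ α, ∫ x, phi ε (dist x a) ∂ν ≤ α.card * C1 := by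
      have := Finset.sum_le_card_nsmul α _ C1 (fun a _ => hC1 ε h0 h1 a)
      simpa using this
    have e3 := hC0 ε h0 h1
    have e4 : κ * Real.log (t il) ≤ κ * Real.log x :=
      mul_le_mul_of_nonneg_left (Real.log_le_log (ht il) hx) hκ.le
    have e5 : (α.card : ℝ) * C1 ≤ C * α.card / x := by
      rw [le_div_iff₀ hx0]
      have : C1 ≤ C := by nlinarith
      have hc : (0:ℝ) ≤ α.card := Nat.cast_nonneg _
      calc (α.card : ℝ) * C1 * x ≤ α.card * C1 * 1 :=
            mul_le_mul_of_nonneg_left hx1 (mul_nonneg hc hC1n)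
        _ ≤ C * α.card := by nlinarith
    linarith
  have main : ∀ n : ℕ, ∀ x : ℝ, t il ≤ x → x ≤ (1 / t im) ^ n → ∀ α : Finset (Eu q),
      ∫ y, phi ε (infDist y (Vᶜ ∪ ↑α)) ∂ν ≤ κ * Real.log x + C + C * α.card / x := by
    intro n
    induction n with
    | zero => intro x hx hx1 α; exact base x hx (by simpa using hx1) α
    | succ n ih =>
      intro x hx hxn α
      rcases le_or_gt x 1 with hx1 | hx1
      · exact base x hx hx1 α
      classical
      have hx0 : 0 < x := by linarith
      let β : Fin N → Finset (Eu q) := fun i =>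
        (α.preimage (f i) (sim_inj (hs0 i) (hf i)).injOn).filter (· ∈ V)
      have hβ : ∑ i, ((β i).card : ℝ) ≤ α.card := by
        have h2 : ∑ i, (β i).card ≤ α.card := by
          calc ∑ i, (β i).card = ∑ i, ((β i).image (f i)).card := by
                refine Finset.sum_congr rfl (fun i _ => ?_)
                rw [Finset.card_image_of_injective _ (sim_inj (hs0 i) (hf i))]
            _ = (Finset.univ.biUnion fun i => (β i).image (f i)).card := by
                rw [Finset.card_biUnion]
                intro i _ j _ hij
                refine Finset.disjoint_left.2 ?_
                intro z hz1 hz2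
                obtain ⟨z1, g1, rfl⟩ := Finset.mem_image.1 hz1
                obtain ⟨z2, g2, g3⟩ := Finset.mem_image.1 hz2
                exact Set.disjoint_left.1 (hd i j hij) ⟨z1, (Finset.mem_filter.1 g1).2, rfl⟩
                  ⟨z2, (Finset.mem_filter.1 g2).2, g3⟩
            _ ≤ α.card := by
                apply Finset.card_le_card
                intro z hz
                obtain ⟨i, _, hz⟩ := Finset.mem_biUnion.1 hz
                obtain ⟨z1, g1, rfl⟩ := Finset.mem_image.1 hz
                have := (Finset.mem_filter.1 g1).1
                simpa using this
        exact_mod_cast h2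
      have e0 := int_ν hs hf ht hν (g := fun y => phi ε (infDist y (Vᶜ ∪ ↑α)))
        ((phi_cont h0).measurable.comp measurable_infDist) (fun i => by
          have hfm : Measurable (f i) := (sim_cont (hs0 i) (hf i)).measurable
          exact phi_int ν hfm.infDist h0 h1)
      have e2 : ∀ i, ∫ y, phi ε (infDist (f i y) (Vᶜ ∪ ↑α)) ∂ν ≤
          -Real.log (s i) + ∫ y, phi ε (infDist y (Vᶜ ∪ ↑(β i))) ∂ν := by
        intro i
        have hfm : Measurable (f i) := (sim_cont (hs0 i) (hf i)).measurable
        have : ∫ y, phi ε (infDist (f i y) (Vᶜ ∪ ↑α)) ∂ν ≤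
            ∫ y, (-Real.log (s i) + phi ε (infDist y (Vᶜ ∪ ↑(β i)))) ∂ν := by
          apply integral_mono (phi_int ν hfm.infDist h0 h1)
          · exact (integrable_const _).add (phi_int ν measurable_infDist h0 h1)
          · intro y
            refine (phi_anti h0 (infDist_ge (hs0 i) (hf i) (hVn.mono Set.subset_union_left)
              (B := Vᶜ ∪ ↑(β i)) ?_ y)).trans (phi_scale h0 (hs0 i) (hs i).2.le _)
            intro z hz
            obtain ⟨z', rfl⟩ := sim_surj (hs0 i) (hf i) z
            refine ⟨z', ?_, rfl⟩
            by_cases hz' : z' ∈ V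
            · right
              have : f i z' ∈ V := hV i ⟨z', hz', rfl⟩
              have hzα : f i z' ∈ α := by
                rcases hz with hz | hz
                · exact absurd this hz
                · exact hz
              simp [β, hz', hzα]
            · left; exact hz'
        rw [integral_add (integrable_const _) (phi_int ν measurable_infDist h0 h1)] at this
        simpa using this
      rw [e0]
      have e3 : ∀ i, t i * ∫ y, phi ε (infDist (f i y) (Vᶜ ∪ ↑α)) ∂ν ≤
          t i * (-Real.log (s i) + κ * Real.log (t i)) + t i * (κ * Real.log x + C)
            + C / x * (β i).card := by
        intro i
        have hi := ht i
        have g1 : t il ≤ t i * x := by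
          have := hil i (Finset.mem_univ _)
          nlinarith
        have g2 : t i * x ≤ (1 / t im) ^ n := by
          have := him i (Finset.mem_univ _)
          have hp := ht im
          calc t i * x ≤ t im * (1 / t im) ^ (n + 1) := by gcongr
            _ = _ := by rw [pow_succ]; field_simp
        have g3 := ih (t i * x) g1 g2 (β i)
        have g4 := (e2 i).trans (add_le_add_right g3 _)
        have g5 := mul_le_mul_of_nonneg_left g4 hi.le
        rw [Real.log_mul hi.ne' hx0.ne'] at g5
        refine g5.trans (le_of_eq ?_)
        field_simp
        ring
      calc _ ≤ ∑ i, (t i * (-Real.log (s i) + κ * Real.log (t i)) + t i * (κ * Real.log x + C)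
            + C / x * (β i).card) := Finset.sum_le_sum (fun i _ => e3 i)
        _ = κ * Real.log x + C + C / x * ∑ i, ((β i).card : ℝ) := by
          rw [Finset.sum_add_distrib, Finset.sum_add_distrib, hbal, ← Finset.sum_mul, htsum,
            ← Finset.mul_sum]
          ring
        _ ≤ κ * Real.log x + C + C / x * α.card := by gcongr
        _ = _ := by ring
  intro x hx α
  have : 1 < 1 / t im := by rw [lt_div_iff₀ (ht im)]; linarith
  obtain ⟨n, hn⟩ := pow_unbounded_of_one_lt x this
  exact main n x (by linarith) hn.le α

end lower

section final
variable {q N : ℕ} {f : Fin N → Eu q → Eu q} {s t : Fin N → ℝ} {ν : Measure (Eu q)}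

lemma pull {g : Eu q → Eu q} {r : ℝ} (hr : 0 < r)
    (h : ∀ x y, dist (g x) (g y) = r * dist x y) {β : Finset (Eu q)} (hβ : β.Nonempty) :
    ∃ γ : Finset (Eu q), γ.Nonempty ∧ γ.card = β.card ∧ (∀ a, a ∈ γ ↔ g a ∈ β) ∧
      ∀ y, infDist (g y) ↑β = r * infDist y ↑γ := by
  classical
  have hinj := sim_inj hr h
  have hsurj := sim_surj hr h
  let γ := β.preimage g hinj.injOn
  have him : γ.image g = β := by
    ext z
    simp only [γ, Finset.mem_image, Finset.mem_preimage]
    constructor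
    · rintro ⟨a, ha, rfl⟩; exact ha
    · intro hz
      obtain ⟨a, rfl⟩ := hsurj z
      exact ⟨a, hz, rfl⟩
  refine ⟨γ, ?_, ?_, fun a => by simp [γ], fun y => ?_⟩
  · rw [← him] at hβ; exact Finset.image_nonempty.1 hβ
  · rw [← him, Finset.card_image_of_injective _ hinj]
  · rw [← sim_infDist hr h, ← Finset.coe_image, him]

lemma lower_phi (hN : 2 ≤ N) (hs : ∀ i, s i ∈ Set.Ioo (0 : ℝ) 1)
    (hf : ∀ i x y, dist (f i x) (f i y) = s i * dist x y)
    (hOSC : ∃ U : Set (Eu q), U.Nonempty ∧ IsOpen U ∧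
      Bornology.IsBounded U ∧
      (∀ i j, i ≠ j → Disjoint (f i '' U) (f j '' U)) ∧
      (⋃ i, f i '' U) ⊆ U)
    (ht : ∀ i, 0 < t i) (htsum : ∑ i, t i = 1) (hνp : IsProbabilityMeasure ν)
    (hν : ν = ∑ i, ENNReal.ofReal (t i) • ν.map (f i))
    {p : Fin (N + 1) → ℝ} (hp : ∀ i, 0 < p i) (hpsum : ∑ i, p i = 1)
    {μ : Measure (Eu q)} (hμp : IsProbabilityMeasure μ)
    (hμ : μ = ENNReal.ofReal (p 0) • ν + ∑ i : Fin N, ENNReal.ofReal (p i.succ) • μ.map (f i))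
    {κ : ℝ} (hκ : 0 < κ)
    (hbal : ∑ i, t i * (-Real.log (s i) + κ * Real.log (t i)) = 0) :
    ∃ C, ∀ ε, 0 < ε → ε < 1 → ∀ n : ℕ, 1 ≤ n → ∀ α : Finset (Eu q), α.Nonempty → α.card ≤ n →
      ∫ y, phi ε (infDist y ↑α) ∂ν ≤ κ * Real.log n + C ∧
      ∫ y, phi ε (infDist y ↑α) ∂μ ≤ κ * Real.log n + C := by
  have hs0 : ∀ i, 0 < s i := fun i => (hs i).1
  obtain ⟨x0, hx0⟩ := exists_V hN hs hf hOSC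
  obtain ⟨R, hR1, hRν, hRμ⟩ := supp_ν hN hs hf ht htsum hνp hν hp hpsum hμp hμ x0
  obtain ⟨V, k, hd, hV, hball⟩ := hx0 (R + 1) (by linarith)
  have hVn : Vᶜ.Nonempty := by
    rw [Set.nonempty_compl]
    rintro rfl
    have h1 := hd ⟨0, by omega⟩ ⟨1, by omega⟩ (by simp)
    rw [Set.image_univ, Set.image_univ, (sim_surj (hs0 _) (hf _)).range_eq,
      (sim_surj (hs0 _) (hf _)).range_eq] at h1
    simp at h1
  obtain ⟨C0, hC0⟩ := lemC0 hs hf ht htsum hνp hν hV hVn hball hRν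
  obtain ⟨C1, hC1⟩ := lemC1 hN hs hf ht htsum hνp hν hd hC0
  obtain ⟨C, hC, hmain⟩ := lower_rec hN hs hf ht htsum hνp hν hd hV hVn hκ hbal hC0 hC1
  have hνb : ∀ ε, 0 < ε → ε < 1 → ∀ n : ℕ, 1 ≤ n → ∀ α : Finset (Eu q), α.Nonempty →
      α.card ≤ n → ∫ y, phi ε (infDist y ↑α) ∂ν ≤ κ * Real.log n + 2 * C := by
    intro ε h0 h1 n hn α hα hαn
    have hn1 : (1:ℝ) ≤ n := by exact_mod_cast hn
    have hαn' : (α.card : ℝ) ≤ n := by exact_mod_cast hαn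
    have e1 := hmain ε h0 h1 n hn1 α
    have e2 : ∫ y, phi ε (infDist y ↑α) ∂ν ≤ ∫ y, phi ε (infDist y (Vᶜ ∪ ↑α)) ∂ν := by
      apply integral_mono (phi_int ν measurable_infDist h0 h1)
        (phi_int ν measurable_infDist h0 h1)
      intro y
      exact phi_anti h0 (infDist_le_infDist_of_subset Set.subset_union_right (by simpa using hα))
    have e3 : C * α.card / n ≤ C := by
      rw [div_le_iff₀ (by linarith)]
      gcongr
    linarith
  set c := ∑ i : Fin N, p i.succ * (-Real.log (s i)) with hc
  have hc0 : 0 ≤ c := Finset.sum_nonneg (fun i _ => mul_nonneg (hp _).le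
    (neg_nonneg.2 (Real.log_nonpos (hs0 i).le (hs i).2.le)))
  have hp0 := hp 0
  have hps : ∑ i : Fin N, p i.succ = 1 - p 0 := by
    rw [Fin.sum_univ_succ] at hpsum; linarith
  have hcp : 0 ≤ c / p 0 := by positivity
  refine ⟨2 * C + c / p 0, fun ε h0 h1 n hn => ?_⟩
  let ι := {α : Finset (Eu q) // α.Nonempty ∧ α.card ≤ n}
  let E : ι → ℝ := fun α => ∫ y, phi ε (infDist y ↑α.1) ∂μ
  have : Nonempty ι := ⟨⟨{0}, by simp, by simpa using hn⟩⟩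
  have hbdd : BddAbove (Set.range E) := by
    refine ⟨-Real.log ε, ?_⟩
    rintro _ ⟨a, rfl⟩
    have : E a ≤ ∫ x, -Real.log ε ∂μ :=
      integral_mono (phi_int μ measurable_infDist h0 h1) (integrable_const _)
        (fun x => phi_le h0 h1 _)
    simpa using this
  set G := ⨆ α, E α with hGdef
  have step : ∀ α, E α ≤ p 0 * (κ * Real.log n + 2 * C) + c + (1 - p 0) * G := by
    rintro ⟨α, hα, hαn⟩
    have hfm : ∀ i, Measurable (f i) := fun i => (sim_cont (hs0 i) (hf i)).measurable
    have e0 := int_μ hs hf hp hμ (g := fun y => phi ε (infDist y ↑α))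
      ((phi_cont h0).measurable.comp measurable_infDist)
      (phi_int ν measurable_infDist h0 h1)
      (fun i => phi_int μ (hfm i).infDist h0 h1)
    have e1 : ∀ i, ∫ y, phi ε (infDist (f i y) ↑α) ∂μ ≤ -Real.log (s i) + G := by
      intro i
      obtain ⟨γ, hγ, hγc, -, hγd⟩ := pull (hs0 i) (hf i) hα
      have : ∫ y, phi ε (infDist (f i y) ↑α) ∂μ ≤
          ∫ y, (-Real.log (s i) + phi ε (infDist y ↑γ)) ∂μ := by
        apply integral_mono (phi_int μ (hfm i).infDist h0 h1)
        · exact (integrable_const _).add (phi_int μ measurable_infDist h0 h1)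
        · intro y
          simp only [hγd]
          exact phi_scale h0 (hs0 i) (hs i).2.le _
      rw [integral_add (integrable_const _) (phi_int μ measurable_infDist h0 h1)] at this
      have h3 : ∫ y, phi ε (infDist y ↑γ) ∂μ ≤ G := le_ciSup hbdd ⟨γ, hγ, hγc.trans_le hαn⟩
      simp only [integral_const, probReal_univ, one_smul] at this
      linarith
    change ∫ y, phi ε (infDist y ↑α) ∂μ ≤ _
    rw [e0]
    have e2 := mul_le_mul_of_nonneg_left (hνb ε h0 h1 n hn α hα hαn) hp0.le
    have e3 : ∑ i : Fin N, p i.succ * ∫ y, phi ε (infDist (f i y) ↑α) ∂μ ≤ c + (1 - p 0) * G := by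
      rw [hc, ← hps, Finset.sum_mul, ← Finset.sum_add_distrib]
      apply Finset.sum_le_sum
      intro i _
      rw [← mul_add]
      exact mul_le_mul_of_nonneg_left (e1 i) (hp _).le
    linarith
  have hG : G ≤ p 0 * (κ * Real.log n + 2 * C) + c + (1 - p 0) * G := ciSup_le step
  have hG2 : G ≤ κ * Real.log n + (2 * C + c / p 0) := by
    have : p 0 * G ≤ p 0 * (κ * Real.log n + (2 * C + c / p 0)) := by
      have e : p 0 * (c / p 0) = c := by field_simp
      nlinarith
    exact le_of_mul_le_mul_left this hp0
  intro α hα hαn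
  refine ⟨(hνb ε h0 h1 n hn α hα hαn).trans (by linarith), ?_⟩
  exact (le_ciSup hbdd ⟨α, hα, hαn⟩).trans hG2

def Good (P : Measure (Eu q)) : Prop := ∀ α : Finset (Eu q), α.Nonempty →
  (∀ᵐ x ∂P, 0 < infDist x (↑α : Set (Eu q))) ∧
  Integrable (fun x => Real.log (infDist x (↑α : Set (Eu q)))) P

lemma infDist_bdd {P : Measure (Eu q)} {x0 : Eu q} {R : ℝ} (hR : ∀ᵐ x ∂P, dist x x0 ≤ R)
    {α : Finset (Eu q)} (hα : α.Nonempty) : ∃ R', ∀ᵐ x ∂P, infDist x (↑α : Set (Eu q)) ≤ R' := by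
  obtain ⟨a, ha⟩ := hα
  refine ⟨R + dist x0 a, ?_⟩
  filter_upwards [hR] with x hx
  have h1 : infDist x (↑α : Set (Eu q)) ≤ dist x a := infDist_le_dist_of_mem (by simpa using ha)
  have := dist_triangle x x0 a
  linarith

lemma up_step {P : Measure (Eu q)} [IsProbabilityMeasure P] (hP : Good P)
    {g : Eu q → Eu q} {r : ℝ} (hr : 0 < r)
    (h : ∀ x y, dist (g x) (g y) = r * dist x y) {α β : Finset (Eu q)}
    (hα : α.Nonempty) (hαβ : ∀ a ∈ α, g a ∈ β) :
    Integrable (fun y => Real.log (infDist (g y) (↑β : Set (Eu q)))) P ∧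
    ∫ y, Real.log (infDist (g y) (↑β : Set (Eu q))) ∂P ≤
      Real.log r + ∫ y, Real.log (infDist y (↑α : Set (Eu q))) ∂P := by
  have hβ : β.Nonempty := by
    obtain ⟨a, ha⟩ := hα
    exact ⟨_, hαβ a ha⟩
  obtain ⟨γ, hγ, -, hγm, hγd⟩ := pull hr h hβ
  obtain ⟨g1, g2⟩ := hP γ hγ
  have heq : ∀ᵐ y ∂P, Real.log r + Real.log (infDist y (↑γ : Set (Eu q))) =
      Real.log (infDist (g y) (↑β : Set (Eu q))) := by
    filter_upwards [g1] with y hy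
    rw [hγd, Real.log_mul hr.ne' hy.ne']
  have hint := ((integrable_const (Real.log r)).add g2)
  refine ⟨hint.congr heq, ?_⟩
  rw [← integral_congr_ae heq, integral_add (integrable_const _) g2]
  simp only [integral_const, probReal_univ, one_smul]
  refine add_le_add le_rfl ?_
  apply integral_mono_ae g2 (hP α hα).2
  filter_upwards [g1] with y hy
  apply Real.log_le_log hy
  apply infDist_le_infDist_of_subset _ (by simpa using hα)
  intro a ha
  exact (hγm a).2 (hαβ a ha)

lemma up_one {P : Measure (Eu q)} [IsProbabilityMeasure P] (hP : Good P) {x0 : Eu q} {R : ℝ}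
    (hR1 : 1 ≤ R) (hR : ∀ᵐ x ∂P, dist x x0 ≤ R) :
    ∫ y, Real.log (infDist y (↑({x0} : Finset (Eu q)) : Set (Eu q))) ∂P ≤ Real.log R := by
  obtain ⟨h1, h2⟩ := hP {x0} (by simp)
  have : ∫ y, Real.log (infDist y (↑({x0} : Finset (Eu q)) : Set (Eu q))) ∂P ≤
      ∫ y, Real.log R ∂P := by
    apply integral_mono_ae h2 (integrable_const _)
    filter_upwards [h1, hR] with y hy hy2
    apply Real.log_le_log hy
    simpa using hy2
  simpa using this

lemma upper_ν (hN : 2 ≤ N) (hs : ∀ i, s i ∈ Set.Ioo (0 : ℝ) 1)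
    (hf : ∀ i x y, dist (f i x) (f i y) = s i * dist x y)
    (ht : ∀ i, 0 < t i) (htsum : ∑ i, t i = 1) (hνp : IsProbabilityMeasure ν)
    (hν : ν = ∑ i, ENNReal.ofReal (t i) • ν.map (f i))
    {κ : ℝ} (hκ : 0 < κ)
    (hbal : ∑ i, t i * (-Real.log (s i) + κ * Real.log (t i)) = 0) (hG : Good ν) {x0 : Eu q}
    {R : ℝ} (hR1 : 1 ≤ R) (hR : ∀ᵐ x ∂ν, dist x x0 ≤ R) :
    ∃ C, ∀ n : ℕ, 1 ≤ n → ∃ α : Finset (Eu q), α.Nonempty ∧ α.card ≤ n ∧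
      ∫ y, Real.log (infDist y (↑α : Set (Eu q))) ∂ν ≤ -κ * Real.log n + C := by
  have hs0 : ∀ i, 0 < s i := fun i => (hs i).1
  have i0 : Fin N := ⟨0, by omega⟩
  obtain ⟨im, -, him⟩ := Finset.exists_max_image Finset.univ t ⟨i0, Finset.mem_univ _⟩
  obtain ⟨il, -, hil⟩ := Finset.exists_min_image Finset.univ t ⟨i0, Finset.mem_univ _⟩
  have htm := t_lt_one hN ht htsum im
  have htl := ht il
  have base : ∀ x : ℝ, t il ≤ x → x ≤ 1 → ∃ α : Finset (Eu q), α.Nonempty ∧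
      (α.card : ℝ) ≤ x / t il ∧
      ∫ y, Real.log (infDist y (↑α : Set (Eu q))) ∂ν ≤ -κ * Real.log x + Real.log R := by
    intro x hx hx1
    refine ⟨{x0}, by simp, ?_, ?_⟩
    · rw [le_div_iff₀ htl]; simpa using hx
    · have := up_one hG hR1 hR
      have := Real.log_nonpos (by linarith) hx1
      nlinarith
  have main : ∀ n : ℕ, ∀ x : ℝ, t il ≤ x → x ≤ (1 / t im) ^ n → ∃ α : Finset (Eu q),
      α.Nonempty ∧ (α.card : ℝ) ≤ x / t il ∧
      ∫ y, Real.log (infDist y (↑α : Set (Eu q))) ∂ν ≤ -κ * Real.log x + Real.log R := by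
    intro n
    induction n with
    | zero => intro x hx hx1; exact base x hx (by simpa using hx1)
    | succ n ih =>
      intro x hx hxn
      rcases le_or_gt x 1 with hx1 | hx1
      · exact base x hx hx1
      classical
      have hx0 : 0 < x := by linarith
      have : ∀ i, ∃ α : Finset (Eu q),
        α.Nonempty ∧ (α.card : ℝ) ≤ t i * x / t il ∧
        ∫ y, Real.log (infDist y (↑α : Set (Eu q))) ∂ν ≤ -κ * Real.log (t i * x) + Real.log R := by
        intro i
        have hi := ht i
        apply ih
        · have := hil i (Finset.mem_univ _)
          nlinarith
        · have := him i (Finset.mem_univ _)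
          have hp := ht im
          calc t i * x ≤ t im * (1 / t im) ^ (n + 1) := by gcongr
            _ = _ := by rw [pow_succ]; field_simp
      choose α hα hαc hαi using this
      let β : Finset (Eu q) := Finset.univ.biUnion fun i => (α i).image (f i)
      have hβ : ∀ i, ∀ a ∈ α i, f i a ∈ β := by
        intro i a ha
        exact Finset.mem_biUnion.2 ⟨i, Finset.mem_univ _, Finset.mem_image_of_mem _ ha⟩
      refine ⟨β, ?_, ?_, ?_⟩
      · obtain ⟨a, ha⟩ := hα i0
        exact ⟨_, hβ i0 a ha⟩
      · have h1 : β.card ≤ ∑ i, (α i).card :=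
          Finset.card_biUnion_le.trans (Finset.sum_le_sum (fun i _ => Finset.card_image_le))
        calc (β.card : ℝ) ≤ ∑ i, ((α i).card : ℝ) := by exact_mod_cast h1
          _ ≤ ∑ i, t i * x / t il := Finset.sum_le_sum (fun i _ => hαc i)
          _ = _ := by
            rw [← Finset.sum_div, ← Finset.sum_mul, htsum, one_mul]
      · have hst := fun i => up_step hG (hs0 i) (hf i) (hα i) (hβ i)
        rw [int_ν hs hf ht hν (g := fun y => Real.log (infDist y (↑β : Set (Eu q))))
          (Real.measurable_log.comp measurable_infDist) (fun i => (hst i).1)]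
        have e : ∀ i, t i * ∫ y, Real.log (infDist (f i y) (↑β : Set (Eu q))) ∂ν ≤
            -(t i * (-Real.log (s i) + κ * Real.log (t i))) +
              t i * (-κ * Real.log x + Real.log R) := by
          intro i
          have g1 := (hst i).2.trans (add_le_add_right (hαi i) _)
          have g2 := mul_le_mul_of_nonneg_left g1 (ht i).le
          rw [Real.log_mul (ht i).ne' hx0.ne'] at g2
          refine g2.trans (le_of_eq ?_)
          ring
        refine (Finset.sum_le_sum (fun i _ => e i)).trans (le_of_eq ?_)
        rw [Finset.sum_add_distrib, Finset.sum_neg_distrib, hbal, ← Finset.sum_mul, htsum]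
        ring
  have h1t : 1 < 1 / t im := by rw [lt_div_iff₀ (ht im)]; linarith
  refine ⟨-κ * Real.log (t il) + Real.log R, fun n hn => ?_⟩
  have hn1 : (1:ℝ) ≤ n := by exact_mod_cast hn
  obtain ⟨m, hm⟩ := pow_unbounded_of_one_lt (n * t il) h1t
  obtain ⟨α, h1, h2, h3⟩ := main m (n * t il) (by nlinarith) hm.le
  refine ⟨α, h1, ?_, ?_⟩
  · rw [mul_div_cancel_right₀ _ htl.ne'] at h2
    exact_mod_cast h2
  · rw [Real.log_mul (by linarith) htl.ne'] at h3
    linarith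

lemma upper_μ (hN : 2 ≤ N) (hs : ∀ i, s i ∈ Set.Ioo (0 : ℝ) 1)
    (hf : ∀ i x y, dist (f i x) (f i y) = s i * dist x y)
    {p : Fin (N + 1) → ℝ} (hp : ∀ i, 0 < p i) (hpsum : ∑ i, p i = 1)
    {μ : Measure (Eu q)} (hμp : IsProbabilityMeasure μ)
    (hμ : μ = ENNReal.ofReal (p 0) • ν + ∑ i : Fin N, ENNReal.ofReal (p i.succ) • μ.map (f i))
    {κ : ℝ} (hκ : 0 < κ) (hGν : Good ν) (hG : Good μ) {x0 : Eu q}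
    {R : ℝ} (hR1 : 1 ≤ R) (hR : ∀ᵐ x ∂μ, dist x x0 ≤ R) {Cν : ℝ}
    (hCν : ∀ n : ℕ, 1 ≤ n → ∃ α : Finset (Eu q), α.Nonempty ∧ α.card ≤ n ∧
      ∫ y, Real.log (infDist y (↑α : Set (Eu q))) ∂ν ≤ -κ * Real.log n + Cν) :
    ∃ C, ∀ n : ℕ, 1 ≤ n → ∃ α : Finset (Eu q), α.Nonempty ∧ α.card ≤ n ∧
      ∫ y, Real.log (infDist y (↑α : Set (Eu q))) ∂μ ≤ -κ * Real.log n + C := by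
  have hs0 : ∀ i, 0 < s i := fun i => (hs i).1
  have hp1 : ∀ i, p i < 1 := t_lt_one (by omega) hp hpsum
  obtain ⟨il, -, hil⟩ := Finset.exists_min_image Finset.univ p ⟨0, Finset.mem_univ _⟩
  obtain ⟨n0, hn0⟩ := exists_nat_gt (1 / p il)
  have hn0' : ∀ i, 1 ≤ p i * n0 := by
    intro i
    rw [div_lt_iff₀ (hp il)] at hn0
    have := hil i (Finset.mem_univ _)
    have h0 : (0:ℝ) ≤ n0 := Nat.cast_nonneg _
    nlinarith
  have hp0 := hp 0
  have hps : ∑ i : Fin N, p i.succ = 1 - p 0 := by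
    rw [Fin.sum_univ_succ] at hpsum; linarith
  set H := p 0 * (Cν - κ * Real.log (p 0 / 2)) +
    ∑ i : Fin N, p i.succ * (Real.log (s i) - κ * Real.log (p i.succ / 2)) with hH
  set C := max (H / p 0) (Real.log R + κ * Real.log n0) with hC
  have hC1 : H ≤ p 0 * C := by
    have := le_max_left (H / p 0) (Real.log R + κ * Real.log n0)
    rw [← hC, div_le_iff₀ hp0] at this
    linarith
  have hC2 : Real.log R + κ * Real.log n0 ≤ C := le_max_right _ _
  refine ⟨C, fun n => ?_⟩
  induction n using Nat.strong_induction_on with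
  | _ n ih =>
  intro hn
  have hn1 : (1:ℝ) ≤ n := by exact_mod_cast hn
  rcases le_or_gt n n0 with hnn | hnn
  · refine ⟨{x0}, by simp, by simpa using hn, ?_⟩
    have h1 := up_one hG hR1 hR
    have h2 : Real.log n ≤ Real.log n0 := Real.log_le_log (by linarith) (by exact_mod_cast hnn)
    nlinarith
  classical
  have hnn' : (n0:ℝ) < n := by exact_mod_cast hnn
  have hpn : ∀ i, 1 ≤ p i * n := fun i => (hn0' i).trans (by have := hp i; gcongr)
  let m : Fin (N + 1) → ℕ := fun i => ⌊p i * n⌋₊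
  have hm1 : ∀ i, 1 ≤ m i := fun i => Nat.one_le_floor_iff _ |>.2 (hpn i)
  have hm2 : ∀ i, (m i : ℝ) ≤ p i * n := fun i => Nat.floor_le (by linarith [hpn i])
  have hm3 : ∀ i, p i / 2 * n ≤ m i := by
    intro i
    have h1 : p i * n < m i + 1 := Nat.lt_floor_add_one _
    have h2 : (1:ℝ) ≤ m i := by exact_mod_cast hm1 i
    linarith
  have hm4 : ∀ i, m i < n := by
    intro i
    have : (m i : ℝ) < n := lt_of_le_of_lt (hm2 i) (by have := hp1 i; nlinarith)
    exact_mod_cast this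
  have hm5 : ∀ i, -κ * Real.log (m i) ≤ -κ * Real.log n - κ * Real.log (p i / 2) := by
    intro i
    have hi := hp i
    have := Real.log_le_log (by positivity) (hm3 i)
    rw [Real.log_mul (by positivity) (by positivity)] at this
    nlinarith
  obtain ⟨α0, hα0, hα0c, hα0i⟩ := hCν (m 0) (hm1 0)
  have := fun i : Fin N => ih (m i.succ) (hm4 _) (hm1 _)
  choose α hα hαc hαi using this
  let β : Finset (Eu q) := α0 ∪ Finset.univ.biUnion fun i => (α i).image (f i)
  have hβ : ∀ i, ∀ a ∈ α i, f i a ∈ β := by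
    intro i a ha
    exact Finset.mem_union_right _
      (Finset.mem_biUnion.2 ⟨i, Finset.mem_univ _, Finset.mem_image_of_mem _ ha⟩)
  have hβn : β.Nonempty := hα0.mono Finset.subset_union_left
  refine ⟨β, hβn, ?_, ?_⟩
  · have h1 : β.card ≤ m 0 + ∑ i : Fin N, m i.succ := by
      refine (Finset.card_union_le _ _).trans (add_le_add hα0c ?_)
      exact Finset.card_biUnion_le.trans
        (Finset.sum_le_sum (fun i _ => Finset.card_image_le.trans (hαc i)))
    rw [← Fin.sum_univ_succ] at h1
    have h2 : (∑ i, (m i : ℝ)) ≤ n := by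
      calc (∑ i, (m i : ℝ)) ≤ ∑ i, p i * n := Finset.sum_le_sum (fun i _ => hm2 i)
        _ = n := by rw [← Finset.sum_mul, hpsum, one_mul]
    have h3 : ∑ i, m i ≤ n := by exact_mod_cast h2
    exact h1.trans h3
  · have hst := fun i => up_step hG (hs0 i) (hf i) (hα i) (hβ i)
    rw [int_μ hs hf hp hμ (g := fun y => Real.log (infDist y (↑β : Set (Eu q))))
      (Real.measurable_log.comp measurable_infDist) (hGν β hβn).2 (fun i => (hst i).1)]
    have e0 : ∫ y, Real.log (infDist y (↑β : Set (Eu q))) ∂ν ≤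
        ∫ y, Real.log (infDist y (↑α0 : Set (Eu q))) ∂ν := by
      apply integral_mono_ae (hGν β hβn).2 (hGν α0 hα0).2
      filter_upwards [(hGν β hβn).1] with y hy
      apply Real.log_le_log hy
      apply infDist_le_infDist_of_subset _ (by simpa using hα0)
      exact_mod_cast Finset.subset_union_left
    have e1 : p 0 * ∫ y, Real.log (infDist y (↑β : Set (Eu q))) ∂ν ≤
        p 0 * (-κ * Real.log n - κ * Real.log (p 0 / 2) + Cν) := by
      apply mul_le_mul_of_nonneg_left _ hp0.le
      linarith [hm5 0]
    have e2 : ∑ i : Fin N, p i.succ * ∫ y, Real.log (infDist (f i y) (↑β : Set (Eu q))) ∂μ ≤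
        ∑ i : Fin N, (p i.succ * (Real.log (s i) - κ * Real.log (p i.succ / 2)) +
          p i.succ * (-κ * Real.log n + C)) := by
      apply Finset.sum_le_sum
      intro i _
      rw [← mul_add]
      apply mul_le_mul_of_nonneg_left _ (hp _).le
      linarith [hm5 i.succ, (hst i).2, hαi i]
    rw [Finset.sum_add_distrib, ← Finset.sum_mul, hps] at e2
    nlinarith

lemma bounds (hN : 2 ≤ N) (hs : ∀ i, s i ∈ Set.Ioo (0 : ℝ) 1)
    (hf : ∀ i x y, dist (f i x) (f i y) = s i * dist x y)
    (hOSC : ∃ U : Set (Eu q), U.Nonempty ∧ IsOpen U ∧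
      Bornology.IsBounded U ∧
      (∀ i j, i ≠ j → Disjoint (f i '' U) (f j '' U)) ∧
      (⋃ i, f i '' U) ⊆ U)
    (ht : ∀ i, 0 < t i) (htsum : ∑ i, t i = 1) (hνp : IsProbabilityMeasure ν)
    (hν : ν = ∑ i, ENNReal.ofReal (t i) • ν.map (f i))
    {p : Fin (N + 1) → ℝ} (hp : ∀ i, 0 < p i) (hpsum : ∑ i, p i = 1)
    {μ : Measure (Eu q)} (hμp : IsProbabilityMeasure μ)
    (hμ : μ = ENNReal.ofReal (p 0) • ν + ∑ i : Fin N, ENNReal.ofReal (p i.succ) • μ.map (f i))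
    {κ : ℝ} (hκ : 0 < κ)
    (hbal : ∑ i, t i * (-Real.log (s i) + κ * Real.log (t i)) = 0) :
    ∃ c C : ℝ, ∀ n : ℕ, 1 ≤ n →
      Real.exp (-κ * Real.log n - c) ≤ geomError μ n ∧
      geomError μ n ≤ Real.exp (-κ * Real.log n + C) := by
  obtain ⟨c, hc⟩ := lower_phi hN hs hf hOSC ht htsum hνp hν hp hpsum hμp hμ hκ hbal
  obtain ⟨R, hR1, hRν, hRμ⟩ := supp_ν hN hs hf ht htsum hνp hν hp hpsum hμp hμ 0
  have key : ∀ n : ℕ, 1 ≤ n → ∀ α : Finset (Eu q), α.Nonempty → α.card ≤ n → _ := 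
    fun n hn α hα hαn =>
      let ⟨_, h⟩ := infDist_bdd hRμ hα
      phi_fin μ (measurable_infDist (s := (↑α : Set (Eu q)))) (fun x => infDist_nonneg) h
        (fun ε h0 h1 => (hc ε h0 h1 n hn α hα hαn).2)
  have hGμ : Good μ := fun α hα =>
    let h := key α.card hα.card_pos α hα le_rfl
    ⟨h.1, h.2.1⟩
  have hGν : Good ν := fun α hα =>
    let ⟨_, h⟩ := infDist_bdd hRν hα
    let h := phi_fin ν (measurable_infDist (s := (↑α : Set (Eu q)))) (fun x => infDist_nonneg) h
        (fun ε h0 h1 => (hc ε h0 h1 α.card hα.card_pos α hα le_rfl).1)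
    ⟨h.1, h.2.1⟩
  obtain ⟨Cν, hCν⟩ := upper_ν hN hs hf ht htsum hνp hν hκ hbal hGν hR1 hRν
  obtain ⟨C, hC⟩ := upper_μ hN hs hf hp hpsum hμp hμ hκ hGν hGμ hR1 hRμ hCν
  refine ⟨c, C, fun n hn => ⟨?_, ?_⟩⟩
  · apply le_csInf
    · obtain ⟨α, h1, h2, h3⟩ := hC n hn
      exact ⟨_, α, h1, h2, rfl⟩
    · rintro _ ⟨α, h1, h2, rfl⟩
      apply Real.exp_le_exp.2
      have := (key n hn α h1 h2).2.2
      linarith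
  · obtain ⟨α, h1, h2, h3⟩ := hC n hn
    refine le_trans (csInf_le ?_ ⟨α, h1, h2, rfl⟩) (Real.exp_le_exp.2 h3)
    refine ⟨0, ?_⟩
    rintro _ ⟨α, h1, h2, rfl⟩
    exact (Real.exp_pos _).le

end final
end Quant
theorem stmt0 (q N : ℕ) (hq : 1 ≤ q) (hN : 2 ≤ N)
    (f : Fin N → EuclideanSpace ℝ (Fin q) → EuclideanSpace ℝ (Fin q))
    (s : Fin N → ℝ) (hs : ∀ i, s i ∈ Set.Ioo (0 : ℝ) 1)
    (hf : ∀ i x y, dist (f i x) (f i y) = s i * dist x y)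
    (hOSC : ∃ U : Set (EuclideanSpace ℝ (Fin q)), U.Nonempty ∧ IsOpen U ∧
      Bornology.IsBounded U ∧
      (∀ i j, i ≠ j → Disjoint (f i '' U) (f j '' U)) ∧
      (⋃ i, f i '' U) ⊆ U)
    (t : Fin N → ℝ) (ht : ∀ i, 0 < t i) (htsum : ∑ i, t i = 1)
    (ν : Measure (EuclideanSpace ℝ (Fin q))) (hνp : IsProbabilityMeasure ν)
    (hν : ν = ∑ i, ENNReal.ofReal (t i) • ν.map (f i))
    (p : Fin (N + 1) → ℝ) (hp : ∀ i, 0 < p i) (hpsum : ∑ i, p i = 1)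
    (μ : Measure (EuclideanSpace ℝ (Fin q))) (hμp : IsProbabilityMeasure μ)
    (hμ : μ = ENNReal.ofReal (p 0) • ν + ∑ i : Fin N, ENNReal.ofReal (p i.succ) • μ.map (f i))
    (d₀ : ℝ) (hd₀ : d₀ = (∑ i, t i * Real.log (t i)) / (∑ i, t i * Real.log (s i))) :
    0 < liminf (fun n : ℕ => ENNReal.ofReal ((n : ℝ) ^ (1 / d₀) * geomError μ n)) atTop ∧
    limsup (fun n : ℕ => ENNReal.ofReal ((n : ℝ) ^ (1 / d₀) * geomError μ n)) atTop < ⊤ ∧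
    Tendsto (fun n : ℕ => Real.log n / (-Real.log (geomError μ n))) atTop (nhds d₀) := by
  have hs0 : ∀ i, 0 < s i := fun i => (hs i).1
  have i0 : Fin N := ⟨0, by omega⟩
  have hA : ∑ i, t i * Real.log (t i) < 0 := by
    apply Finset.sum_neg _ ⟨i0, Finset.mem_univ _⟩
    intro i _
    exact mul_neg_of_pos_of_neg (ht i) (Real.log_neg (ht i) (Quant.t_lt_one hN ht htsum i))
  have hB : ∑ i, t i * Real.log (s i) < 0 := by
    apply Finset.sum_neg _ ⟨i0, Finset.mem_univ _⟩
    intro i _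
    exact mul_neg_of_pos_of_neg (ht i) (Real.log_neg (hs0 i) (hs i).2)
  have hd : 0 < d₀ := by rw [hd₀]; exact div_pos_of_neg_of_neg hA hB
  have hκ : 0 < 1 / d₀ := by positivity
  have hbal : ∑ i, t i * (-Real.log (s i) + 1 / d₀ * Real.log (t i)) = 0 := by
    have : ∑ i, t i * (-Real.log (s i) + 1 / d₀ * Real.log (t i)) =
        -(∑ i, t i * Real.log (s i)) + 1 / d₀ * ∑ i, t i * Real.log (t i) := by
      rw [Finset.mul_sum, ← Finset.sum_neg_distrib, ← Finset.sum_add_distrib]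
      exact Finset.sum_congr rfl (fun i _ => by ring)
    rw [this, hd₀]
    have := hA.ne
    have := hB.ne
    field_simp
    ring
  obtain ⟨c, C, hcC⟩ := Quant.bounds hN hs hf hOSC ht htsum hνp hν hp hpsum hμp hμ hκ hbal
  have hpow : ∀ n : ℕ, 1 ≤ n → (n : ℝ) ^ (1 / d₀) = Real.exp (1 / d₀ * Real.log n) := by
    intro n hn
    rw [Real.rpow_def_of_pos (by exact_mod_cast hn), mul_comm]
  have hlo : ∀ n : ℕ, 1 ≤ n → Real.exp (-c) ≤ (n : ℝ) ^ (1 / d₀) * geomError μ n := by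
    intro n hn
    rw [hpow n hn]
    calc Real.exp (-c) = Real.exp (1 / d₀ * Real.log n) *
          Real.exp (-(1 / d₀) * Real.log n - c) := by rw [← Real.exp_add]; ring_nf
      _ ≤ _ := mul_le_mul_of_nonneg_left (hcC n hn).1 (Real.exp_pos _).le
  have hhi : ∀ n : ℕ, 1 ≤ n → (n : ℝ) ^ (1 / d₀) * geomError μ n ≤ Real.exp C := by
    intro n hn
    rw [hpow n hn]
    calc _ ≤ Real.exp (1 / d₀ * Real.log n) *
          Real.exp (-(1 / d₀) * Real.log n + C) :=
            mul_le_mul_of_nonneg_left (hcC n hn).2 (Real.exp_pos _).le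
      _ = _ := by rw [← Real.exp_add]; ring_nf
  refine ⟨?_, ?_, ?_⟩
  · refine lt_of_lt_of_le (ENNReal.ofReal_pos.2 (Real.exp_pos (-c))) ?_
    apply le_liminf_of_le
    · isBoundedDefault
    · filter_upwards [eventually_ge_atTop 1] with n hn
      exact ENNReal.ofReal_le_ofReal (hlo n hn)
  · refine lt_of_le_of_lt ?_ (ENNReal.ofReal_lt_top (r := Real.exp C))
    apply limsup_le_of_le
    · isBoundedDefault
    · filter_upwards [eventually_ge_atTop 1] with n hn
      exact ENNReal.ofReal_le_ofReal (hhi n hn)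
  · have hlog : Tendsto (fun n : ℕ => Real.log n) atTop atTop :=
      Real.tendsto_log_atTop.comp tendsto_natCast_atTop_atTop
    have hinv : ∀ K : ℝ, Tendsto (fun n : ℕ => 1 / d₀ + K / Real.log n) atTop (nhds (1 / d₀)) := by
      intro K
      have := (tendsto_const_nhds (x := 1 / d₀)).add (hlog.const_div_atTop K)
      simpa using this
    have hlim : Tendsto (fun n : ℕ => -Real.log (geomError μ n) / Real.log n) atTop
        (nhds (1 / d₀)) := by
      apply tendsto_of_tendsto_of_tendsto_of_le_of_le' (hinv (-C)) (hinv c)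
      · filter_upwards [eventually_ge_atTop 1, hlog.eventually_gt_atTop 0] with n hn hn0
        have h1 := hcC n hn
        have hpos : 0 < geomError μ n := (Real.exp_pos _).trans_le h1.1
        have h2 := (Real.log_le_iff_le_exp hpos).2 h1.2
        rw [le_div_iff₀ hn0, add_mul, div_mul_cancel₀ _ hn0.ne']
        linarith
      · filter_upwards [eventually_ge_atTop 1, hlog.eventually_gt_atTop 0] with n hn hn0
        have h1 := hcC n hn
        have hpos : 0 < geomError μ n := (Real.exp_pos _).trans_le h1.1
        have h2 := (Real.le_log_iff_exp_le hpos).2 h1.1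
        rw [div_le_iff₀ hn0, add_mul, div_mul_cancel₀ _ hn0.ne']
        linarith
    have := hlim.inv₀ hκ.ne'
    simpa using this
end

section
/- Set d₀ := (Σ_{i=1}^M t_i log t_i)/(Σ_{i=1}^M t_i log c_i). Then 0 < liminf_{n→∞} n^{1/d₀} e_{n,0}(μ) ≤ limsup_{n→∞} n^{1/d₀} e_{n,0}(μ) < ∞; in particular, the quantization dimension of order zero of μ exists and equals d₀, i.e. lim_{n→∞} (log n)/(−log e_{n,0}(μ)) = d₀. -/
open MeasureTheory Filter Metric

/-- The topological support of a measure: points all of whose open neighbourhoods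
have positive measure. -/
def msupport {q : ℕ} (ν : Measure (EuclideanSpace ℝ (Fin q))) : Set (EuclideanSpace ℝ (Fin q)) :=
  {x | ∀ U : Set (EuclideanSpace ℝ (Fin q)), IsOpen U → x ∈ U → ν U ≠ 0}


set_option linter.unusedSectionVars false
section Helper
variable {X : Type*} [NormedAddCommGroup X] [InnerProductSpace ℝ X] [FiniteDimensional ℝ X]

lemma sim_inj {h : X → X} {r : ℝ} (hr : 0 < r) (hh : ∀ x y, dist (h x) (h y) = r * dist x y) :
    Function.Injective h := by
  intro x y hxy
  have := hh x y
  rw [hxy, dist_self] at this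
  have h2 : dist x y = 0 := by
    rcases mul_eq_zero.1 this.symm with h | h
    · exact absurd h hr.ne'
    · exact h
  exact dist_eq_zero.1 h2

lemma sim_surj {h : X → X} {r : ℝ} (hr : 0 < r) (hh : ∀ x y, dist (h x) (h y) = r * dist x y) :
    Function.Surjective h := by
  have hk : Isometry (fun x => r⁻¹ • h x) := by
    refine Isometry.of_dist_eq fun x y => ?_
    rw [dist_smul₀, hh, Real.norm_eq_abs, abs_of_pos (inv_pos.2 hr), inv_mul_cancel_left₀ hr.ne']
  haveI : Inhabited X := ⟨0⟩
  let e := (hk.affineIsometryOfStrictConvexSpace).toAffineIsometryEquiv rfl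
  intro y
  obtain ⟨x, hx⟩ := e.surjective (r⁻¹ • y)
  refine ⟨x, ?_⟩
  have h1 : r⁻¹ • h x = r⁻¹ • y := hx
  exact smul_right_injective X (inv_ne_zero hr.ne') h1

lemma sim_cont {h : X → X} {r : ℝ} (hr : 0 < r) (hh : ∀ x y, dist (h x) (h y) = r * dist x y) :
    Continuous h := by
  have : LipschitzWith r.toNNReal h := LipschitzWith.of_dist_le_mul fun x y => by
    rw [hh, Real.coe_toNNReal _ hr.le]
  exact this.continuous

lemma infDist_sim {h : X → X} {r : ℝ} (hr : 0 < r) (hh : ∀ x y, dist (h x) (h y) = r * dist x y)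
    (S : Set X) (hS : S.Nonempty) (x : X) :
    infDist (h x) S = r * infDist x (h ⁻¹' S) := by
  have hs := sim_surj hr hh
  have hne : (h ⁻¹' S).Nonempty := hS.preimage hs
  apply le_antisymm
  · have : infDist (h x) S / r ≤ infDist x (h ⁻¹' S) := by
      rw [le_infDist hne]
      intro y hy
      rw [div_le_iff₀ hr, mul_comm, ← hh]
      exact infDist_le_dist_of_mem hy
    rwa [div_le_iff₀ hr, mul_comm] at this
  · rw [le_infDist hS]
    intro y hy
    obtain ⟨z, rfl⟩ := hs y
    rw [hh]
    exact mul_le_mul_of_nonneg_left (infDist_le_dist_of_mem hy) hr.le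

lemma sim_ball {h : X → X} {r : ℝ} (hr : 0 < r) (hh : ∀ x y, dist (h x) (h y) = r * dist x y)
    (x : X) (e : ℝ) : h '' ball x e = ball (h x) (r * e) := by
  ext y
  obtain ⟨z, rfl⟩ := sim_surj hr hh y
  rw [(sim_inj hr hh).mem_set_image, mem_ball, mem_ball, hh, mul_lt_mul_iff_right₀ hr]

lemma fix_lemma (S : Set ℝ) (hb : BddAbove S) (t k : ℝ) (ht : 0 < t)
    (h : ∀ B, (∀ e ∈ S, e ≤ B) → ∀ e ∈ S, e ≤ (1 - t) * B + k) :
    ∀ e ∈ S, e ≤ k / t := by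
  intro e he
  have h1 := h (sSup S) (fun e he => le_csSup hb he)
  have h2 : sSup S ≤ (1 - t) * sSup S + k := csSup_le ⟨e, he⟩ h1
  have h3 : e ≤ sSup S := le_csSup hb he
  rw [le_div_iff₀ ht]
  nlinarith

/-! words -/
def gw {ι : Type*} (g : ι → X → X) : List ι → X → X
  | [] => id
  | i :: l => g i ∘ gw g l

def cw {ι : Type*} (c : ι → ℝ) (l : List ι) : ℝ := (l.map c).prod

section words
variable {ι : Type*} {g : ι → X → X} {c : ι → ℝ}
lemma gw_append (l l' : List ι) : gw g (l ++ l') = gw g l ∘ gw g l' := by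
  induction l with
  | nil => rfl
  | cons i l ih => simp [gw, ih, Function.comp_assoc]

lemma cw_append (l l' : List ι) : cw c (l ++ l') = cw c l * cw c l' := by simp [cw]

lemma cw_pos (hc : ∀ i, c i ∈ Set.Ioo (0 : ℝ) 1) (l : List ι) : 0 < cw c l := by
  induction l with
  | nil => simp [cw]
  | cons i l ih => simpa [cw] using mul_pos (hc i).1 ih

lemma cw_le_one (hc : ∀ i, c i ∈ Set.Ioo (0 : ℝ) 1) (l : List ι) : cw c l ≤ 1 := by
  induction l with
  | nil => simp [cw]
  | cons i l ih =>
    have := mul_le_one₀ (hc i).2.le (cw_pos hc l).le ih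
    simpa [cw] using this

lemma cw_lt_one (hc : ∀ i, c i ∈ Set.Ioo (0 : ℝ) 1) (l : List ι) (hl : l ≠ []) : cw c l < 1 := by
  cases l with
  | nil => exact absurd rfl hl
  | cons i l =>
    have h1 := (hc i).2
    have h2 := (hc i).1
    have h3 := cw_le_one hc l
    have h4 := cw_pos hc l
    have : cw c (i :: l) = c i * cw c l := by simp [cw]
    rw [this]
    nlinarith

lemma gw_dist (hg : ∀ i x y, dist (g i x) (g i y) = c i * dist x y) (l : List ι) (x y : X) :
    dist (gw g l x) (gw g l y) = cw c l * dist x y := by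
  induction l with
  | nil => simp [gw, cw]
  | cons i l ih =>
    have : cw c (i :: l) = c i * cw c l := by simp [cw]
    simp only [gw, Function.comp, hg, ih, this]; ring

/-- tree lemma -/
lemma tree_lemma [Fintype ι] [DecidableEq ι] (t : ι → ℝ) (ht : ∀ i, 0 < t i) (hts : ∑ i, t i = 1)
    (F : List ι → ℝ) (S b : ℝ) (hb : 0 ≤ b)
    (h1 : ∀ l, F l ≤ ∑ i, t i * F (l ++ [i])) (h2 : ∀ l, F l ≤ S + b * l.length)
    (s : List ι) : ∀ l, F l ≤ cw t s * F (l ++ s) + (1 - cw t s) * (S + b * (l.length + s.length)) := by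
  induction s with
  | nil => intro l; simp [cw]
  | cons a s ih =>
    intro l
    have e1 : cw t (a :: s) = t a * cw t s := by simp [cw]
    have h3 := h1 l
    rw [← Finset.add_sum_erase _ _ (Finset.mem_univ a)] at h3
    have hS : ∑ i ∈ Finset.univ.erase a, t i = 1 - t a := by
      rw [← hts, ← Finset.add_sum_erase _ t (Finset.mem_univ a)]; ring
    have h4 : ∑ i ∈ Finset.univ.erase a, t i * F (l ++ [i]) ≤
        ∑ i ∈ Finset.univ.erase a, t i * (S + b * (l.length + (a :: s).length)) := by
      refine Finset.sum_le_sum fun i _ => mul_le_mul_of_nonneg_left ?_ (ht i).le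
      refine (h2 _).trans ?_
      have : (0:ℝ) ≤ s.length := by positivity
      simp only [List.length_append, List.length_cons, List.length_nil]
      push_cast
      nlinarith
    rw [← Finset.sum_mul, hS] at h4
    have h5 := mul_le_mul_of_nonneg_left (ih (l ++ [a])) (ht a).le
    have e2 : l ++ [a] ++ s = l ++ a :: s := by simp
    rw [e2] at h5
    rw [e1]
    refine h3.trans ((add_le_add h5 h4).trans (le_of_eq ?_))
    simp only [List.length_append, List.length_cons, List.length_nil]
    push_cast
    ring

lemma exists_prefix (l : List ι) (r : ℝ) (hr : r < 1) (hl : cw c l ≤ r) :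
    ∃ τ, τ ≠ [] ∧ τ <+: l ∧ cw c τ ≤ r ∧ r < cw c τ.dropLast := by
  induction l using List.reverseRecOn with
  | nil => simp [cw] at hl; linarith
  | append_singleton l a ih =>
    by_cases h : cw c l ≤ r
    · obtain ⟨τ, h1, h2, h3⟩ := ih h
      exact ⟨τ, h1, h2.trans (List.prefix_append _ _), h3⟩
    · refine ⟨l ++ [a], by simp, List.prefix_rfl, hl, ?_⟩
      simpa using h

lemma cw_prefix (hc : ∀ i, c i ∈ Set.Ioo (0 : ℝ) 1) {l l' : List ι} (h : l <+: l') :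
    cw c l' ≤ cw c l := by
  obtain ⟨s, rfl⟩ := h
  rw [cw_append]
  exact mul_le_of_le_one_right (cw_pos hc l).le (cw_le_one hc s)

lemma gw_image_sub {V : Set X} (hV : ∀ i, g i '' V ⊆ V) (l : List ι) : gw g l '' V ⊆ V := by
  induction l with
  | nil => simp [gw]
  | cons i l ih =>
    rw [gw, Set.image_comp]
    exact (Set.image_mono ih).trans (hV i)

lemma words_disj {V : Set X} (hc : ∀ i, c i ∈ Set.Ioo (0 : ℝ) 1)
    (hg : ∀ i x y, dist (g i x) (g i y) = c i * dist x y)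
    (hV : ∀ i, g i '' V ⊆ V) (hd : ∀ i j, i ≠ j → Disjoint (g i '' V) (g j '' V)) :
    ∀ l l' : List ι, ¬ l <+: l' → ¬ l' <+: l → Disjoint (gw g l '' V) (gw g l' '' V) := by
  intro l
  induction l with
  | nil => intro l' h; exact absurd (List.nil_prefix) h
  | cons i l ih =>
    intro l' h1 h2
    cases l' with
    | nil => exact absurd (List.nil_prefix) h2
    | cons j l' =>
      rw [gw, gw, Set.image_comp, Set.image_comp]
      by_cases hij : i = j
      · subst hij
        rw [Set.disjoint_image_iff (sim_inj (hc i).1 (hg i))]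
        apply ih
        · intro h; exact h1 (by simpa using h)
        · intro h; exact h2 (by simpa using h)
      · exact (hd i j hij).mono (Set.image_mono (gw_image_sub hV l)) (Set.image_mono (gw_image_sub hV l'))
end words

lemma packing (R e : ℝ) (he : 0 < e) : ∃ L : ℕ, ∀ r > 0, ∀ y : X, ∀ P : Finset X,
    (∀ p ∈ P, dist p y ≤ R * r) → (∀ p ∈ P, ∀ p' ∈ P, p ≠ p' → e * r ≤ dist p p') → P.card ≤ L := by
  have hc : IsCompact (closedBall (0 : X) R) := isCompact_closedBall _ _
  obtain ⟨T, _, hT, hTc⟩ := hc.finite_cover_balls (e := e / 2) (by positivity)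
  refine ⟨hT.toFinset.card, ?_⟩
  intro r hr y P h1 h2
  have : ∀ p ∈ P, ∃ z ∈ T, dist (r⁻¹ • (p - y)) z < e / 2 := by
    intro p hp
    have : r⁻¹ • (p - y) ∈ closedBall (0 : X) R := by
      rw [mem_closedBall_zero_iff, norm_smul, ← dist_eq_norm, norm_inv, Real.norm_eq_abs, abs_of_pos hr,
        inv_mul_le_iff₀ hr, mul_comm]
      exact h1 p hp
    have := hTc this
    simpa using this
  choose! φ hφ1 hφ2 using this
  refine Finset.card_le_card_of_injOn φ (fun p hp => by simpa using hφ1 p hp) ?_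
  intro p hp p' hp' heq
  by_contra hne
  have h3 := h2 p hp p' hp' hne
  have h4 : dist (r⁻¹ • (p - y)) (r⁻¹ • (p' - y)) < e := by
    have := dist_triangle_right (r⁻¹ • (p - y)) (r⁻¹ • (p' - y)) (φ p)
    have a := hφ2 p hp
    have b := hφ2 p' hp'
    rw [← heq] at b
    linarith
  rw [dist_smul₀, dist_sub_right, norm_inv, Real.norm_eq_abs, abs_of_pos hr, inv_mul_lt_iff₀ hr] at h4
  linarith
end Helper

set_option linter.unusedSectionVars false

section HelperB
variable {X : Type*} [NormedAddCommGroup X] [InnerProductSpace ℝ X] [FiniteDimensional ℝ X]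
variable {ι : Type*} {g : ι → X → X} {c : ι → ℝ}

lemma packing_words (hc : ∀ i, c i ∈ Set.Ioo (0 : ℝ) 1)
    (hg : ∀ i x y, dist (g i x) (g i y) = c i * dist x y)
    {V : Set X} (hVo : IsOpen V) (hVn : V.Nonempty)
    (hV : ∀ i, g i '' V ⊆ V) (hd : ∀ i j, i ≠ j → Disjoint (g i '' V) (g j '' V))
    (D k : ℝ) (hk : 0 < k) :
    ∃ L : ℕ, ∀ r > 0, ∀ y : X, ∀ T : Finset (List ι),
      (∀ τ ∈ T, k * r ≤ cw c τ ∧ cw c τ ≤ r ∧ dist (gw g τ 0) y ≤ D * r) →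
      (∀ τ ∈ T, ∀ τ' ∈ T, τ ≠ τ' → ¬ τ <+: τ') → T.card ≤ L := by
  classical
  obtain ⟨v, hv⟩ := hVn
  obtain ⟨e, he, hball⟩ := Metric.isOpen_iff.1 hVo v hv
  obtain ⟨L, hL⟩ := packing (X := X) (D + ‖v‖) (e * k) (by positivity)
  refine ⟨L, fun r hr y T h1 h2 => ?_⟩
  have hsep : ∀ τ ∈ T, ∀ τ' ∈ T, τ ≠ τ' → e * k * r ≤ dist (gw g τ v) (gw g τ' v) := by
    intro τ hτ τ' hτ' hne
    by_contra hlt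
    push Not at hlt
    have hdis := words_disj hc hg hV hd τ τ' (h2 τ hτ τ' hτ' hne) (h2 τ' hτ' τ hτ hne.symm)
    have hmem : gw g τ v ∈ gw g τ' '' V := by
      apply Set.image_mono hball
      rw [sim_ball (cw_pos hc τ') (gw_dist hg τ'), mem_ball]
      have := (h1 τ' hτ').1
      nlinarith
    exact Set.disjoint_left.1 hdis (Set.mem_image_of_mem _ hv) hmem
  have hinj : Set.InjOn (fun τ => gw g τ v) T := by
    intro τ hτ τ' hτ' heq
    by_contra hne
    have := hsep τ hτ τ' hτ' hne
    simp only at heq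
    rw [heq, dist_self] at this
    have : 0 < e * k * r := by positivity
    linarith
  rw [← Finset.card_image_of_injOn hinj]
  apply hL r hr y
  · intro p hp
    obtain ⟨τ, hτ, rfl⟩ := Finset.mem_image.1 hp
    obtain ⟨_, a2, a3⟩ := h1 τ hτ
    have := dist_triangle (gw g τ v) (gw g τ 0) y
    have h5 := gw_dist hg τ v 0
    rw [dist_zero_right] at h5
    nlinarith [norm_nonneg v]
  · intro p hp p' hp' hne
    obtain ⟨τ, hτ, rfl⟩ := Finset.mem_image.1 hp
    obtain ⟨τ', hτ', rfl⟩ := Finset.mem_image.1 hp'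
    exact hsep τ hτ τ' hτ' (fun h => hne (by rw [h]))

lemma gw_norm {R : ℝ} (hR : ∀ i x, ‖x‖ ≤ R → ‖g i x‖ ≤ R) (l : List ι) (x : X) (hx : ‖x‖ ≤ R) :
    ‖gw g l x‖ ≤ R := by
  induction l with
  | nil => simpa [gw] using hx
  | cons i l ih => exact hR i _ ih

lemma schief [Fintype ι] [Nonempty ι] (hc : ∀ i, c i ∈ Set.Ioo (0 : ℝ) 1)
    (hg : ∀ i x y, dist (g i x) (g i y) = c i * dist x y)
    {V : Set X} (hVo : IsOpen V) (hVn : V.Nonempty)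
    (hV : ∀ i, g i '' V ⊆ V) (hd : ∀ i j, i ≠ j → Disjoint (g i '' V) (g j '' V))
    (R : ℝ) (hR0 : 0 ≤ R) (hR : ∀ i x, ‖x‖ ≤ R → ‖g i x‖ ≤ R) :
    ∃ (W : Set X) (σ : List ι) (δ : ℝ), 0 < δ ∧ δ ≤ 1 ∧ (∀ i, g i '' W ⊆ W) ∧
      (∀ i j, i ≠ j → Disjoint (g i '' W) (g j '' W)) ∧
      ∀ x, ‖x‖ ≤ R → ball (gw g σ x) δ ⊆ W := by
  classical
  obtain ⟨i0, hi0⟩ := Finite.exists_min c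
  set k := c i0 with hkdef
  have hk : 0 < k := (hc i0).1
  set ρ := R + 1 with hρ
  set D := 2 * ρ + 2 * R with hD
  obtain ⟨L, hL⟩ := packing_words hc hg hVo hVn hV hd D k hk
  let N : List ι → Set (List ι) := fun σ =>
    {τ | cw c τ ≤ cw c σ ∧ cw c σ < cw c τ.dropLast ∧ dist (gw g τ 0) (gw g σ 0) ≤ D * cw c σ}
  have hNne : ∀ σ, ∀ τ ∈ N σ, τ ≠ [] := by
    rintro σ τ ⟨h1, h2, _⟩ rfl
    simp [cw] at h1 h2
    linarith
  have hcard : ∀ σ, ∀ T : Finset (List ι), (↑T ⊆ N σ) → T.card ≤ L := by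
    intro σ T hT
    apply hL (cw c σ) (cw_pos hc σ) (gw g σ 0)
    · intro τ hτ
      obtain ⟨h1, h2, h3⟩ := hT hτ
      refine ⟨?_, h1, h3⟩
      have hne := hNne σ τ (hT hτ)
      have : cw c τ = cw c τ.dropLast * c (τ.getLast hne) := by
        conv_lhs => rw [← List.dropLast_append_getLast hne]
        rw [cw_append]; simp [cw]
      rw [this]
      have := hi0 (τ.getLast hne)
      have := cw_pos hc σ
      nlinarith
    · intro τ hτ τ' hτ' hne hp
      have h1 := (hT hτ).1
      have h2 := (hT hτ').2.1
      have hne' := hNne σ τ' (hT hτ')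
      have : τ <+: τ'.dropLast := by
        rw [← List.dropLast_append_getLast hne', List.prefix_concat_iff] at hp
        rcases hp with hp | hp
        · rw [List.dropLast_append_getLast hne'] at hp
          exact absurd hp hne
        · exact hp
      have := cw_prefix hc this
      linarith
  -- maximal
  have hmax : ∃ σ : List ι, σ ≠ [] ∧ ∃ T : Finset (List ι), ↑T ⊆ N σ ∧
      ∀ σ' : List ι, σ' ≠ [] → ∀ T' : Finset (List ι), ↑T' ⊆ N σ' → T'.card ≤ T.card := by
    let P : ℕ → Prop := fun n => ∃ σ : List ι, σ ≠ [] ∧ ∃ T : Finset (List ι), ↑T ⊆ N σ ∧ T.card = n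
    have hP0 : P 0 := ⟨[i0], by simp, ∅, by simp, rfl⟩
    have hPs : P (Nat.findGreatest P L) := Nat.findGreatest_spec (Nat.zero_le L) hP0
    obtain ⟨σ, hσ, T, hT, hTc⟩ := hPs
    refine ⟨σ, hσ, T, hT, fun σ' hσ' T' hT' => ?_⟩
    rw [hTc]
    exact Nat.le_findGreatest (hcard σ' T' hT') ⟨σ', hσ', T', hT', rfl⟩
  obtain ⟨σ, hσ, T, hT, hTmax⟩ := hmax
  have hkey : ∀ ω : List ι, ∀ τ ∈ N (ω ++ σ), ω <+: τ := by
    intro ω τ hτ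
    let T' := T.image (fun τ => ω ++ τ)
    have hT'card : T'.card = T.card :=
      Finset.card_image_of_injective _ (fun a b h => List.append_cancel_left h)
    have hT' : ↑T' ⊆ N (ω ++ σ) := by
      intro τ' hτ'
      obtain ⟨η, hη, rfl⟩ := Finset.mem_image.1 (Finset.mem_coe.1 hτ')
      obtain ⟨h1, h2, h3⟩ := hT hη
      have hp := cw_pos hc ω
      refine ⟨?_, ?_, ?_⟩
      · rw [cw_append, cw_append]; exact mul_le_mul_of_nonneg_left h1 hp.le
      · rw [List.dropLast_append_of_ne_nil (hNne _ _ (hT hη)), cw_append, cw_append]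
        exact mul_lt_mul_of_pos_left h2 hp
      · rw [gw_append, gw_append, cw_append, Function.comp, Function.comp, gw_dist hg]
        nlinarith
    by_contra hno
    have hnot : τ ∉ T' := by
      intro h
      obtain ⟨η, _, rfl⟩ := Finset.mem_image.1 h
      exact hno (List.prefix_append _ _)
    have := hTmax (ω ++ σ) (by simp [hσ]) (insert τ T') (by
      rw [Finset.coe_insert]; exact Set.insert_subset hτ hT')
    rw [Finset.card_insert_of_notMem hnot, hT'card] at this
    omega
  let W : Set X := ⋃ ζ : List ι, ball (gw g (ζ ++ σ) 0) (ρ * cw c (ζ ++ σ))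
  have himg : ∀ i, g i '' W = ⋃ ζ : List ι, ball (gw g (i :: ζ ++ σ) 0) (ρ * cw c (i :: ζ ++ σ)) := by
    intro i
    simp only [W, Set.image_iUnion]
    refine Set.iUnion_congr fun ζ => ?_
    rw [sim_ball (hc i).1 (hg i)]
    simp only [List.cons_append, gw, Function.comp, cw, List.map_cons, List.prod_cons]
    congr 1; ring
  have hone : ∀ i j, i ≠ j → ∀ ζ η : List ι, cw c (j :: η ++ σ) ≤ cw c (i :: ζ ++ σ) →
      ∀ x, x ∈ ball (gw g (i :: ζ ++ σ) 0) (ρ * cw c (i :: ζ ++ σ)) →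
        x ∈ ball (gw g (j :: η ++ σ) 0) (ρ * cw c (j :: η ++ σ)) → False := by
    intro i j hij ζ η hle x hx hy
    obtain ⟨τ, hτne, hτp, hτ1, hτ2⟩ := exists_prefix (c := c) (j :: η ++ σ) (cw c (i :: ζ ++ σ))
      (cw_lt_one hc _ (by simp)) hle
    have hτN : τ ∈ N (i :: ζ ++ σ) := by
      refine ⟨hτ1, hτ2, ?_⟩
      obtain ⟨s, hs⟩ := hτp
      have h1 : dist (gw g τ 0) (gw g (j :: η ++ σ) 0) ≤ cw c τ * R := by
        rw [← hs, gw_append, Function.comp, gw_dist hg, dist_zero_left]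
        exact mul_le_mul_of_nonneg_left (gw_norm hR s 0 (by simpa using hR0)) (cw_pos hc τ).le
      rw [mem_ball] at hx hy
      have h2 := dist_triangle (gw g τ 0) (gw g (j :: η ++ σ) 0) (gw g (i :: ζ ++ σ) 0)
      have h3 := dist_triangle_left (gw g (j :: η ++ σ) 0) (gw g (i :: ζ ++ σ) 0) x
      have h4 := cw_pos hc (i :: ζ ++ σ)
      have h5 : cw c τ * R ≤ cw c (i :: ζ ++ σ) * R := mul_le_mul_of_nonneg_right hτ1 hR0
      have h6 : ρ * cw c (j :: η ++ σ) ≤ ρ * cw c (i :: ζ ++ σ) :=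
        mul_le_mul_of_nonneg_left hle (by positivity)
      rw [hD]
      nlinarith
    have hpre := hkey (i :: ζ) τ hτN
    have h7 : i :: ζ <+: j :: (η ++ σ) := hpre.trans hτp
    exact hij (List.cons_prefix_cons.1 h7).1
  refine ⟨W, σ, cw c σ, cw_pos hc σ, cw_le_one hc σ, ?_, ?_, ?_⟩
  · intro i
    rw [himg]
    exact Set.iUnion_subset fun ζ => Set.subset_iUnion (fun ζ : List ι =>
      ball (gw g (ζ ++ σ) 0) (ρ * cw c (ζ ++ σ))) (i :: ζ)
  · intro i j hij
    rw [himg, himg, Set.disjoint_left]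
    intro x hx hy
    obtain ⟨ζ, hx⟩ := Set.mem_iUnion.1 hx
    obtain ⟨η, hy⟩ := Set.mem_iUnion.1 hy
    rcases le_total (cw c (j :: η ++ σ)) (cw c (i :: ζ ++ σ)) with h | h
    · exact hone i j hij ζ η h x hx hy
    · exact hone j i hij.symm η ζ h x hy hx
  · intro x hx y hy
    refine Set.mem_iUnion.2 ⟨[], ?_⟩
    rw [List.nil_append, mem_ball]
    rw [mem_ball] at hy
    have h1 := dist_triangle y (gw g σ x) (gw g σ 0)
    rw [gw_dist hg σ x 0, dist_zero_right] at h1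
    have := mul_le_mul_of_nonneg_left hx (cw_pos hc σ).le
    rw [hρ]; nlinarith

/-- two separated cells -/
lemma two_cells [Fintype ι] (i j : ι) (hij : i ≠ j) (hc : ∀ i, c i ∈ Set.Ioo (0 : ℝ) 1)
    (hg : ∀ i x y, dist (g i x) (g i y) = c i * dist x y)
    {V : Set X} (hVo : IsOpen V) (hVn : V.Nonempty)
    (hV : ∀ i, g i '' V ⊆ V) (hd : ∀ i j, i ≠ j → Disjoint (g i '' V) (g j '' V))
    (R : ℝ) (hR0 : 0 ≤ R) :
    ∃ (σ τ : List ι) (δ : ℝ), 0 < δ ∧ δ ≤ 1 ∧ ∀ x y, ‖x‖ ≤ R → ‖y‖ ≤ R →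
      2 * δ ≤ dist (gw g σ x) (gw g τ y) := by
  classical
  by_contra hcon
  push Not at hcon
  have hclose : ∀ σ τ : List ι, dist (gw g σ 0) (gw g τ 0) ≤ (cw c σ + cw c τ) * R := by
    intro σ τ
    by_contra h
    push Not at h
    set δ := min 1 ((dist (gw g σ 0) (gw g τ 0) - (cw c σ + cw c τ) * R) / 2) with hδ
    obtain ⟨x, y, hx, hy, hxy⟩ := hcon σ τ δ (lt_min one_pos (by linarith)) (min_le_left _ _)
    have h1 := dist_triangle4 (gw g σ 0) (gw g σ x) (gw g τ y) (gw g τ 0)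
    rw [gw_dist hg, gw_dist hg, dist_zero_left, dist_zero_right] at h1
    have h2 := mul_le_mul_of_nonneg_left hx (cw_pos hc σ).le
    have h3 := mul_le_mul_of_nonneg_left hy (cw_pos hc τ).le
    have h4 : δ ≤ (dist (gw g σ 0) (gw g τ 0) - (cw c σ + cw c τ) * R) / 2 := min_le_right _ _
    linarith
  obtain ⟨L, hL⟩ := packing_words hc hg hVo hVn hV hd (2 * R) 1 one_pos
  let S : Fin (L + 1) → List ι := fun a =>
    List.replicate a i ++ j :: List.replicate (L - a) i
  have hS : ∀ a, cw c (S a) = c i ^ L * c j := by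
    intro a
    have : (a : ℕ) + (L - a) = L := by have := a.2; omega
    simp only [S, cw, List.map_append, List.map_cons, List.map_replicate, List.prod_append,
      List.prod_cons, List.prod_replicate]
    calc c i ^ (a : ℕ) * (c j * c i ^ (L - a)) = c i ^ ((a : ℕ) + (L - a)) * c j := by ring
      _ = _ := by rw [this]
  have hlen : ∀ a, (S a).length = L + 1 := by
    intro a; have := a.2; simp [S]; omega
  have hinj : Function.Injective S := by
    have key : ∀ a b : Fin (L + 1), (a : ℕ) < b → S a ≠ S b := by
      intro a b hab h
      have h1 : (S a)[(a : ℕ)]? = some j := by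
        simp [S]
      have h2 : (S b)[(a : ℕ)]? = some i := by
        simp only [S]
        rw [List.getElem?_append_left (by simpa using hab)]
        simp [hab]
      rw [h, h2] at h1
      exact hij (Option.some.inj h1)
    intro a b h
    rcases lt_trichotomy (a : ℕ) b with h' | h' | h'
    · exact absurd h (key a b h')
    · exact Fin.ext h'
    · exact absurd h.symm (key b a h')
  have hpos : 0 < c i ^ L * c j := mul_pos (pow_pos (hc i).1 _) (hc j).1
  have := hL (c i ^ L * c j) hpos (gw g (S 0) 0) (Finset.univ.image S) (by
    intro τ hτ
    obtain ⟨a, _, rfl⟩ := Finset.mem_image.1 hτ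
    have := hclose (S a) (S 0)
    rw [hS, hS] at this
    rw [hS]
    refine ⟨by simp, le_rfl, by linarith⟩) (by
    intro τ hτ τ' hτ' hne hp
    obtain ⟨a, _, rfl⟩ := Finset.mem_image.1 hτ
    obtain ⟨b, _, rfl⟩ := Finset.mem_image.1 hτ'
    exact hne (hp.eq_of_length (by rw [hlen, hlen])))
  rw [Finset.card_image_of_injective _ hinj] at this
  simp at this
end HelperB

set_option linter.unusedSectionVars false

section HelperC
variable {X : Type*} [NormedAddCommGroup X] [InnerProductSpace ℝ X] [FiniteDimensional ℝ X]
  [MeasurableSpace X] [BorelSpace X]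

structure IFSM {ι : Type*} [Fintype ι] (h : ι → X → X) (r w : ι → ℝ) (w0 : ℝ)
    (m0 m : Measure X) : Prop where
  hr : ∀ j, r j ∈ Set.Ioo (0 : ℝ) 1
  hh : ∀ j x y, dist (h j x) (h j y) = r j * dist x y
  hw : ∀ j, 0 < w j
  hw0 : 0 ≤ w0
  hsum : w0 + ∑ j, w j = 1
  pm : IsProbabilityMeasure m
  pm0 : IsProbabilityMeasure m0
  eq : m = ENNReal.ofReal w0 • m0 + ∑ j, ENNReal.ofReal (w j) • m.map (h j)

variable {ι : Type*} [Fintype ι] {h : ι → X → X} {r w : ι → ℝ} {w0 : ℝ} {m0 m : Measure X}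

lemma IFSM.int (H : IFSM h r w w0 m0 m) (φ : X → ℝ) (hφ : Measurable φ) (hi : Integrable φ m) :
    ∫ x, φ x ∂m = w0 * ∫ x, φ x ∂m0 + ∑ j, w j * ∫ x, φ (h j x) ∂m := by
  have hi' := hi
  rw [H.eq] at hi'
  have h1 := hi'.left_of_add_measure
  have h2 := hi'.right_of_add_measure
  have h3 := integrable_finsetSum_measure.1 h2
  conv_lhs => rw [H.eq]
  rw [integral_add_measure h1 h2, integral_finsetSum_measure h3, integral_smul_measure,
    ENNReal.toReal_ofReal H.hw0, smul_eq_mul]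
  congr 1
  refine Finset.sum_congr rfl fun j _ => ?_
  rw [integral_smul_measure, ENNReal.toReal_ofReal (H.hw j).le, smul_eq_mul,
    integral_map (sim_cont (H.hr j).1 (H.hh j)).measurable.aemeasurable hφ.aestronglyMeasurable]

lemma exists_R (h : ι → X → X) (r : ι → ℝ) (hr : ∀ j, r j ∈ Set.Ioo (0 : ℝ) 1)
    (hh : ∀ j x y, dist (h j x) (h j y) = r j * dist x y) :
    ∃ R0 : ℝ, 0 ≤ R0 ∧ ∀ R ≥ R0, ∀ j x, max (‖h j x‖ - R) 0 ≤ r j * max (‖x‖ - R) 0 := by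
  refine ⟨∑ j, ‖h j 0‖ / (1 - r j), Finset.sum_nonneg fun j _ =>
    div_nonneg (norm_nonneg _) (by linarith [(hr j).2]), fun R hR j x => ?_⟩
  have h1 : ‖h j 0‖ / (1 - r j) ≤ R := le_trans
    (Finset.single_le_sum (f := fun j => ‖h j 0‖ / (1 - r j)) (fun j _ =>
      div_nonneg (norm_nonneg _) (by linarith [(hr j).2])) (Finset.mem_univ j)) hR
  rw [div_le_iff₀ (by linarith [(hr j).2])] at h1
  have h2 : ‖h j x‖ ≤ r j * ‖x‖ + ‖h j 0‖ := by
    have := hh j x 0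
    rw [dist_eq_norm, dist_zero_right] at this
    have h3 := norm_le_norm_add_norm_sub' (h j x) (h j 0)
    linarith
  have h0 := (hr j).1
  apply max_le
  · have := le_max_left (‖x‖ - R) 0
    nlinarith
  · positivity

lemma norm_le_of {R : ℝ} {h : ι → X → X} {r : ι → ℝ}
    (hR : ∀ j x, max (‖h j x‖ - R) 0 ≤ r j * max (‖x‖ - R) 0) (j : ι) (x : X) (hx : ‖x‖ ≤ R) :
    ‖h j x‖ ≤ R := by
  have := hR j x
  rw [max_eq_right (by linarith : ‖x‖ - R ≤ 0), mul_zero] at this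
  have := le_trans (le_max_left _ _) this
  linarith

lemma IFSM.supp [Nonempty ι] (H : IFSM h r w w0 m0 m) (R : ℝ)
    (hR : ∀ j x, max (‖h j x‖ - R) 0 ≤ r j * max (‖x‖ - R) 0)
    (h0 : w0 = 0 ∨ ∀ᵐ x ∂m0, ‖x‖ ≤ R) : ∀ᵐ x ∂m, ‖x‖ ≤ R := by
  have := H.pm
  have := H.pm0
  obtain ⟨i0, hi0⟩ := Finite.exists_max r
  set k := r i0
  have hk := H.hr i0
  let F : X → ℝ := fun x => max (‖x‖ - R) 0
  have hFc : Continuous F := by fun_prop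
  have hF0 : ∀ x, 0 ≤ F x := fun x => le_max_right _ _
  have hbd : ∀ a : ℝ, Integrable (fun x => Real.arctan (a * F x)) m := by
    intro a
    refine Integrable.of_bound (C := Real.pi / 2) (by
      exact (Real.continuous_arctan.comp (continuous_const.mul hFc)).aestronglyMeasurable) ?_
    refine Eventually.of_forall fun x => ?_
    rw [Real.norm_eq_abs, abs_le]
    exact ⟨(Real.neg_pi_div_two_lt_arctan _).le, (Real.arctan_lt_pi_div_two _).le⟩
  have hb1 : Integrable (fun x => Real.arctan (F x)) m := by simpa using hbd 1
  have e1 := H.int (fun x => Real.arctan (F x))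
    (Real.continuous_arctan.comp hFc).measurable hb1
  have e2 : w0 * ∫ x, Real.arctan (F x) ∂m0 = 0 := by
    rcases h0 with h0 | h0
    · simp [h0]
    · rw [integral_eq_zero_of_ae, mul_zero]
      filter_upwards [h0] with x hx
      have : F x = 0 := max_eq_right (by linarith)
      simp [this]
  have e3 : ∑ j, w j * ∫ x, Real.arctan (F (h j x)) ∂m ≤
      ∑ j, w j * ∫ x, Real.arctan (k * F x) ∂m := by
    refine Finset.sum_le_sum fun j _ => mul_le_mul_of_nonneg_left ?_ (H.hw j).le
    refine integral_mono_of_nonneg (Eventually.of_forall fun x => ?_) (hbd k)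
      (Eventually.of_forall fun x => ?_)
    · exact Real.arctan_nonneg.2 (hF0 _)
    · apply Real.arctan_strictMono.monotone
      exact (hR j x).trans (mul_le_mul_of_nonneg_right (hi0 j) (hF0 x))
  have hI0 : 0 ≤ ∫ x, Real.arctan (k * F x) ∂m :=
    integral_nonneg fun x => Real.arctan_nonneg.2 (mul_nonneg hk.1.le (hF0 x))
  rw [← Finset.sum_mul] at e3
  have e4 : ∫ x, (Real.arctan (F x) - Real.arctan (k * F x)) ∂m ≤ 0 := by
    rw [integral_sub hb1 (hbd k)]
    have := H.hsum
    have := H.hw0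
    nlinarith
  have hnn : ∀ x, 0 ≤ Real.arctan (F x) - Real.arctan (k * F x) := by
    intro x
    have : k * F x ≤ F x := mul_le_of_le_one_left (hF0 x) hk.2.le
    linarith [Real.arctan_strictMono.monotone this]
  have e5 : ∫ x, (Real.arctan (F x) - Real.arctan (k * F x)) ∂m = 0 :=
    le_antisymm e4 (integral_nonneg hnn)
  rw [integral_eq_zero_iff_of_nonneg hnn (hb1.sub (hbd k))] at e5
  filter_upwards [e5] with x hx
  by_contra hlt
  push Not at hlt
  have hpos : 0 < F x := lt_of_lt_of_le (by linarith) (le_max_left (‖x‖ - R) 0)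
  have : k * F x < F x := by nlinarith [hk.2]
  have := Real.arctan_strictMono this
  simp only [Pi.zero_apply] at hx
  linarith

/-- truncated logarithm -/
noncomputable def psi (e d : ℝ) : ℝ := - Real.log (max (min d 1) e)

lemma psi_nonneg {e d : ℝ} (he : 0 < e) (he1 : e ≤ 1) : 0 ≤ psi e d := by
  unfold psi
  have := Real.log_nonpos (x := max (min d 1) e) (le_trans he.le (le_max_right _ _))
    (max_le (min_le_right _ _) he1)
  linarith

lemma psi_le {e d : ℝ} (he : 0 < e) : psi e d ≤ - Real.log e := by
  unfold psi
  have := Real.log_le_log he (le_max_right (min d 1) e)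
  linarith

lemma psi_le' {e d δ : ℝ} (hδ : 0 < δ) (hδ1 : δ ≤ 1) (hd : δ ≤ d) : psi e d ≤ - Real.log δ := by
  unfold psi
  have := Real.log_le_log hδ ((le_min hd hδ1).trans (le_max_left (min d 1) e))
  linarith

lemma psi_scale {e d c : ℝ} (he : 0 < e) (hd : 0 ≤ d) (hc : 0 < c) (hc1 : c ≤ 1) :
    psi e (c * d) ≤ psi e d - Real.log c := by
  unfold psi
  have hp : 0 < max (min d 1) e := lt_of_lt_of_le he (le_max_right _ _)
  have h1 : c * max (min d 1) e ≤ max (min (c * d) 1) e := by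
    rw [mul_max_of_nonneg _ _ hc.le, mul_min_of_nonneg _ _ hc.le]
    apply max_le_max
    · exact min_le_min le_rfl (by linarith)
    · exact mul_le_of_le_one_left he.le hc1
  have := Real.log_le_log (mul_pos hc hp) h1
  rw [Real.log_mul hc.ne' hp.ne'] at this
  linarith

lemma psi_cont {e : ℝ} (he : 0 < e) (φ : X → ℝ) (hφ : Continuous φ) :
    Continuous fun x => psi e (φ x) := by
  unfold psi
  refine (Continuous.log (by fun_prop) fun x => ?_).neg
  exact (lt_of_lt_of_le he (le_max_right _ _)).ne'

lemma psi_int {e : ℝ} (he : 0 < e) (he1 : e ≤ 1) (φ : X → ℝ) (hφ : Continuous φ)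
    [IsProbabilityMeasure m] : Integrable (fun x => psi e (φ x)) m := by
  refine Integrable.of_bound (C := - Real.log e) (psi_cont he φ hφ).aestronglyMeasurable ?_
  refine Eventually.of_forall fun x => ?_
  rw [Real.norm_eq_abs, abs_of_nonneg (psi_nonneg he he1)]
  exact psi_le he

lemma psi_int_le {e : ℝ} (he : 0 < e) (he1 : e ≤ 1) [IsProbabilityMeasure m] (φ : X → ℝ)
    (hφ : Continuous φ) : ∫ x, psi e (φ x) ∂m ≤ - Real.log e := by
  have := integral_mono (μ := m) (psi_int he he1 φ hφ) (integrable_const (- Real.log e))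
    (fun x => psi_le he)
  simpa using this

/-- uniform bound of truncated potentials -/
def PotB (m : Measure X) (A : ℝ) : Prop :=
  ∀ e, 0 < e → e ≤ 1 → ∀ a : X, ∫ x, psi e (dist x a) ∂m ≤ A

lemma psi_sim {h : X → X} {r : ℝ} (hr : r ∈ Set.Ioc (0:ℝ) 1)
    (hh : ∀ x y, dist (h x) (h y) = r * dist x y)
    [IsProbabilityMeasure m] {e : ℝ} (he : 0 < e) (he1 : e ≤ 1) (B : ℝ)
    (hB : ∀ a : X, ∫ x, psi e (dist x a) ∂m ≤ B) (a : X) :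
    ∫ x, psi e (dist (h x) a) ∂m ≤ B - Real.log r := by
  obtain ⟨b, rfl⟩ := sim_surj hr.1 hh a
  have hi : Integrable (fun x => psi e (dist x b)) m := psi_int he he1 _ (by fun_prop)
  have : ∫ x, psi e (dist (h x) (h b)) ∂m ≤ ∫ x, (psi e (dist x b) - Real.log r) ∂m := by
    refine integral_mono (psi_int he he1 _ ?_) (hi.sub (integrable_const _)) fun x => ?_
    · have := sim_cont hr.1 hh
      fun_prop
    · simp only [hh]
      exact psi_scale he dist_nonneg hr.1 hr.2
  rw [integral_sub hi (integrable_const _)] at this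
  simp at this
  linarith [hB b]

lemma IFSM.pot_mu (H : IFSM h r w w0 m0 m) (hw0 : 0 < w0) (A : ℝ) (hA : PotB m0 A) :
    ∃ A', PotB m A' := by
  have := H.pm
  have := H.pm0
  refine ⟨(w0 * A + ∑ j, w j * (- Real.log (r j))) / w0, fun e he he1 a => ?_⟩
  refine fix_lemma (Set.range fun a : X => ∫ x, psi e (dist x a) ∂m) ?_ w0 _ hw0 ?_ _ ⟨a, rfl⟩
  · refine ⟨- Real.log e, ?_⟩
    rintro _ ⟨a, rfl⟩
    exact psi_int_le he he1 _ (by fun_prop)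
  · rintro B hB _ ⟨a, rfl⟩
    have hB' : ∀ a : X, ∫ x, psi e (dist x a) ∂m ≤ B := fun a => hB _ ⟨a, rfl⟩
    have e1 := H.int (fun x => psi e (dist x a)) (psi_cont he _ (by fun_prop)).measurable
      (psi_int he he1 _ (by fun_prop))
    simp only
    rw [e1]
    have e2 : ∑ j, w j * ∫ x, psi e (dist (h j x) a) ∂m ≤ ∑ j, w j * (B - Real.log (r j)) :=
      Finset.sum_le_sum fun j _ => mul_le_mul_of_nonneg_left
        (psi_sim ⟨(H.hr j).1, (H.hr j).2.le⟩ (H.hh j) he he1 B hB' a) (H.hw j).le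
    have e3 : ∑ j, w j * (B - Real.log (r j)) = (1 - w0) * B + ∑ j, w j * (- Real.log (r j)) := by
      rw [← H.hsum, add_sub_cancel_left, Finset.sum_mul, ← Finset.sum_add_distrib]
      exact Finset.sum_congr rfl fun j _ => by ring
    have e4 := mul_le_mul_of_nonneg_left (hA e he he1 a) hw0.le
    linarith

lemma log_cw {c : ι → ℝ} (hc : ∀ i, c i ∈ Set.Ioo (0 : ℝ) 1) (i0 : ι) (hi0 : ∀ j, c i0 ≤ c j)
    (l : List ι) : - Real.log (cw c l) ≤ - Real.log (c i0) * l.length := by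
  induction l with
  | nil => simp [cw]
  | cons i l ih =>
    have : cw c (i :: l) = c i * cw c l := by simp [cw]
    rw [this, Real.log_mul (hc i).1.ne' (cw_pos hc l).ne']
    have := Real.log_le_log (hc i0).1 (hi0 i)
    simp only [List.length_cons]
    push_cast
    linarith

lemma IFSM.pot_nu [DecidableEq ι] [Nonempty ι] (H : IFSM h r w 0 m0 m) (R : ℝ)
    (hR : ∀ᵐ x ∂m, ‖x‖ ≤ R)
    (σ τ : List ι) (δ : ℝ) (hδ : 0 < δ) (hδ1 : δ ≤ 1)
    (hsep : ∀ x y, ‖x‖ ≤ R → ‖y‖ ≤ R → 2 * δ ≤ dist (gw h σ x) (gw h τ y)) :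
    ∃ A', PotB m A' := by
  have := H.pm
  have := H.pm0
  have hws : ∑ j, w j = 1 := by have := H.hsum; linarith
  have hw1 : ∀ l, cw w l ≤ 1 := by
    intro l
    induction l with
    | nil => simp [cw]
    | cons i l ih =>
      have hi : w i ≤ 1 := by
        rw [← hws]; exact Finset.single_le_sum (fun j _ => (H.hw j).le) (Finset.mem_univ i)
      have h1 : cw w (i :: l) = w i * cw w l := by simp [cw]
      rw [h1]
      have := (H.hw i).le
      nlinarith
  have hwp : ∀ l, 0 < cw w l := by
    intro l
    induction l with
    | nil => simp [cw]
    | cons i l ih => simpa [cw] using mul_pos (H.hw i) ih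
  obtain ⟨i0, hi0⟩ := Finite.exists_min r
  set b := - Real.log (r i0) with hb
  have hb0 : 0 ≤ b := by
    have := Real.log_nonpos (H.hr i0).1.le (H.hr i0).2.le
    linarith
  set ts := min (cw w σ) (cw w τ) with hts
  have hts0 : 0 < ts := lt_min (hwp σ) (hwp τ)
  set n := max (σ.length : ℝ) τ.length with hn
  have hlδ : 0 ≤ - Real.log δ := by
    have := Real.log_nonpos hδ.le hδ1
    linarith
  refine ⟨(- Real.log δ + b * n) / ts, fun e he he1 a => ?_⟩
  refine fix_lemma (Set.range fun a : X => ∫ x, psi e (dist x a) ∂m) ?_ ts _ hts0 ?_ _ ⟨a, rfl⟩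
  · refine ⟨- Real.log e, ?_⟩
    rintro _ ⟨a, rfl⟩
    exact psi_int_le he he1 _ (by fun_prop)
  · rintro B hB _ ⟨a, rfl⟩
    have hB' : ∀ a : X, ∫ x, psi e (dist x a) ∂m ≤ B := fun a => hB _ ⟨a, rfl⟩
    have hB0 : 0 ≤ B := le_trans (integral_nonneg fun x => psi_nonneg he he1) (hB' a)
    have hgc : ∀ l, Continuous (gw h l) := fun l => sim_cont (cw_pos H.hr l) (gw_dist H.hh l)
    let F : List ι → ℝ := fun l => ∫ x, psi e (dist (gw h l x) a) ∂m
    have hF1 : ∀ l, F l ≤ ∑ i, w i * F (l ++ [i]) := by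
      intro l
      have hcl := hgc l
      have e1 := H.int (fun x => psi e (dist (gw h l x) a))
        (psi_cont he _ (by fun_prop)).measurable (psi_int he he1 _ (by fun_prop))
      simp only [F]
      rw [e1, zero_mul, zero_add]
      refine le_of_eq (Finset.sum_congr rfl fun i _ => ?_)
      rw [gw_append]
      rfl
    have hF2 : ∀ l, F l ≤ B + b * l.length := by
      intro l
      have := psi_sim (m := m) ⟨cw_pos H.hr l, cw_le_one H.hr l⟩ (gw_dist H.hh l) he he1 B hB' a
      have := log_cw H.hr i0 hi0 l
      simp only [F]
      linarith
    have main : ∀ s : List ι, ts ≤ cw w s → (s.length : ℝ) ≤ n →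
        (∀ x, ‖x‖ ≤ R → δ ≤ dist (gw h s x) a) → F [] ≤ (1 - ts) * B + (- Real.log δ + b * n) := by
      intro s h1 h2 h3
      have h4 := tree_lemma w H.hw hws F B b hb0 hF1 hF2 s []
      simp only [List.nil_append, List.length_nil, Nat.cast_zero, zero_add] at h4
      have h5 : F s ≤ - Real.log δ := by
        have hcl := hgc s
        have := integral_mono_ae (μ := m) (psi_int (e := e) he he1 (fun x => dist (gw h s x) a) (by fun_prop))
          (integrable_const (- Real.log δ)) (by
            filter_upwards [hR] with x hx
            exact psi_le' hδ hδ1 (h3 x hx))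
        simpa using this
      have h6 := mul_le_mul_of_nonneg_left h5 (hwp s).le
      have h7 : cw w s * (- Real.log δ) ≤ - Real.log δ := mul_le_of_le_one_left hlδ (hw1 s)
      have h8 : (1 - cw w s) * (B + b * s.length) ≤ (1 - ts) * B + b * n := by
        have hbs : b * s.length ≤ b * n := mul_le_mul_of_nonneg_left h2 hb0
        have hbs0 : 0 ≤ b * (s.length : ℝ) := by positivity
        have := hw1 s
        have := hwp s
        nlinarith
      linarith
    change F [] ≤ _
    by_cases hcase : ∀ x, ‖x‖ ≤ R → δ ≤ dist (gw h σ x) a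
    · exact main σ (min_le_left _ _) (le_max_left _ _) hcase
    · push Not at hcase
      obtain ⟨x, hx, hxa⟩ := hcase
      refine main τ (min_le_right _ _) (le_max_right _ _) fun y hy => ?_
      have := hsep x y hx hy
      have := dist_triangle_right (gw h σ x) (gw h τ y) a
      linarith
end HelperC

set_option linter.unusedSectionVars false

section HelperD
variable {X : Type*} [NormedAddCommGroup X] [InnerProductSpace ℝ X] [FiniteDimensional ℝ X]
  [MeasurableSpace X] [BorelSpace X]

structure Good (m : Measure X) (A R : ℝ) : Prop where
  pm : IsProbabilityMeasure m
  supp : ∀ᵐ x ∂m, ‖x‖ ≤ R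
  pot : PotB m A

variable {ι : Type*} [Fintype ι] {h : ι → X → X} {r w : ι → ℝ} {w0 : ℝ} {m0 m : Measure X} {A R : ℝ}

lemma Good.A_nonneg (G : Good m A R) : 0 ≤ A :=
  le_trans (integral_nonneg fun _ => psi_nonneg one_pos le_rfl) (G.pot 1 one_pos le_rfl 0)

lemma Good.ae_ne (G : Good m A R) (a : X) : ∀ᵐ x ∂m, x ≠ a := by
  have := G.pm
  have key : ∀ n : ℕ, m.real {a} * n ≤ A := by
    intro n
    have he : (0:ℝ) < Real.exp (-n) := Real.exp_pos _
    have he1 : Real.exp (-(n:ℝ)) ≤ 1 := Real.exp_le_one_iff.2 (by simp)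
    refine le_trans ?_ (G.pot _ he he1 a)
    have : ∫ x, ({a} : Set X).indicator (fun _ => (n : ℝ)) x ∂m ≤
        ∫ x, psi (Real.exp (-n)) (dist x a) ∂m := by
      refine integral_mono ((integrable_const _).indicator (measurableSet_singleton a))
        (psi_int he he1 _ (by fun_prop)) fun x => ?_
      by_cases hx : x = a
      · subst hx
        simp only [Set.mem_singleton_iff, Set.indicator_of_mem, dist_self]
        simp only [psi]
        rw [min_eq_left zero_le_one, max_eq_right he.le, Real.log_exp]
        simp
      · rw [Set.indicator_of_notMem (by simpa using hx)]
        exact psi_nonneg he he1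
    rw [integral_indicator_const _ (measurableSet_singleton a), smul_eq_mul] at this
    exact this
  have hz : m.real {a} = 0 := by
    by_contra hne
    have hpos : 0 < m.real {a} := lt_of_le_of_ne measureReal_nonneg (Ne.symm hne)
    obtain ⟨n, hn⟩ := exists_nat_gt (A / m.real {a})
    rw [div_lt_iff₀ hpos] at hn
    linarith [key n]
  rw [measureReal_eq_zero_iff] at hz
  rw [ae_iff]
  simpa using hz

noncomputable def potf (x a : X) : ℝ := max 0 (- Real.log (dist x a))

lemma potf_nonneg (x a : X) : 0 ≤ potf x a := le_max_left _ _

lemma potf_meas (a : X) : Measurable fun x => potf x a := by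
  unfold potf
  exact measurable_const.max ((Real.measurable_log.comp (by fun_prop)).neg)

lemma Good.pot_int (G : Good m A R) (a : X) :
    Integrable (fun x => potf x a) m ∧ ∫ x, potf x a ∂m ≤ A := by
  have := G.pm
  have hlim : ∀ᵐ x ∂m, Tendsto (fun n : ℕ => ENNReal.ofReal (psi (Real.exp (-n)) (dist x a))) atTop
      (nhds (ENNReal.ofReal (potf x a))) := by
    filter_upwards [G.ae_ne a] with x hx
    have hd : 0 < dist x a := dist_pos.2 hx
    refine tendsto_const_nhds.congr' ?_
    obtain ⟨n0, hn0⟩ := exists_nat_gt (- Real.log (min (dist x a) 1))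
    filter_upwards [eventually_ge_atTop n0] with n hn
    congr 1
    have hmp : 0 < min (dist x a) 1 := lt_min hd one_pos
    have : Real.exp (-n) ≤ min (dist x a) 1 := by
      rw [← Real.exp_log hmp]
      apply Real.exp_le_exp.2
      have : (n0:ℝ) ≤ n := by exact_mod_cast hn
      linarith
    unfold psi potf
    rw [max_eq_left this]
    rcases le_total (dist x a) 1 with h | h
    · rw [min_eq_left h, max_eq_right]
      have := Real.log_nonpos hd.le h
      linarith
    · rw [min_eq_right h, max_eq_left, Real.log_one, neg_zero]
      have := Real.log_nonneg h
      linarith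
  have hfat : ∫⁻ x, ENNReal.ofReal (potf x a) ∂m ≤ ENNReal.ofReal A := by
    have h1 : ∫⁻ x, ENNReal.ofReal (potf x a) ∂m =
        ∫⁻ x, liminf (fun n : ℕ => ENNReal.ofReal (psi (Real.exp (-n)) (dist x a))) atTop ∂m := by
      refine lintegral_congr_ae ?_
      filter_upwards [hlim] with x hx
      exact hx.liminf_eq.symm
    rw [h1]
    refine (lintegral_liminf_le fun n => ?_).trans ?_
    · exact ((psi_cont (Real.exp_pos _) _ (by fun_prop)).measurable).ennreal_ofReal
    · have : ∀ n : ℕ, ∫⁻ x, ENNReal.ofReal (psi (Real.exp (-n)) (dist x a)) ∂m ≤ ENNReal.ofReal A := by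
        intro n
        have he : (0:ℝ) < Real.exp (-n) := Real.exp_pos _
        have he1 : Real.exp (-(n:ℝ)) ≤ 1 := Real.exp_le_one_iff.2 (by simp)
        rw [← ofReal_integral_eq_lintegral_ofReal (psi_int he he1 _ (by fun_prop))
          (Eventually.of_forall fun x => psi_nonneg he he1)]
        exact ENNReal.ofReal_le_ofReal (G.pot _ he he1 a)
      refine (liminf_le_liminf (Eventually.of_forall this)).trans ?_
      simp
  have hI : Integrable (fun x => potf x a) m := by
    refine ⟨(potf_meas a).aestronglyMeasurable, ?_⟩
    rw [hasFiniteIntegral_iff_ofReal (Eventually.of_forall fun x => potf_nonneg x a)]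
    exact lt_of_le_of_lt hfat ENNReal.ofReal_lt_top
  refine ⟨hI, ?_⟩
  rw [← ofReal_integral_eq_lintegral_ofReal hI (Eventually.of_forall fun x => potf_nonneg x a)] at hfat
  exact (ENNReal.ofReal_le_ofReal_iff G.A_nonneg).1 hfat

noncomputable def LL (α : Finset X) (m : Measure X) : ℝ :=
  ∫ x, Real.log (infDist x (↑α : Set X)) ∂m

lemma exists_min_dist (α : Finset X) (hα : α.Nonempty) (x : X) :
    ∃ a ∈ α, infDist x (↑α : Set X) = dist x a := by
  obtain ⟨a, ha, h⟩ := α.finite_toSet.isCompact.exists_infDist_eq_dist (by simpa using hα) x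
  exact ⟨a, ha, h⟩

lemma Good.pos (G : Good m A R) (α : Finset X) (hα : α.Nonempty) :
    ∀ᵐ x ∂m, 0 < infDist x (↑α : Set X) := by
  have : ∀ᵐ x ∂m, ∀ a ∈ α, x ≠ a := by
    exact (ae_ball_iff α.countable_toSet).2 fun a _ => G.ae_ne a
  filter_upwards [this] with x hx
  obtain ⟨a, ha, h⟩ := exists_min_dist α hα x
  rw [h]; exact dist_pos.2 (hx a ha)

lemma log_meas (α : Finset X) : Measurable fun x => Real.log (infDist x (↑α : Set X)) :=
  Real.measurable_log.comp (continuous_infDist_pt _).measurable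

lemma Good.int_L (G : Good m A R) (α : Finset X) (hα : α.Nonempty) :
    Integrable (fun x => Real.log (infDist x (↑α : Set X))) m := by
  have := G.pm
  obtain ⟨a0, ha0⟩ := hα
  have hI : Integrable (fun x => (∑ a ∈ α, potf x a) + (R + ‖a0‖)) m :=
    (integrable_finsetSum _ fun a _ => (G.pot_int a).1).add (integrable_const _)
  refine hI.mono' (log_meas α).aestronglyMeasurable ?_
  filter_upwards [G.supp] with x hx
  have hR0 : 0 ≤ R := (norm_nonneg _).trans hx
  have h0 : 0 ≤ ∑ a ∈ α, potf x a := Finset.sum_nonneg fun a _ => potf_nonneg x a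
  rw [Real.norm_eq_abs, abs_le]
  constructor
  · obtain ⟨a, ha, h⟩ := exists_min_dist α ⟨a0, ha0⟩ x
    rw [h]
    have h1 : - Real.log (dist x a) ≤ potf x a := le_max_right _ _
    have h2 : potf x a ≤ ∑ a ∈ α, potf x a :=
      Finset.single_le_sum (fun a _ => potf_nonneg x a) ha
    have := norm_nonneg a0
    linarith
  · have h1 : infDist x (↑α : Set X) ≤ dist x a0 := infDist_le_dist_of_mem (by simpa using ha0)
    have h2 := Real.log_le_self (infDist_nonneg (x := x) (s := (↑α : Set X)))
    have h3 : dist x a0 ≤ ‖x‖ + ‖a0‖ := dist_le_norm_add_norm x a0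
    linarith

lemma Good.L_mono (G : Good m A R) {α β : Finset X} (hα : α.Nonempty) (hs : α ⊆ β) :
    LL β m ≤ LL α m := by
  have hβ := hα.mono hs
  refine integral_mono_ae (G.int_L β hβ) (G.int_L α hα) ?_
  filter_upwards [G.pos β hβ] with x hx
  exact Real.log_le_log hx (infDist_le_infDist_of_subset (by exact_mod_cast hs) (by simpa using hα))

noncomputable def pre {h : X → X} (hi : Function.Injective h) (α : Finset X) : Finset X :=
  α.preimage h hi.injOn

lemma pre_nonempty {h : X → X} (hi : Function.Injective h) (hs : Function.Surjective h)
    {α : Finset X} (hα : α.Nonempty) : (pre hi α).Nonempty := by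
  obtain ⟨a, ha⟩ := hα
  obtain ⟨b, rfl⟩ := hs a
  exact ⟨b, by simpa [pre] using ha⟩

lemma Good.L_sim (G : Good m A R) {h : X → X} {r : ℝ} (hr : 0 < r)
    (hh : ∀ x y, dist (h x) (h y) = r * dist x y) (α : Finset X) (hα : α.Nonempty) :
    ∫ x, Real.log (infDist (h x) (↑α : Set X)) ∂m = Real.log r + LL (pre (sim_inj hr hh) α) m := by
  have := G.pm
  have hne := pre_nonempty (sim_inj hr hh) (sim_surj hr hh) hα
  have e : ∫ x, Real.log (infDist (h x) (↑α : Set X)) ∂m =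
      ∫ x, (Real.log r + Real.log (infDist x (↑(pre (sim_inj hr hh) α) : Set X))) ∂m := by
    refine integral_congr_ae ?_
    filter_upwards [G.pos _ hne] with x hx
    rw [infDist_sim hr hh _ (by simpa using hα)]
    simp only [pre, Finset.coe_preimage] at hx ⊢
    rw [Real.log_mul hr.ne' hx.ne']
  rw [e, integral_add (integrable_const _) (G.int_L _ hne)]
  simp [LL]

lemma IFSM.L_step (H : IFSM h r w w0 m0 m) (G : Good m A R) (α : Finset X) (hα : α.Nonempty) :
    LL α m = w0 * LL α m0 +
      ∑ j, w j * (Real.log (r j) + LL (pre (sim_inj (H.hr j).1 (H.hh j)) α) m) := by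
  have := H.int _ (log_meas α) (G.int_L α hα)
  rw [LL, this]
  congr 1
  exact Finset.sum_congr rfl fun j _ => by rw [G.L_sim (H.hr j).1 (H.hh j) α hα]

noncomputable def cnt (α : Finset X) (W : Set X) : ℝ := ∑ a ∈ α, W.indicator (fun _ => (1:ℝ)) a

lemma cnt_nonneg (α : Finset X) (W : Set X) : 0 ≤ cnt α W :=
  Finset.sum_nonneg fun a _ => Set.indicator_nonneg (fun _ _ => zero_le_one) a

lemma cnt_mono (α : Finset X) {W W' : Set X} (hs : W ⊆ W') : cnt α W ≤ cnt α W' :=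
  Finset.sum_le_sum fun a _ => Set.indicator_le_indicator_of_subset hs (fun _ => zero_le_one) a

lemma cnt_mono_left {α β : Finset X} (hs : α ⊆ β) (W : Set X) : cnt α W ≤ cnt β W :=
  Finset.sum_le_sum_of_subset_of_nonneg hs fun a _ _ => Set.indicator_nonneg (fun _ _ => zero_le_one) a

lemma cnt_le_card (α : Finset X) (W : Set X) : cnt α W ≤ α.card := by
  have : cnt α W ≤ ∑ a ∈ α, (1:ℝ) := Finset.sum_le_sum fun a _ =>
    Set.indicator_le_self' (fun _ _ => zero_le_one) a
  simpa using this

lemma cnt_pre {h : X → X} (hi : Function.Injective h) (hs : Function.Surjective h) (α : Finset X)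
    (W : Set X) : cnt (pre hi α) W = cnt α (h '' W) := by
  have := Finset.sum_preimage h α hi.injOn ((h '' W).indicator (fun _ => (1:ℝ)))
    (fun x _ hx => absurd (hs x) (by simpa using hx))
  unfold cnt
  rw [← this]
  refine Finset.sum_congr rfl fun a _ => ?_
  by_cases ha : a ∈ W
  · rw [Set.indicator_of_mem ha, Set.indicator_of_mem (Set.mem_image_of_mem _ ha)]
  · rw [Set.indicator_of_notMem ha, Set.indicator_of_notMem (by rwa [hi.mem_set_image])]

lemma cnt_disj (α : Finset X) (W W0 : Set X) (S : ι → Set X) (h0 : W0 ⊆ W) (hS : ∀ j, S j ⊆ W)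
    (h0S : ∀ j, Disjoint W0 (S j)) (hSS : ∀ i j, i ≠ j → Disjoint (S i) (S j)) :
    cnt α W0 + ∑ j, cnt α (S j) ≤ cnt α W := by
  classical
  unfold cnt
  rw [Finset.sum_comm, ← Finset.sum_add_distrib]
  refine Finset.sum_le_sum fun a _ => ?_
  by_cases ha : ∃ j, a ∈ S j
  · obtain ⟨j, hj⟩ := ha
    rw [Finset.sum_eq_single j, Set.indicator_of_notMem (Set.disjoint_right.1 (h0S j) hj),
      Set.indicator_of_mem hj, Set.indicator_of_mem (hS j hj), zero_add]
    · intro i _ hij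
      exact Set.indicator_of_notMem (Set.disjoint_right.1 (hSS i j hij) hj) _
    · simp
  · push Not at ha
    rw [Finset.sum_eq_zero fun j _ => Set.indicator_of_notMem (ha j) _, add_zero]
    exact Set.indicator_le_indicator_of_subset h0 (fun _ => zero_le_one) a

/-- crude local bound -/
lemma Good.local_bd (G : Good m A R) {W : Set X} {δ : ℝ} (hδ : 0 < δ) (hδ1 : δ ≤ 1)
    (hW : ∀ᵐ x ∂m, ball x δ ⊆ W) (α : Finset X) (hα : α.Nonempty) :
    - LL α m ≤ - Real.log δ + A * cnt α W := by
  have := G.pm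
  have hIt : ∀ a ∈ α, Integrable (fun x => W.indicator (fun _ => (1:ℝ)) a * potf x a) m :=
    fun a _ => (G.pot_int a).1.const_mul _
  have hI : Integrable (fun x => - Real.log δ + ∑ a ∈ α, W.indicator (fun _ => (1:ℝ)) a * potf x a) m :=
    (integrable_const _).add (integrable_finsetSum _ hIt)
  have h1 : ∫ x, - Real.log (infDist x (↑α : Set X)) ∂m ≤
      ∫ x, (- Real.log δ + ∑ a ∈ α, W.indicator (fun _ => (1:ℝ)) a * potf x a) ∂m := by
    refine integral_mono_ae (G.int_L α hα).neg hI ?_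
    filter_upwards [hW] with x hx
    obtain ⟨a, ha, h⟩ := exists_min_dist α hα x
    rw [h]
    have hnn : ∀ a ∈ α, 0 ≤ W.indicator (fun _ => (1:ℝ)) a * potf x a := fun a _ =>
      mul_nonneg (Set.indicator_nonneg (fun _ _ => zero_le_one) a) (potf_nonneg x a)
    have hlδ := Real.log_nonpos hδ.le hδ1
    by_cases haW : a ∈ W
    · have h2 := Finset.single_le_sum hnn ha
      rw [Set.indicator_of_mem haW, one_mul] at h2
      have h3 : - Real.log (dist x a) ≤ potf x a := le_max_right _ _
      linarith
    · have h4 : δ ≤ dist x a := by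
        by_contra hlt
        push Not at hlt
        exact haW (hx (by rwa [mem_ball, dist_comm]))
      have := Real.log_le_log hδ h4
      have := Finset.sum_nonneg hnn
      linarith
  rw [integral_neg, integral_add (integrable_const _) (integrable_finsetSum _ hIt),
    integral_finsetSum _ hIt] at h1
  have h2 : ∑ a ∈ α, ∫ x, W.indicator (fun _ => (1:ℝ)) a * potf x a ∂m ≤ A * cnt α W := by
    unfold cnt
    rw [Finset.mul_sum]
    refine Finset.sum_le_sum fun a _ => ?_
    rw [integral_const_mul, mul_comm]
    exact mul_le_mul_of_nonneg_right (G.pot_int a).2 (Set.indicator_nonneg (fun _ _ => zero_le_one) a)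
  simp only [integral_const, probReal_univ, one_smul] at h1
  unfold LL
  linarith
end HelperD

set_option linter.unusedSectionVars false

section HelperE
variable {X : Type*} [NormedAddCommGroup X] [InnerProductSpace ℝ X] [FiniteDimensional ℝ X]
  [MeasurableSpace X] [BorelSpace X]
variable {ι : Type*} [Fintype ι] {h : ι → X → X} {r w : ι → ℝ} {w0 : ℝ} {m0 m : Measure X} {A A0 R R0 : ℝ}

lemma Good.int_sim (G : Good m A R) {h : X → X} {r : ℝ} (hr : 0 < r)
    (hh : ∀ x y, dist (h x) (h y) = r * dist x y) (α : Finset X) (hα : α.Nonempty) :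
    Integrable (fun x => Real.log (infDist (h x) (↑α : Set X))) m := by
  have := G.pm
  have hne := pre_nonempty (sim_inj hr hh) (sim_surj hr hh) hα
  refine ((integrable_const (Real.log r)).add (G.int_L _ hne)).congr ?_
  filter_upwards [G.pos _ hne] with x hx
  rw [infDist_sim hr hh _ (by simpa using hα)]
  simp only [pre, Finset.coe_preimage, Pi.add_apply] at hx ⊢
  rw [Real.log_mul hr.ne' hx.ne']

lemma base_nu [DecidableEq ι] [Nonempty ι] (H : IFSM h r w 0 m0 m) (G : Good m A R)
    (W : Set X) (σ : List ι) (δ : ℝ) (hδ : 0 < δ) (hδ1 : δ ≤ 1) (hW : ∀ i, h i '' W ⊆ W)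
    (hb : ∀ x, ‖x‖ ≤ R → ball (gw h σ x) δ ⊆ W) :
    ∃ C1 : ℝ, 0 ≤ C1 ∧ ∀ α : Finset X, α.Nonempty → - LL α m ≤ C1 + C1 * cnt α W := by
  have := G.pm
  have hA := G.A_nonneg
  have hws : ∑ j, w j = 1 := by have := H.hsum; linarith
  have hTp : ∀ l, 0 < cw w l := by
    intro l
    induction l with
    | nil => simp [cw]
    | cons i l ih => simpa [cw] using mul_pos (H.hw i) ih
  obtain ⟨i0, hi0⟩ := Finite.exists_min r
  set b := - Real.log (r i0) with hbdef
  have hb0 : 0 ≤ b := by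
    have := Real.log_nonpos (H.hr i0).1.le (H.hr i0).2.le
    linarith
  set T := cw w σ with hT
  have hT0 : 0 < T := hTp σ
  set k := b * σ.length + T * (- Real.log δ) with hk
  have main : ∀ α : Finset X, α.Nonempty → - LL α m - A * cnt α W ≤ k / T := by
    intro α0 hα0
    refine fix_lemma {e | ∃ α : Finset X, α.Nonempty ∧ cnt α Set.univ ≤ cnt α0 Set.univ ∧
      e = - LL α m - A * cnt α W} ?_ T k hT0 ?_ _ ⟨α0, hα0, le_rfl, rfl⟩
    · refine ⟨A * cnt α0 Set.univ, ?_⟩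
      rintro _ ⟨α, hα, hc, rfl⟩
      have h1 := G.local_bd (W := Set.univ) one_pos le_rfl (Eventually.of_forall fun x => Set.subset_univ _) α hα
      rw [Real.log_one] at h1
      have h2 := mul_le_mul_of_nonneg_left hc hA
      have h3 := mul_nonneg hA (cnt_nonneg α W)
      linarith
    · rintro B hB _ ⟨α, hα, hc, rfl⟩
      let F : List ι → ℝ := fun l => - ∫ x, Real.log (infDist (gw h l x) (↑α : Set X)) ∂m
      have hF : ∀ l, F l = - Real.log (cw r l) - LL (pre (sim_inj (cw_pos H.hr l) (gw_dist H.hh l)) α) m := by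
        intro l
        simp only [F]
        rw [G.L_sim (cw_pos H.hr l) (gw_dist H.hh l) α hα]
        ring
      have hlog := log_cw H.hr i0 hi0
      have hne : ∀ l, (pre (sim_inj (cw_pos H.hr l) (gw_dist H.hh l)) α).Nonempty := fun l =>
        pre_nonempty _ (sim_surj (cw_pos H.hr l) (gw_dist H.hh l)) hα
      have hcp : ∀ l W, cnt (pre (sim_inj (cw_pos H.hr l) (gw_dist H.hh l)) α) W = cnt α (gw h l '' W) :=
        fun l W => cnt_pre _ (sim_surj (cw_pos H.hr l) (gw_dist H.hh l)) α W
      have h1 : ∀ l, F l ≤ ∑ i, w i * F (l ++ [i]) := by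
        intro l
        have e := H.int (fun x => Real.log (infDist (gw h l x) (↑α : Set X)))
          ((log_meas α).comp (sim_cont (cw_pos H.hr l) (gw_dist H.hh l)).measurable)
          (G.int_sim (cw_pos H.hr l) (gw_dist H.hh l) α hα)
        simp only [F]
        rw [e, zero_mul, zero_add, ← Finset.sum_neg_distrib]
        refine le_of_eq (Finset.sum_congr rfl fun i _ => ?_)
        rw [gw_append]
        simp [gw]
      have h2 : ∀ l, F l ≤ (B + A * cnt α W) + b * l.length := by
        intro l
        rw [hF]
        have e1 := hB _ ⟨_, hne l, by rw [hcp]; exact (cnt_mono α (Set.subset_univ _)).trans hc, rfl⟩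
        rw [hcp] at e1
        have e2 := mul_le_mul_of_nonneg_left (cnt_mono α (gw_image_sub hW l)) hA
        have := hlog l
        linarith
      have h3 := tree_lemma w H.hw hws F _ b hb0 h1 h2 σ []
      have h4 : F σ ≤ b * σ.length - Real.log δ + A * cnt α W := by
        rw [hF]
        have e1 := G.local_bd (W := gw h σ ⁻¹' W) hδ hδ1 (by
          filter_upwards [G.supp] with x hx y hy
          refine hb x hx ?_
          rw [mem_ball, gw_dist H.hh σ]
          have := cw_le_one H.hr σ
          have := cw_pos H.hr σ
          rw [mem_ball] at hy
          have := dist_nonneg (x := y) (y := x)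
          nlinarith) _ (hne σ)
        rw [hcp] at e1
        have e2 := mul_le_mul_of_nonneg_left (cnt_mono α (Set.image_preimage_subset (gw h σ) W)) hA
        have := hlog σ
        linarith
      have h5 : F [] = - LL α m := by simp [F, gw, LL]
      rw [h5, List.nil_append] at h3
      have h6 := mul_le_mul_of_nonneg_left h4 hT0.le
      simp only [List.length_nil, Nat.cast_zero, zero_add] at h3
      rw [hk]
      rw [← hT] at h3
      linarith
  refine ⟨max (k / T) A, hA.trans (le_max_right _ _), fun α hα => ?_⟩
  have h1 := main α hα
  have h2 := mul_le_mul_of_nonneg_right (le_max_right (k / T) A) (cnt_nonneg α W)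
  have h3 := le_max_left (k / T) A
  linarith

lemma base_mu (H : IFSM h r w w0 m0 m) (hw0 : 0 < w0) (G : Good m A R) (G0 : Good m0 A0 R0)
    (W W0 : Set X) (δ : ℝ) (hδ : 0 < δ) (hδ1 : δ ≤ 1)
    (hWi : ∀ i, h i '' W ⊆ W) (hW0 : W0 ⊆ W)
    (hb : ∀ᵐ x ∂m0, ball x δ ⊆ W0) :
    ∃ C1 : ℝ, 0 ≤ C1 ∧ ∀ α : Finset X, α.Nonempty → - LL α m ≤ C1 + C1 * cnt α W := by
  have hA := G.A_nonneg
  have hA0 := G0.A_nonneg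
  set k := w0 * (- Real.log δ) + ∑ j, w j * (- Real.log (r j)) with hk
  have main : ∀ α : Finset X, α.Nonempty → - LL α m - A0 * cnt α W ≤ k / w0 := by
    intro α0 hα0
    refine fix_lemma {e | ∃ α : Finset X, α.Nonempty ∧ cnt α Set.univ ≤ cnt α0 Set.univ ∧
      e = - LL α m - A0 * cnt α W} ?_ w0 k hw0 ?_ _ ⟨α0, hα0, le_rfl, rfl⟩
    · refine ⟨A * cnt α0 Set.univ, ?_⟩
      rintro _ ⟨α, hα, hc, rfl⟩
      have h1 := G.local_bd (W := Set.univ) one_pos le_rfl (Eventually.of_forall fun x => Set.subset_univ _) α hα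
      rw [Real.log_one] at h1
      have h2 := mul_le_mul_of_nonneg_left hc hA
      have h3 := mul_nonneg hA0 (cnt_nonneg α W)
      linarith
    · rintro B hB _ ⟨α, hα, hc, rfl⟩
      have e0 := H.L_step G α hα
      have e1 := G0.local_bd hδ hδ1 hb α hα
      have e2 : ∀ j, w j * -(Real.log (r j) + LL (pre (sim_inj (H.hr j).1 (H.hh j)) α) m) ≤
          w j * (- Real.log (r j)) + w j * (B + A0 * cnt α W) := by
        intro j
        have hne := pre_nonempty (sim_inj (H.hr j).1 (H.hh j)) (sim_surj (H.hr j).1 (H.hh j)) hα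
        have hcp := cnt_pre (sim_inj (H.hr j).1 (H.hh j)) (sim_surj (H.hr j).1 (H.hh j)) α
        have := hB _ ⟨_, hne, by rw [hcp]; exact (cnt_mono α (Set.subset_univ _)).trans hc, rfl⟩
        rw [hcp] at this
        have e2 := mul_le_mul_of_nonneg_left (cnt_mono α (hWi j)) hA0
        rw [← mul_add]
        refine mul_le_mul_of_nonneg_left ?_ (H.hw j).le
        linarith
      have e3 := Finset.sum_le_sum fun j (_ : j ∈ Finset.univ) => e2 j
      rw [Finset.sum_add_distrib, ← Finset.sum_mul] at e3
      simp only [mul_neg, Finset.sum_neg_distrib] at e3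
      have e4 := mul_le_mul_of_nonneg_left e1 hw0.le
      have e5 := mul_le_mul_of_nonneg_left (mul_le_mul_of_nonneg_left (cnt_mono α hW0) hA0) hw0.le
      have e6 : ∑ j, w j = 1 - w0 := by have := H.hsum; linarith
      rw [e6] at e3
      rw [hk, e0]
      simp only [mul_neg, Finset.sum_neg_distrib] at e4 ⊢
      linarith
  refine ⟨max (k / w0) A0, hA0.trans (le_max_right _ _), fun α hα => ?_⟩
  have h1 := main α hα
  have h2 := mul_le_mul_of_nonneg_right (le_max_right (k / w0) A0) (cnt_nonneg α W)
  have h3 := le_max_left (k / w0) A0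
  linarith
end HelperE

set_option linter.unusedSectionVars false

section HelperF
variable {X : Type*} [NormedAddCommGroup X] [InnerProductSpace ℝ X] [FiniteDimensional ℝ X]
  [MeasurableSpace X] [BorelSpace X]
variable {ι : Type*} [Fintype ι] {h : ι → X → X} {r w : ι → ℝ} {w0 : ℝ} {m0 m : Measure X} {A A0 R R0 : ℝ}

lemma scale_ind (w : ι → ℝ) (κ l : ℝ) (hκ : 0 < κ) (hκw : ∀ j, κ ≤ w j)
    (hl0 : 0 < l) (hl : l < 1) (hwl : ∀ j, w j ≤ l) (P : ℝ → Prop)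
    (hbase : ∀ x, κ ≤ x → x ≤ 1 → P x)
    (hstep : ∀ x, 1 < x → (∀ j, P (w j * x)) → P x) : ∀ x, κ ≤ x → P x := by
  have key : ∀ n : ℕ, ∀ x, κ ≤ x → x * l ^ n ≤ 1 → P x := by
    intro n
    induction n with
    | zero => intro x hx h1; exact hbase x hx (by simpa using h1)
    | succ n ih =>
      intro x hx h1
      rcases le_or_gt x 1 with h2 | h2
      · exact hbase x hx h2
      · refine hstep x h2 fun j => ih _ ?_ ?_
        · have := hκw j
          nlinarith
        · refine le_trans ?_ h1
          rw [pow_succ]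
          have := hwl j
          have hp : 0 ≤ x * l ^ n := by positivity
          nlinarith
  intro x hx
  have hx0 : 0 < x := lt_of_lt_of_le hκ hx
  obtain ⟨n, hn⟩ := exists_pow_lt_of_lt_one (inv_pos.2 hx0) hl
  refine key n x hx ?_
  have := mul_le_mul_of_nonneg_left hn.le hx0.le
  rwa [mul_inv_cancel₀ hx0.ne'] at this

lemma lower_gen (H : IFSM h r w w0 m0 m) (G : Good m A R) (W W0 : Set X) (θ κ l C1 C' B0 : ℝ)
    (hθ : 0 ≤ θ) (hκ : 0 < κ) (hκw : ∀ j, κ ≤ w j)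
    (hl0 : 0 < l) (hl : l < 1) (hwl : ∀ j, w j ≤ l)
    (hC1 : 0 ≤ C1) (hC' : C1 - θ * Real.log κ ≤ C') (hκ1 : κ ≤ 1)
    (hdis : ∀ α, cnt α W0 + ∑ j, cnt α (h j '' W) ≤ cnt α W)
    (hbase : ∀ α : Finset X, α.Nonempty → - LL α m ≤ C1 + C1 * cnt α W)
    (h0 : ∀ x, 1 ≤ x → ∀ α : Finset X, α.Nonempty →
      w0 * (- LL α m0) ≤ w0 * (θ * Real.log x) + B0 + C' / x * cnt α W0)
    (hconst : B0 + ∑ j, w j * (- Real.log (r j) + θ * Real.log (w j)) ≤ w0 * C') :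
    ∀ x, κ ≤ x → ∀ α : Finset X, α.Nonempty →
      - LL α m ≤ θ * Real.log x + C' + C' / x * cnt α W := by
  have hlκ := Real.log_nonpos hκ.le hκ1
  have hC0 : C1 ≤ C' := by nlinarith
  refine scale_ind w κ l hκ hκw hl0 hl hwl (fun x => ∀ α : Finset X, α.Nonempty →
      - LL α m ≤ θ * Real.log x + C' + C' / x * cnt α W) ?_ ?_
  · intro x hx hx1 α hα
    have hx0 : 0 < x := lt_of_lt_of_le hκ hx
    have e1 := hbase α hα
    have e2 := mul_le_mul_of_nonneg_left (Real.log_le_log hκ hx) hθ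
    have e3 : C1 ≤ C' / x := by
      rw [le_div_iff₀ hx0]
      nlinarith
    have e4 := mul_le_mul_of_nonneg_right e3 (cnt_nonneg α W)
    linarith
  · intro x hx IH α hα
    have hx0 : 0 < x := by linarith
    have e0 := H.L_step G α hα
    have e1 := h0 x hx.le α hα
    have e2 : ∀ j, w j * -(Real.log (r j) + LL (pre (sim_inj (H.hr j).1 (H.hh j)) α) m) ≤
          w j * (- Real.log (r j) + θ * Real.log (w j)) + w j * (θ * Real.log x + C') +
            C' / x * cnt α (h j '' W) := by
      intro j
      have hne := pre_nonempty (sim_inj (H.hr j).1 (H.hh j)) (sim_surj (H.hr j).1 (H.hh j)) hα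
      have hcp := cnt_pre (sim_inj (H.hr j).1 (H.hh j)) (sim_surj (H.hr j).1 (H.hh j)) α W
      have i1 := IH j _ hne
      rw [hcp, Real.log_mul (H.hw j).ne' hx0.ne'] at i1
      have i2 := mul_le_mul_of_nonneg_left i1 (H.hw j).le
      have i3 : w j * (C' / (w j * x) * cnt α (h j '' W)) = C' / x * cnt α (h j '' W) := by
        have := (H.hw j).ne'
        field_simp
      linarith
    have e3 := Finset.sum_le_sum fun j (_ : j ∈ Finset.univ) => e2 j
    rw [Finset.sum_add_distrib, Finset.sum_add_distrib, ← Finset.sum_mul, ← Finset.mul_sum] at e3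
    simp only [mul_neg, Finset.sum_neg_distrib] at e3 e1
    have e5 := mul_le_mul_of_nonneg_left (hdis α) (div_nonneg (hC1.trans hC0) hx0.le)
    have e6 : ∑ j, w j = 1 - w0 := by have := H.hsum; linarith
    rw [e6] at e3
    rw [e0]
    linarith

lemma upper_gen [Nonempty ι] (H : IFSM h r w w0 m0 m) (G : Good m A R) (θ κ l D C' B0 : ℝ)
    (hθ : 0 ≤ θ) (hκ : 0 < κ) (hκw : ∀ j, κ ≤ w j)
    (hl0 : 0 < l) (hl : l < 1) (hwl : ∀ j, w j ≤ l) (hD : 1 ≤ D * κ) (hC' : R ≤ C')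
    (h0 : ∀ x, 1 ≤ x → ∃ α0 : Finset X, (α0.card : ℝ) ≤ w0 * D * x ∧
      ∀ α : Finset X, α.Nonempty → α0 ⊆ α → w0 * LL α m0 ≤ - (w0 * (θ * Real.log x)) + B0)
    (hconst : B0 + ∑ j, w j * (Real.log (r j) - θ * Real.log (w j)) ≤ w0 * C') :
    ∀ x, κ ≤ x → ∃ α : Finset X, α.Nonempty ∧ (α.card : ℝ) ≤ D * x ∧
      LL α m ≤ C' - θ * Real.log x := by
  classical
  have := G.pm
  have hD0 : 0 ≤ D := by by_contra hneg; push Not at hneg; nlinarith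
  refine scale_ind w κ l hκ hκw hl0 hl hwl (fun x => ∃ α : Finset X, α.Nonempty ∧
    (α.card : ℝ) ≤ D * x ∧ LL α m ≤ C' - θ * Real.log x) ?_ ?_
  · intro x hx hx1
    have hx0 : 0 < x := lt_of_lt_of_le hκ hx
    refine ⟨{0}, by simp, ?_, ?_⟩
    · simp
      nlinarith
    · have e1 : LL {(0:X)} m ≤ ∫ _, R ∂m := by
        refine integral_mono_ae (G.int_L _ (by simp)) (integrable_const _) ?_
        filter_upwards [G.supp] with x hx
        simp only [Finset.coe_singleton, infDist_singleton, dist_zero_right]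
        exact (Real.log_le_self (norm_nonneg _)).trans hx
      simp at e1
      have := Real.log_nonpos hx0.le hx1
      nlinarith
  · intro x hx IH
    have hx0 : 0 < x := by linarith
    choose α hne hcard hLL using IH
    obtain ⟨α0, hc0, hα0⟩ := h0 x hx.le
    set β := α0 ∪ Finset.univ.biUnion fun j => (α j).image (h j) with hβ
    have hsub : ∀ j, (α j).image (h j) ⊆ β := fun j =>
      (Finset.subset_biUnion_of_mem (fun j => (α j).image (h j)) (Finset.mem_univ j)).trans
        Finset.subset_union_right
    have hβn : β.Nonempty := by
      obtain ⟨j⟩ := ‹Nonempty ι›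
      exact ((hne j).image (h j)).mono (hsub j)
    have e6 : ∑ j, w j = 1 - w0 := by have := H.hsum; linarith
    refine ⟨β, hβn, ?_, ?_⟩
    · have c1 : (β.card : ℝ) ≤ α0.card + ∑ j, ((α j).card : ℝ) := by
        have : β.card ≤ α0.card + ∑ j, (α j).card :=
          (Finset.card_union_le _ _).trans (Nat.add_le_add_left
            (Finset.card_biUnion_le.trans (Finset.sum_le_sum fun j _ => Finset.card_image_le)) _)
        exact_mod_cast this
      have c2 := Finset.sum_le_sum fun j (_ : j ∈ Finset.univ) => hcard j
      rw [← Finset.mul_sum, ← Finset.sum_mul, e6] at c2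
      linarith
    · have e0 := H.L_step G β hβn
      have e1 := hα0 β hβn Finset.subset_union_left
      have e2 : ∀ j, w j * (Real.log (r j) + LL (pre (sim_inj (H.hr j).1 (H.hh j)) β) m) ≤
          w j * (Real.log (r j) - θ * Real.log (w j)) + w j * (C' - θ * Real.log x) := by
        intro j
        have i1 : LL (pre (sim_inj (H.hr j).1 (H.hh j)) β) m ≤ LL (α j) m := by
          refine G.L_mono (hne j) fun a ha => ?_
          simp only [pre, Finset.mem_preimage]
          exact hsub j (Finset.mem_image_of_mem _ ha)
        have i2 := hLL j
        rw [Real.log_mul (H.hw j).ne' hx0.ne'] at i2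
        rw [← mul_add]
        refine mul_le_mul_of_nonneg_left ?_ (H.hw j).le
        linarith
      have e3 := Finset.sum_le_sum fun j (_ : j ∈ Finset.univ) => e2 j
      rw [Finset.sum_add_distrib, ← Finset.sum_mul, e6] at e3
      rw [e0]
      linarith
end HelperF

set_option linter.unusedSectionVars false

section HelperG
variable {X : Type*} [NormedAddCommGroup X] [InnerProductSpace ℝ X] [FiniteDimensional ℝ X]
  [MeasurableSpace X] [BorelSpace X]
variable {ι : Type*} [Fintype ι] {h : ι → X → X} {r w : ι → ℝ} {w0 : ℝ} {m0 m : Measure X} {A A0 R R0 : ℝ}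

lemma nu_lower [Nonempty ι] (H : IFSM h r w 0 m m) (G : Good m A R) (hw1 : ∀ j, w j < 1) (W : Set X)
    (θ C1 : ℝ) (hθ : 0 ≤ θ) (hC1 : 0 ≤ C1) (hW : ∀ j, h j '' W ⊆ W)
    (hd : ∀ i j, i ≠ j → Disjoint (h i '' W) (h j '' W))
    (hbase : ∀ α : Finset X, α.Nonempty → - LL α m ≤ C1 + C1 * cnt α W)
    (hc : ∑ j, w j * (- Real.log (r j) + θ * Real.log (w j)) = 0) :
    ∃ C' : ℝ, 0 ≤ C' ∧ ∀ x : ℝ, 1 ≤ x → ∀ α : Finset X, α.Nonempty →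
      - LL α m ≤ θ * Real.log x + C' + C' / x * α.card := by
  obtain ⟨i0, hi0⟩ := Finite.exists_min w
  obtain ⟨i1, hi1⟩ := Finite.exists_max w
  have hlk := Real.log_nonpos (H.hw i0).le (hw1 i0).le
  have hC' : 0 ≤ C1 - θ * Real.log (w i0) := by nlinarith
  have key := lower_gen H G W ∅ θ (w i0) (w i1) C1 (C1 - θ * Real.log (w i0)) 0 hθ (H.hw i0) hi0
    (H.hw i1) (hw1 i1) hi1 hC1 le_rfl (hw1 i0).le (fun α => cnt_disj α W ∅ _ (Set.empty_subset _) hW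
      (fun j => Set.empty_disjoint _) hd) hbase (fun x hx α hα => by
        simp [cnt]) (by rw [hc]; simp)
  refine ⟨_, hC', fun x hx α hα => (key x ((hw1 i0).le.trans hx) α hα).trans ?_⟩
  have := mul_le_mul_of_nonneg_left (cnt_le_card α W) (div_nonneg hC' (by linarith : (0:ℝ) ≤ x))
  linarith

lemma nu_upper [Nonempty ι] (H : IFSM h r w 0 m m) (G : Good m A R) (hw1 : ∀ j, w j < 1)
    (θ : ℝ) (hθ : 0 ≤ θ)
    (hc : ∑ j, w j * (- Real.log (r j) + θ * Real.log (w j)) = 0) :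
    ∃ C' D : ℝ, ∀ x : ℝ, 1 ≤ x → ∃ α : Finset X, α.Nonempty ∧ (α.card : ℝ) ≤ D * x ∧
      LL α m ≤ C' - θ * Real.log x := by
  obtain ⟨i0, hi0⟩ := Finite.exists_min w
  obtain ⟨i1, hi1⟩ := Finite.exists_max w
  have key := upper_gen H G θ (w i0) (w i1) (1 / w i0) R 0 hθ (H.hw i0) hi0
    (H.hw i1) (hw1 i1) hi1 (by rw [one_div_mul_cancel (H.hw i0).ne']) le_rfl
    (fun x hx => ⟨∅, by simp, fun α hα _ => by simp⟩) (by
      have : ∑ j, w j * (Real.log (r j) - θ * Real.log (w j)) =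
        - ∑ j, w j * (- Real.log (r j) + θ * Real.log (w j)) := by
        rw [← Finset.sum_neg_distrib]
        exact Finset.sum_congr rfl fun j _ => by ring
      rw [this, hc]; simp)
  exact ⟨R, 1 / w i0, fun x hx => key x ((hw1 i0).le.trans hx)⟩

lemma nu_local (G : Good m A R) (hR : 0 ≤ R) (W0 : Set X) (R' : ℝ) (hR' : 0 ≤ R') (hW0 : ∀ x ∈ W0, ‖x‖ ≤ R')
    (δ : ℝ) (hδ : 0 < δ) (hδ1 : δ ≤ 1)
    (hb : ∀ᵐ x ∂m, ball x δ ⊆ W0) (θ C : ℝ) (hθ : 0 ≤ θ) (hC : 0 ≤ C)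
    (hl : ∀ x : ℝ, 1 ≤ x → ∀ α : Finset X, α.Nonempty →
      - LL α m ≤ θ * Real.log x + C + C / x * α.card) :
    ∃ K : ℝ, 0 ≤ K ∧ ∀ x : ℝ, 1 ≤ x → ∀ α : Finset X, α.Nonempty →
      - LL α m ≤ θ * Real.log x + K + C / x * cnt α W0 := by
  classical
  have := G.pm
  have hlδ := Real.log_nonpos hδ.le hδ1
  refine ⟨R + R' - Real.log δ + C, by linarith, fun x hx α hα => ?_⟩
  have hlx := mul_nonneg hθ (Real.log_nonneg hx)
  set β := α.filter (· ∈ W0) with hβ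
  have hcard : (β.card : ℝ) = cnt α W0 := by
    simp only [cnt, Set.indicator_apply, Finset.sum_boole, hβ]
  rcases β.eq_empty_or_nonempty with he | hne
  · have h1 := G.local_bd hδ hδ1 hb α hα
    rw [he] at hcard
    simp at hcard
    rw [← hcard] at h1 ⊢
    linarith
  · have h1 := hl x hx β hne
    rw [hcard] at h1
    have h2 : ∫ x, - Real.log (infDist x (↑α : Set X)) ∂m ≤
        ∫ x, ((R + R' - Real.log δ) + - Real.log (infDist x (↑β : Set X))) ∂m := by
      refine integral_mono_ae (G.int_L α hα).neg ((integrable_const _).add (G.int_L β hne).neg) ?_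
      filter_upwards [hb, G.supp, G.pos β hne] with y hy hyR hpos
      obtain ⟨a, ha, e⟩ := exists_min_dist α hα y
      rw [e]
      by_cases haW : a ∈ W0
      · have : infDist y (↑β : Set X) ≤ dist y a :=
          infDist_le_dist_of_mem (by simpa [hβ] using ⟨ha, haW⟩)
        have := Real.log_le_log hpos this
        linarith
      · have h4 : δ ≤ dist y a := by
          by_contra hlt
          push Not at hlt
          exact haW (hy (by rwa [mem_ball, dist_comm]))
        have h5 := Real.log_le_log hδ h4
        obtain ⟨b, hbm⟩ := hne
        have h6 : infDist y (↑β : Set X) ≤ dist y b := infDist_le_dist_of_mem (by simpa using hbm)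
        have h7 := Real.log_le_self (infDist_nonneg (x := y) (s := (↑β : Set X)))
        have h8 := dist_le_norm_add_norm y b
        have h9 := hW0 b (Finset.mem_filter.1 hbm).2
        linarith
    have e3 : Integrable (fun x => - Real.log (infDist x (↑β : Set X))) m := (G.int_L β hne).neg
    rw [integral_neg, integral_add (integrable_const _) e3, integral_neg] at h2
    simp only [integral_const, probReal_univ, smul_eq_mul, one_mul] at h2
    simp only [LL] at h1 ⊢
    linarith

lemma mu_lower [Nonempty ι] (H : IFSM h r w w0 m0 m) (hw0 : 0 < w0) (G : Good m A R)
    (hw1 : ∀ j, w j < 1) (W W0 : Set X)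
    (θ C1 K C : ℝ) (hθ : 0 ≤ θ) (hC1 : 0 ≤ C1)
    (hdis : ∀ α, cnt α W0 + ∑ j, cnt α (h j '' W) ≤ cnt α W)
    (hbase : ∀ α : Finset X, α.Nonempty → - LL α m ≤ C1 + C1 * cnt α W)
    (hl : ∀ x : ℝ, 1 ≤ x → ∀ α : Finset X, α.Nonempty →
      - LL α m0 ≤ θ * Real.log x + K + C / x * cnt α W0) :
    ∃ C' : ℝ, 0 ≤ C' ∧ ∀ x : ℝ, 1 ≤ x → ∀ α : Finset X, α.Nonempty →
      - LL α m ≤ θ * Real.log x + C' + C' / x * α.card := by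
  obtain ⟨i0, hi0⟩ := Finite.exists_min w
  obtain ⟨i1, hi1⟩ := Finite.exists_max w
  have hlk := Real.log_nonpos (H.hw i0).le (hw1 i0).le
  set S0 := w0 * K + ∑ j, w j * (- Real.log (r j) + θ * Real.log (w j)) with hS0
  set C' := max (max (C1 - θ * Real.log (w i0)) (w0 * C)) (S0 / w0) with hC'
  have h1 : C1 - θ * Real.log (w i0) ≤ C' := (le_max_left _ _).trans (le_max_left _ _)
  have h2 : w0 * C ≤ C' := (le_max_right _ _).trans (le_max_left _ _)
  have h3 : S0 / w0 ≤ C' := le_max_right _ _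
  have hC0 : 0 ≤ C' := by nlinarith
  have key := lower_gen H G W W0 θ (w i0) (w i1) C1 C' (w0 * K) hθ (H.hw i0) hi0
    (H.hw i1) (hw1 i1) hi1 hC1 h1 (hw1 i0).le hdis hbase (fun x hx α hα => by
      have hx0 : 0 < x := by linarith
      have e1 := mul_le_mul_of_nonneg_left (hl x hx α hα) hw0.le
      have e2 := mul_le_mul_of_nonneg_right (div_le_div_of_nonneg_right h2 hx0.le) (cnt_nonneg α W0)
      have e3 : w0 * C / x * cnt α W0 = w0 * (C / x * cnt α W0) := by ring
      linarith) (by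
      rw [div_le_iff₀ hw0] at h3
      linarith)
  refine ⟨_, hC0, fun x hx α hα => (key x ((hw1 i0).le.trans hx) α hα).trans ?_⟩
  have := mul_le_mul_of_nonneg_left (cnt_le_card α W) (div_nonneg hC0 (by linarith : (0:ℝ) ≤ x))
  linarith

lemma mu_upper [Nonempty ι] (H : IFSM h r w w0 m0 m) (hw0 : 0 < w0) (G : Good m A R)
    (G0 : Good m0 A0 R0)
    (hw1 : ∀ j, w j < 1) (θ : ℝ) (hθ : 0 ≤ θ)
    (hu : ∃ C' D : ℝ, ∀ x : ℝ, 1 ≤ x → ∃ α : Finset X, α.Nonempty ∧ (α.card : ℝ) ≤ D * x ∧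
      LL α m0 ≤ C' - θ * Real.log x) :
    ∃ C' D : ℝ, 0 < D ∧ ∀ x : ℝ, 1 ≤ x → ∃ α : Finset X, α.Nonempty ∧ (α.card : ℝ) ≤ D * x ∧
      LL α m ≤ C' - θ * Real.log x := by
  obtain ⟨i0, hi0⟩ := Finite.exists_min w
  obtain ⟨i1, hi1⟩ := Finite.exists_max w
  obtain ⟨C, D, hu⟩ := hu
  set S0 := w0 * C + ∑ j, w j * (Real.log (r j) - θ * Real.log (w j)) with hS0
  set D' := max (D / w0) (1 / w i0) with hD'
  have hD1 : D ≤ w0 * D' := by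
    have := le_max_left (D / w0) (1 / w i0)
    rw [div_le_iff₀ hw0] at this
    linarith
  have hD2 : 1 ≤ D' * w i0 := by
    have := le_max_right (D / w0) (1 / w i0)
    rwa [div_le_iff₀ (H.hw i0)] at this
  have h3 : S0 / w0 ≤ max R (S0 / w0) := le_max_right _ _
  rw [div_le_iff₀ hw0] at h3
  have key := upper_gen H G θ (w i0) (w i1) D' (max R (S0 / w0)) (w0 * C) hθ (H.hw i0) hi0
    (H.hw i1) (hw1 i1) hi1 hD2 (le_max_left _ _)
    (fun x hx => by
      obtain ⟨α0, hne, hcard, hLL⟩ := hu x hx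
      refine ⟨α0, hcard.trans (mul_le_mul_of_nonneg_right hD1 (by linarith)), fun α hα hs => ?_⟩
      have := mul_le_mul_of_nonneg_left ((G0.L_mono hne hs).trans hLL) hw0.le
      linarith) (by linarith)
  exact ⟨_, D', lt_of_lt_of_le (one_div_pos.2 (H.hw i0)) (le_max_right _ _),
    fun x hx => key x ((hw1 i0).le.trans hx)⟩
end HelperG

set_option linter.unusedSectionVars false

section HelperH

lemma final_asym (e : ℕ → ℝ) (d a b : ℝ) (hd : 0 < d)
    (hl : ∀ᶠ n : ℕ in atTop, Real.exp (a - (1 / d) * Real.log n) ≤ e n)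
    (hu : ∀ᶠ n : ℕ in atTop, e n ≤ Real.exp (b - (1 / d) * Real.log n)) :
    0 < liminf (fun n : ℕ => ENNReal.ofReal ((n : ℝ) ^ (1 / d) * e n)) atTop ∧
    limsup (fun n : ℕ => ENNReal.ofReal ((n : ℝ) ^ (1 / d) * e n)) atTop < ⊤ ∧
    Tendsto (fun n : ℕ => Real.log n / (-Real.log (e n))) atTop (nhds d) := by
  have hpw : ∀ n : ℕ, 1 ≤ n → ∀ c, (n : ℝ) ^ (1 / d) * Real.exp (c - (1 / d) * Real.log n) = Real.exp c := by
    intro n hn c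
    have hn0 : (0:ℝ) < n := by exact_mod_cast hn
    rw [Real.rpow_def_of_pos hn0, ← Real.exp_add]
    congr 1; ring
  refine ⟨?_, ?_, ?_⟩
  · refine lt_of_lt_of_le (b := ENNReal.ofReal (Real.exp a)) (by simpa using Real.exp_pos a) ?_
    refine le_liminf_of_le (by isBoundedDefault) ?_
    filter_upwards [hl, eventually_ge_atTop 1] with n hn h1
    apply ENNReal.ofReal_le_ofReal
    rw [← hpw n h1 a]
    exact mul_le_mul_of_nonneg_left hn (by positivity)
  · refine lt_of_le_of_lt (b := ENNReal.ofReal (Real.exp b)) ?_ ENNReal.ofReal_lt_top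
    refine limsup_le_of_le (by isBoundedDefault) ?_
    filter_upwards [hu, eventually_ge_atTop 1] with n hn h1
    apply ENNReal.ofReal_le_ofReal
    rw [← hpw n h1 b]
    exact mul_le_mul_of_nonneg_left hn (by positivity)
  · have hlog : Tendsto (fun n : ℕ => Real.log n) atTop atTop :=
      Real.tendsto_log_atTop.comp tendsto_natCast_atTop_atTop
    have hlim : ∀ c : ℝ, Tendsto (fun n : ℕ => 1 / d - c / Real.log n) atTop (nhds (1 / d)) := by
      intro c
      have := (tendsto_const_nhds (x := (1/d : ℝ))).sub (hlog.const_div_atTop c)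
      simpa using this
    have key : Tendsto (fun n : ℕ => (-Real.log (e n)) / Real.log n) atTop (nhds (1 / d)) := by
      refine tendsto_of_tendsto_of_tendsto_of_le_of_le' (hlim b) (hlim a) ?_ ?_
      · filter_upwards [hl, hu, hlog.eventually_gt_atTop 0] with n h1 h2 h3
        have hp := (Real.exp_pos _).trans_le h1
        have := Real.log_le_log hp h2
        rw [Real.log_exp] at this
        rw [le_div_iff₀ h3, sub_mul, div_mul_cancel₀ _ h3.ne']
        linarith
      · filter_upwards [hl, hu, hlog.eventually_gt_atTop 0] with n h1 h2 h3
        have := Real.log_le_log (Real.exp_pos _) h1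
        rw [Real.log_exp] at this
        rw [div_le_iff₀ h3, sub_mul, div_mul_cancel₀ _ h3.ne']
        linarith
    have := key.inv₀ (one_div_pos.2 hd).ne'
    simpa [inv_div] using this

variable {q : ℕ}

lemma geom_lower (P : Measure (EuclideanSpace ℝ (Fin q))) (θ C : ℝ) (hC : 0 ≤ C)
    (hl : ∀ x : ℝ, 1 ≤ x → ∀ α : Finset (EuclideanSpace ℝ (Fin q)), α.Nonempty →
      - LL α P ≤ θ * Real.log x + C + C / x * α.card) :
    ∀ᶠ n : ℕ in atTop, Real.exp (-(2 * C) - θ * Real.log n) ≤ geomError P n := by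
  filter_upwards [eventually_ge_atTop 1] with n hn
  have hn1 : (1:ℝ) ≤ n := by exact_mod_cast hn
  refine le_csInf ⟨_, {0}, by simp, by simpa using hn, rfl⟩ ?_
  rintro _ ⟨α, hα, hc, rfl⟩
  apply Real.exp_le_exp.2
  have h1 := hl n hn1 α hα
  have h2 : C / n * α.card ≤ C := by
    have : (α.card : ℝ) ≤ n := by exact_mod_cast hc
    rw [div_mul_eq_mul_div, div_le_iff₀ (by linarith)]
    exact mul_le_mul_of_nonneg_left this hC
  simp only [LL] at h1
  linarith

lemma geom_upper (P : Measure (EuclideanSpace ℝ (Fin q))) (θ C D : ℝ) (hD : 0 < D)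
    (hu : ∀ x : ℝ, 1 ≤ x → ∃ α : Finset (EuclideanSpace ℝ (Fin q)), α.Nonempty ∧ (α.card : ℝ) ≤ D * x ∧
      LL α P ≤ C - θ * Real.log x) :
    ∀ᶠ n : ℕ in atTop, geomError P n ≤ Real.exp (C + θ * Real.log D - θ * Real.log n) := by
  have h1 := (tendsto_natCast_atTop_atTop (R := ℝ)).eventually_ge_atTop D
  filter_upwards [h1] with n hn
  have hn0 : (0:ℝ) < n := lt_of_lt_of_le hD hn
  obtain ⟨α, hα, hc, hL⟩ := hu (n / D) (by rwa [le_div_iff₀ hD, one_mul])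
  rw [mul_div_cancel₀ _ hD.ne'] at hc
  rw [Real.log_div hn0.ne' hD.ne'] at hL
  have hle : geomError P n ≤ Real.exp (LL α P) := by
    refine csInf_le ⟨0, ?_⟩ ⟨α, hα, by exact_mod_cast hc, rfl⟩
    rintro _ ⟨α, hα, hc, rfl⟩
    exact (Real.exp_pos _).le
  refine hle.trans (Real.exp_le_exp.2 ?_)
  linarith

lemma msupport_ae (P : Measure (EuclideanSpace ℝ (Fin q))) : ∀ᵐ x ∂P, x ∈ msupport P := by
  rw [ae_iff]
  refine measure_null_of_locally_null _ fun x hx => ?_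
  simp only [msupport, Set.mem_ofPred_eq] at hx
  push Not at hx
  obtain ⟨U, hU, hxU, h0⟩ := hx
  exact ⟨U, mem_nhdsWithin_of_mem_nhds (hU.mem_nhds hxU), h0⟩

lemma msupport_closed (P : Measure (EuclideanSpace ℝ (Fin q))) : IsClosed (msupport P) := by
  rw [← isOpen_compl_iff, isOpen_iff_forall_mem_open]
  intro x hx
  simp only [msupport, Set.mem_compl_iff, Set.mem_ofPred_eq] at hx
  push Not at hx
  obtain ⟨U, hU, hxU, h0⟩ := hx
  exact ⟨U, fun y hy hs => hs U hU hy h0, hU, hxU⟩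

end HelperH

theorem stmt1 (q N M : ℕ) (hq : 1 ≤ q) (hN : 2 ≤ N) (hM : 2 ≤ M)
    (f : Fin N → EuclideanSpace ℝ (Fin q) → EuclideanSpace ℝ (Fin q))
    (s : Fin N → ℝ) (hs : ∀ i, s i ∈ Set.Ioo (0 : ℝ) 1)
    (hf : ∀ i x y, dist (f i x) (f i y) = s i * dist x y)
    (hOSCf : ∃ V : Set (EuclideanSpace ℝ (Fin q)), V.Nonempty ∧ IsOpen V ∧
      Bornology.IsBounded V ∧
      (∀ i j, i ≠ j → Disjoint (f i '' V) (f j '' V)) ∧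
      (⋃ i, f i '' V) ⊆ V)
    (E : Set (EuclideanSpace ℝ (Fin q))) (hEc : IsCompact E) (hEne : E.Nonempty)
    (hE : E = ⋃ i, f i '' E)
    (g : Fin M → EuclideanSpace ℝ (Fin q) → EuclideanSpace ℝ (Fin q))
    (c : Fin M → ℝ) (hc : ∀ i, c i ∈ Set.Ioo (0 : ℝ) 1)
    (hg : ∀ i x y, dist (g i x) (g i y) = c i * dist x y)
    (hOSCg : ∃ V : Set (EuclideanSpace ℝ (Fin q)), V.Nonempty ∧ IsOpen V ∧
      Bornology.IsBounded V ∧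
      (∀ i j, i ≠ j → Disjoint (g i '' V) (g j '' V)) ∧
      (⋃ i, g i '' V) ⊆ V)
    (t : Fin M → ℝ) (ht : ∀ i, 0 < t i) (htsum : ∑ i, t i = 1)
    (ν : Measure (EuclideanSpace ℝ (Fin q))) (hνp : IsProbabilityMeasure ν)
    (hν : ν = ∑ i, ENNReal.ofReal (t i) • ν.map (g i))
    (C : Set (EuclideanSpace ℝ (Fin q))) (hC : C = msupport ν)
    (p : Fin (N + 1) → ℝ) (hp : ∀ i, 0 < p i) (hpsum : ∑ i, p i = 1)
    (μ : Measure (EuclideanSpace ℝ (Fin q))) (hμp : IsProbabilityMeasure μ)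
    (hμ : μ = ENNReal.ofReal (p 0) • ν + ∑ i : Fin N, ENNReal.ofReal (p i.succ) • μ.map (f i))
    -- the in-homogeneous open set condition
    (U : Set (EuclideanSpace ℝ (Fin q))) (hUne : U.Nonempty) (hUo : IsOpen U)
    (hUb : Bornology.IsBounded U)
    (hIOSC1 : ∀ i, f i '' U ⊆ U)
    (hIOSC2 : ∀ i j, i ≠ j → Disjoint (f i '' U) (f j '' U))
    (hIOSC3 : (E ∩ U).Nonempty ∧ C ⊆ U)
    (hIOSC4 : ν (frontier U) = 0 ∧ ∀ i, C ∩ (f i '' closure U) = ∅)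
    (d₀ : ℝ) (hd₀ : d₀ = (∑ i, t i * Real.log (t i)) / (∑ i, t i * Real.log (c i))) :
    0 < liminf (fun n : ℕ => ENNReal.ofReal ((n : ℝ) ^ (1 / d₀) * geomError μ n)) atTop ∧
    limsup (fun n : ℕ => ENNReal.ofReal ((n : ℝ) ^ (1 / d₀) * geomError μ n)) atTop < ⊤ ∧
    Tendsto (fun n : ℕ => Real.log n / (-Real.log (geomError μ n))) atTop (nhds d₀) := by
  have hM0 : 0 < M := by omega
  have hN0 : 0 < N := by omega
  haveI : Nonempty (Fin M) := ⟨⟨0, hM0⟩⟩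
  haveI : Nonempty (Fin N) := ⟨⟨0, hN0⟩⟩
  -- parameters
  have ht1 : ∀ i, t i < 1 := by
    intro i
    haveI : Nontrivial (Fin M) := Fin.nontrivial_iff_two_le.2 hM
    obtain ⟨j, hj⟩ := exists_ne i
    have := Finset.add_le_sum (f := t) (fun k _ => (ht k).le) (Finset.mem_univ i) (Finset.mem_univ j) hj.symm
    have := ht j
    linarith
  have hp1 : ∀ i : Fin N, p i.succ < 1 := by
    intro i
    have := Finset.add_le_sum (f := p) (fun k _ => (hp k).le) (Finset.mem_univ (0 : Fin (N+1)))
      (Finset.mem_univ i.succ) (Fin.succ_ne_zero i).symm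
    have := hp 0
    linarith
  have hS1 : ∑ i, t i * Real.log (t i) < 0 := Finset.sum_neg (fun i _ =>
    mul_neg_of_pos_of_neg (ht i) (Real.log_neg (ht i) (ht1 i))) Finset.univ_nonempty
  have hS2 : ∑ i, t i * Real.log (c i) < 0 := Finset.sum_neg (fun i _ =>
    mul_neg_of_pos_of_neg (ht i) (Real.log_neg (hc i).1 (hc i).2)) Finset.univ_nonempty
  have hd0 : 0 < d₀ := by rw [hd₀]; exact div_pos_of_neg_of_neg hS1 hS2
  have hθ : 0 ≤ 1 / d₀ := (one_div_pos.2 hd0).le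
  have hconst : ∑ j, t j * (- Real.log (c j) + (1 / d₀) * Real.log (t j)) = 0 := by
    have e : ∑ j, t j * (- Real.log (c j) + (1 / d₀) * Real.log (t j)) =
        - ∑ i, t i * Real.log (c i) + (1 / d₀) * ∑ i, t i * Real.log (t i) := by
      rw [Finset.mul_sum, ← Finset.sum_neg_distrib, ← Finset.sum_add_distrib]
      exact Finset.sum_congr rfl fun j _ => by ring
    rw [e, hd₀]
    have := hS1.ne
    have := hS2.ne
    field_simp
    ring
  -- systems
  have Hν : IFSM g c t 0 ν ν := ⟨hc, hg, ht, le_rfl, by rw [htsum, zero_add], hνp, hνp, by simpa using hν⟩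
  have Hμ : IFSM f s (fun i => p i.succ) (p 0) ν μ := ⟨hs, hf, fun i => hp _, (hp 0).le,
    by rw [← Fin.sum_univ_succ, hpsum], hμp, hνp, hμ⟩
  obtain ⟨R1, hR1, hR1'⟩ := exists_R g c hc hg
  obtain ⟨R2, hR2, hR2'⟩ := exists_R f s hs hf
  set R := max R1 R2 with hRdef
  have hR0 : 0 ≤ R := hR1.trans (le_max_left _ _)
  have hRg := hR1' R (le_max_left _ _)
  have hRf := hR2' R (le_max_right _ _)
  have hsν := Hν.supp R hRg (Or.inl rfl)
  have hsμ := Hμ.supp R hRf (Or.inr hsν)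
  obtain ⟨V, hVn, hVo, -, hVd, hVs⟩ := hOSCg
  have hVi : ∀ i, g i '' V ⊆ V := fun i => (Set.subset_iUnion (fun i => g i '' V) i).trans hVs
  -- potentials
  have hpν : ∃ A, PotB ν A := by
    obtain ⟨σ, τ, δ, hδ, hδ1, hsep⟩ := two_cells (⟨0, hM0⟩ : Fin M) ⟨1, by omega⟩
      (by simp) hc hg hVo hVn hVi hVd R hR0
    exact Hν.pot_nu R hsν σ τ δ hδ hδ1 hsep
  obtain ⟨A, hA⟩ := hpν
  obtain ⟨A', hA'⟩ := Hμ.pot_mu (hp 0) A hA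
  have Gν : Good ν A R := ⟨hνp, hsν, hA⟩
  have Gμ : Good μ A' R := ⟨hμp, hsμ, hA'⟩
  -- bounds for ν
  obtain ⟨W, σ, δ, hδ, hδ1, hWi, hWd, hWb⟩ := schief hc hg hVo hVn hVi hVd R hR0 (norm_le_of hRg)
  obtain ⟨C1, hC1, hbase⟩ := base_nu Hν Gν W σ δ hδ hδ1 hWi hWb
  obtain ⟨Cν, hCν, hlν⟩ := nu_lower Hν Gν ht1 W (1 / d₀) C1 hθ hC1 hWi hWd hbase hconst
  have huν := nu_upper Hν Gν ht1 (1 / d₀) hθ hconst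
  -- separation of the support
  set W0 : Set (EuclideanSpace ℝ (Fin q)) := U \ ⋃ i, f i '' closure U with hW0
  have hUc : IsCompact (closure U) := hUb.isCompact_closure
  have hW0o : IsOpen W0 := hUo.sdiff (isClosed_iUnion_of_finite fun i =>
    (hUc.image (sim_cont (hs i).1 (hf i))).isClosed)
  have hCW : msupport ν ⊆ W0 := by
    intro x hx
    rw [← hC] at hx
    refine ⟨hIOSC3.2 hx, fun h => ?_⟩
    obtain ⟨i, hi⟩ := Set.mem_iUnion.1 h
    have : x ∈ C ∩ (f i '' closure U) := ⟨hx, hi⟩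
    rw [hIOSC4.2 i] at this
    exact this
  have hcomp : IsCompact (msupport ν) := Metric.isCompact_of_isClosed_isBounded (msupport_closed ν)
    (hUb.subset (hCW.trans Set.diff_subset))
  obtain ⟨δ1, hδ1p, hδ1s⟩ := hcomp.exists_thickening_subset_open hW0o hCW
  have hball : ∀ᵐ x ∂ν, ball x (min δ1 1) ⊆ W0 := by
    filter_upwards [msupport_ae ν] with x hx
    exact ((ball_subset_ball (min_le_left _ _)).trans (ball_subset_thickening hx δ1)).trans hδ1s
  have hδ0 : 0 < min δ1 1 := lt_min hδ1p one_pos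
  obtain ⟨R', hR'⟩ := hUb.exists_norm_le
  have hW0b : ∀ x ∈ W0, ‖x‖ ≤ max R' 0 := fun x hx => (hR' x hx.1).trans (le_max_left _ _)
  obtain ⟨K, hK, hloc⟩ := nu_local Gν hR0 W0 (max R' 0) (le_max_right _ _) hW0b (min δ1 1) hδ0
    (min_le_right _ _) hball (1 / d₀) Cν hθ hCν hlν
  obtain ⟨C2, hC2, hbase2⟩ := base_mu Hμ (hp 0) Gμ Gν U W0 (min δ1 1) hδ0 (min_le_right _ _)
    hIOSC1 Set.diff_subset hball
  have hdis : ∀ α, cnt α W0 + ∑ j, cnt α (f j '' U) ≤ cnt α U := fun α =>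
    cnt_disj α U W0 _ Set.diff_subset hIOSC1 (fun j => Set.disjoint_left.2 fun x hx hxj =>
      hx.2 (Set.mem_iUnion.2 ⟨j, Set.image_mono subset_closure hxj⟩)) hIOSC2
  obtain ⟨C', hC', hlμ⟩ := mu_lower Hμ (hp 0) Gμ hp1 U W0 (1 / d₀) C2 K Cν hθ hC2 hdis hbase2 hloc
  obtain ⟨C'', D, hD, huμ⟩ := mu_upper Hμ (hp 0) Gμ Gν hp1 (1 / d₀) hθ huν
  exact final_asym (geomError μ) d₀ _ _ hd0 (geom_lower μ (1 / d₀) C' hC' hlμ)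
    (geom_upper μ (1 / d₀) C'' D hD huμ)
end
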